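/- arXiv:2201.05485 — 2 statements merged into one kernel-verified Lean document; each statement's English description precedes it below -/
import Mathlib

section
/- Fix q ≥ 1 and λ > 0. Then the free energy limit holds: lim_{n→∞} (1/n) log Z_{n,λ,q} = sup_{θ∈[0,1]} Φ(θ,λ,q). -/
open Filter Topology Set

noncomputable section

/-- Size of the connected component of `K_n(ω)` containing the vertex `v`. -/
def compSize {n : ℕ} (G : SimpleGraph (Fin n)) (v : Fin n) : ℕ :=
  (G.connectedComponentMk v).supp.ncard

/-- Random cluster weight of a configuration `G` on the complete graph `K_m`,
with edge weight `p` and cluster weight `q`. -/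
def rcW (m : ℕ) (p q : ℝ) (G : SimpleGraph (Fin m)) : ℝ :=
  p ^ G.edgeSet.ncard * (1 - p) ^ (m * (m - 1) / 2 - G.edgeSet.ncard) *
    q ^ Nat.card G.ConnectedComponent

/-- Total random-cluster weight of an event, with explicit edge weight `p`. -/
def ZP (m : ℕ) (p q : ℝ) (A : Set (SimpleGraph (Fin m))) : ℝ :=
  ∑ᶠ G ∈ A, rcW m p q G

/-- `Z_{n,λ,q}[A]`, i.e. the total weight of the event `A` with `p = λ/n`. -/
def Zrc (n : ℕ) (lam q : ℝ) (A : Set (SimpleGraph (Fin n))) : ℝ :=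
  ZP n (lam / n) q A

/-- The partition function `Z_{n,λ,q}`. -/
def Ztot (n : ℕ) (lam q : ℝ) : ℝ := Zrc n lam q Set.univ

/-- The random cluster probability `φ_{n,λ,q}[A]`. -/
def phiRC (n : ℕ) (lam q : ℝ) (A : Set (SimpleGraph (Fin n))) : ℝ :=
  Zrc n lam q A / Ztot n lam q

/-- The event `K` that the configuration is connected. -/
def Kev (n : ℕ) : Set (SimpleGraph (Fin n)) := {G | G.Connected}

/-- The event `B_r` that no connected component has size larger than `r`. -/
def Bev (n : ℕ) (r : ℝ) : Set (SimpleGraph (Fin n)) :=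
  {G | ∀ v, (compSize G v : ℝ) ≤ r}

/-- The event `L` that the configuration is acyclic. -/
def Lev (n : ℕ) : Set (SimpleGraph (Fin n)) := {G | G.IsAcyclic}

/-- The set `V_r` of vertices lying in components of size larger than `r`. -/
def Vbig {n : ℕ} (G : SimpleGraph (Fin n)) (r : ℝ) : Set (Fin n) :=
  {v | r < (compSize G v : ℝ)}

/-- The number `N_r` of connected components of size larger than `r`. -/
def Nbig {n : ℕ} (G : SimpleGraph (Fin n)) (r : ℝ) : ℕ :=
  {C : G.ConnectedComponent | r < (C.supp.ncard : ℝ)}.ncard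

def pi1 (x : ℝ) : ℝ := 1 - Real.exp (-x)

def Psi (x : ℝ) : ℝ := min (Real.log x - (x - 1/x) / 2) 0

def Sent (θ : ℝ) : ℝ := θ * Real.log θ + (1 - θ) * Real.log (1 - θ)

def Phi (θ lam q : ℝ) : ℝ :=
  -Sent θ + (1 - θ) * Real.log (1 - pi1 (lam * θ)) + θ * Real.log (pi1 (lam * θ)) +
    (1 - θ) * (Psi (lam * (1 - θ) / q) - ((q - 1) / (2 * q)) * (lam * (1 - θ)) + Real.log q)

set_option linter.unusedSectionVars false

/-! ### Product Bernoulli expectations over finite sets -/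

/-- Expectation of `f ω` when `ω ⊆ E` is a random subset with density `p`. -/
def Ex {α : Type*} (p : ℝ) (E : Finset α) (f : Finset α → ℝ) : ℝ :=
  ∑ ω ∈ E.powerset, p ^ ω.card * (1 - p) ^ (E.card - ω.card) * f ω

section Ex
variable {α : Type*} [DecidableEq α] {p : ℝ}

lemma Ex_congr {E : Finset α} {f g : Finset α → ℝ} (h : ∀ ω, ω ⊆ E → f ω = g ω) :
    Ex p E f = Ex p E g := by
  unfold Ex
  refine Finset.sum_congr rfl fun ω hω => ?_
  rw [h ω (Finset.mem_powerset.1 hω)]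

lemma Ex_mono (hp : 0 ≤ p) (hp1 : p ≤ 1) {E : Finset α} {f g : Finset α → ℝ}
    (h : ∀ ω, ω ⊆ E → f ω ≤ g ω) : Ex p E f ≤ Ex p E g := by
  unfold Ex
  refine Finset.sum_le_sum fun ω hω => ?_
  have : 0 ≤ 1 - p := by linarith
  exact mul_le_mul_of_nonneg_left (h ω (Finset.mem_powerset.1 hω)) (by positivity)

lemma Ex_pow (E : Finset α) (a : ℝ) : Ex p E (fun ω => a ^ ω.card) = (p * a + (1 - p)) ^ E.card := by
  rw [← Finset.sum_pow_mul_eq_add_pow]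
  unfold Ex
  refine Finset.sum_congr rfl fun ω hω => ?_
  rw [mul_pow]; ring

lemma Ex_const (E : Finset α) (c : ℝ) : Ex p E (fun _ => c) = c := by
  have h := Ex_pow (p := p) E 1
  unfold Ex at *
  simp only [one_pow, mul_one] at h
  rw [← Finset.sum_mul, h]; simp

lemma Ex_mul_right (E : Finset α) (f : Finset α → ℝ) (c : ℝ) :
    Ex p E (fun ω => f ω * c) = Ex p E f * c := by
  unfold Ex
  rw [Finset.sum_mul]
  exact Finset.sum_congr rfl fun ω _ => by ring

lemma Ex_add (E : Finset α) (f g : Finset α → ℝ) :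
    Ex p E (fun ω => f ω + g ω) = Ex p E f + Ex p E g := by
  unfold Ex
  rw [← Finset.sum_add_distrib]
  exact Finset.sum_congr rfl fun ω _ => by ring

lemma Ex_sum {ι : Type*} (E : Finset α) (I : Finset ι) (f : ι → Finset α → ℝ) :
    Ex p E (fun ω => ∑ i ∈ I, f i ω) = ∑ i ∈ I, Ex p E (f i) := by
  unfold Ex
  rw [Finset.sum_comm]
  exact Finset.sum_congr rfl fun ω _ => by rw [Finset.mul_sum]

lemma Ex_empty (f : Finset α → ℝ) : Ex p ∅ f = f ∅ := by simp [Ex]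

lemma Ex_insert {e : α} {E : Finset α} (he : e ∉ E) (f : Finset α → ℝ) :
    Ex p (insert e E) f = (1 - p) * Ex p E f + p * Ex p E (fun ω => f (insert e ω)) := by
  unfold Ex
  rw [Finset.sum_powerset_insert he, Finset.mul_sum, Finset.mul_sum]
  congr 1
  · refine Finset.sum_congr rfl fun ω hω => ?_
    have := Finset.card_le_card (Finset.mem_powerset.1 hω)
    rw [Finset.card_insert_of_notMem he, Nat.succ_sub this, pow_succ]; ring
  · refine Finset.sum_congr rfl fun ω hω => ?_
    have h2 : e ∉ ω := fun h => he (Finset.mem_powerset.1 hω h)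
    rw [Finset.card_insert_of_notMem he, Finset.card_insert_of_notMem h2, Nat.succ_sub_succ,
      pow_succ]; ring

lemma Ex_union {E₁ E₂ : Finset α} (h : Disjoint E₁ E₂) (f : Finset α → ℝ) :
    Ex p (E₁ ∪ E₂) f = Ex p E₁ (fun ω₁ => Ex p E₂ (fun ω₂ => f (ω₁ ∪ ω₂))) := by
  induction E₁ using Finset.induction_on generalizing f with
  | empty => simp [Ex_empty]
  | insert e E he ih =>
    rw [Finset.disjoint_insert_left] at h
    have h1 : e ∉ E ∪ E₂ := by simp [he, h.1]
    rw [Finset.insert_union, Ex_insert h1, Ex_insert he, ih h.2, ih h.2]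
    simp only [Finset.insert_union]

lemma Ex_ge_empty (hp : 0 ≤ p) (hp1 : p ≤ 1) {E : Finset α} {f : Finset α → ℝ}
    (h : ∀ ω, ω ⊆ E → 0 ≤ f ω) : (1 - p) ^ E.card * f ∅ ≤ Ex p E f := by
  unfold Ex
  have : 0 ≤ 1 - p := by linarith
  refine le_trans (le_of_eq ?_) (Finset.single_le_sum (f := fun ω : Finset α =>
    p ^ ω.card * (1 - p) ^ (E.card - ω.card) * f ω) (fun ω hω => ?_) (Finset.empty_mem_powerset E))
  · simp
  · have := h ω (Finset.mem_powerset.1 hω)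
    positivity

lemma Ex_eq_empty {E : Finset α} {f : Finset α → ℝ}
    (h : ∀ ω, ω ⊆ E → ω ≠ ∅ → f ω = 0) : Ex p E f = (1 - p) ^ E.card * f ∅ := by
  unfold Ex
  rw [Finset.sum_eq_single_of_mem ∅ (Finset.empty_mem_powerset E)]
  · simp
  · intro ω hω hne
    rw [h ω (Finset.mem_powerset.1 hω) hne, mul_zero]

lemma Ex_ite_empty (E : Finset α) (c0 c1 : ℝ) :
    Ex p E (fun ω => if ω = ∅ then c0 else c1) =
      (1 - p) ^ E.card * c0 + (1 - (1 - p) ^ E.card) * c1 := by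
  have h1 : Ex p E (fun ω => if ω = ∅ then c0 else c1) =
      Ex p E (fun ω => c1 + if ω = ∅ then c0 - c1 else 0) :=
    Ex_congr fun ω _ => by split_ifs <;> ring
  rw [h1, Ex_add, Ex_const, Ex_eq_empty (f := fun ω => if ω = ∅ then c0 - c1 else 0)]
  · simp; ring
  · intro ω _ h; simp [h]

lemma Ex_card_mul (E : Finset α) (y : ℝ) :
    Ex p E (fun ω => (ω.card : ℝ) * y ^ (E.card - ω.card)) =
      E.card * p * (p + (1 - p) * y) ^ (E.card - 1) := by
  have key : ∀ E : Finset α, Ex p E (fun ω => y ^ (E.card - ω.card)) = (p + (1 - p) * y) ^ E.card := by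
    intro E
    rw [← Finset.sum_pow_mul_eq_add_pow]
    unfold Ex
    refine Finset.sum_congr rfl fun ω hω => ?_
    rw [mul_pow]; ring
  induction E using Finset.induction_on with
  | empty => simp [Ex_empty]
  | insert e E he ih =>
    rw [Ex_insert he]
    have a1 : Ex p E (fun ω => (ω.card : ℝ) * y ^ ((insert e E).card - ω.card)) =
        Ex p E (fun ω => (ω.card : ℝ) * y ^ (E.card - ω.card)) * y := by
      rw [← Ex_mul_right]
      refine Ex_congr fun ω hω => ?_
      rw [Finset.card_insert_of_notMem he, Nat.succ_sub (Finset.card_le_card hω), pow_succ]; ring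
    have a2 : Ex p E (fun ω => ((insert e ω).card : ℝ) * y ^ ((insert e E).card - (insert e ω).card)) =
        Ex p E (fun ω => (ω.card : ℝ) * y ^ (E.card - ω.card) + y ^ (E.card - ω.card)) := by
      refine Ex_congr fun ω hω => ?_
      have h2 : e ∉ ω := fun h => he (hω h)
      rw [Finset.card_insert_of_notMem he, Finset.card_insert_of_notMem h2, Nat.succ_sub_succ]
      push_cast; ring
    rw [a1, a2, Ex_add, key, ih, Finset.card_insert_of_notMem he]
    rcases Nat.eq_zero_or_pos E.card with h0 | h0
    · simp [h0]
    · obtain ⟨m, hm⟩ : ∃ m, E.card = m + 1 := ⟨E.card - 1, by omega⟩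
      rw [hm]; simp only [Nat.add_sub_cancel]; push_cast; ring

lemma Ex_pow' (E : Finset α) (y : ℝ) :
    Ex p E (fun ω => y ^ (E.card - ω.card)) = (p + (1 - p) * y) ^ E.card := by
  rw [← Finset.sum_pow_mul_eq_add_pow]
  unfold Ex
  refine Finset.sum_congr rfl fun ω hω => ?_
  rw [mul_pow]; ring

end Ex

/-! ### Graphs from edge sets -/

section Gr
variable {V : Type*} [Fintype V] [DecidableEq V]

/-- Reachability in the graph with edge set `ω`. -/
def Rc (ω : Finset (Sym2 V)) (u v : V) : Prop :=
  (SimpleGraph.fromEdgeSet (ω : Set (Sym2 V))).Reachable u v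

/-- Number of components of the graph with edge set `ω`. -/
def kc (ω : Finset (Sym2 V)) : ℕ :=
  Nat.card (SimpleGraph.fromEdgeSet (ω : Set (Sym2 V))).ConnectedComponent

lemma Rc_refl (ω : Finset (Sym2 V)) (u : V) : Rc ω u u := SimpleGraph.Reachable.refl u

lemma Rc.symm {ω : Finset (Sym2 V)} {u v : V} (h : Rc ω u v) : Rc ω v u :=
  SimpleGraph.Reachable.symm h

lemma Rc.trans {ω : Finset (Sym2 V)} {u v w : V} (h : Rc ω u v) (h' : Rc ω v w) : Rc ω u w :=
  SimpleGraph.Reachable.trans h h'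

lemma Rc_of_mem {ω : Finset (Sym2 V)} {u v : V} (h : s(u, v) ∈ ω) : Rc ω u v := by
  by_cases huv : u = v
  · subst huv; exact Rc_refl _ _
  · apply SimpleGraph.Adj.reachable
    rw [SimpleGraph.fromEdgeSet_adj]
    exact ⟨by exact_mod_cast h, huv⟩

lemma Rc.mono {ω ω' : Finset (Sym2 V)} (hs : ω ⊆ ω') {u v : V} (h : Rc ω u v) : Rc ω' u v :=
  SimpleGraph.Reachable.mono (SimpleGraph.fromEdgeSet_mono (by exact_mod_cast hs)) h

/-- Induction principle for reachability. -/
lemma Rc.ind {ω : Finset (Sym2 V)} {u : V} {P : V → Prop} (h0 : P u)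
    (hs : ∀ x y, s(x, y) ∈ ω → P x → P y) {v : V} (h : Rc ω u v) : P v := by
  unfold Rc at h
  rw [SimpleGraph.reachable_iff_reflTransGen] at h
  induction h with
  | refl => exact h0
  | tail _ hab ih =>
    rw [SimpleGraph.fromEdgeSet_adj] at hab
    exact hs _ _ (by exact_mod_cast hab.1) ih

lemma Rc_insert_of {ω : Finset (Sym2 V)} {x y : V} (hxy : Rc ω x y) (u v : V) :
    Rc (insert s(x, y) ω) u v ↔ Rc ω u v := by
  constructor
  · intro h
    refine Rc.ind (P := fun w => Rc ω u w) (Rc_refl _ _) ?_ h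
    intro a b hab ha
    rw [Finset.mem_insert] at hab
    rcases hab with hab | hab
    · rw [Sym2.eq_iff] at hab
      rcases hab with ⟨rfl, rfl⟩ | ⟨rfl, rfl⟩
      · exact ha.trans hxy
      · exact ha.trans hxy.symm
    · exact ha.trans (Rc_of_mem hab)
  · exact Rc.mono (Finset.subset_insert _ _)

lemma Rc_insert_iff {ω : Finset (Sym2 V)} {x y : V} (u v : V) :
    Rc (insert s(x, y) ω) u v ↔ Rc ω u v ∨ (Rc ω u x ∧ Rc ω y v) ∨ (Rc ω u y ∧ Rc ω x v) := by
  have hm : ∀ {u v}, Rc ω u v → Rc (insert s(x, y) ω) u v := Rc.mono (Finset.subset_insert _ _)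
  have hxy : Rc (insert s(x, y) ω) x y := Rc_of_mem (Finset.mem_insert_self _ _)
  constructor
  · intro h
    refine Rc.ind (P := fun v => Rc ω u v ∨ (Rc ω u x ∧ Rc ω y v) ∨ (Rc ω u y ∧ Rc ω x v))
      (Or.inl (Rc_refl _ _)) ?_ h
    intro a b hab ha
    rw [Finset.mem_insert] at hab
    rcases hab with hab | hab
    · rw [Sym2.eq_iff] at hab
      rcases hab with ⟨rfl, rfl⟩ | ⟨rfl, rfl⟩
      · rcases ha with h | h | h
        · exact Or.inr (Or.inl ⟨h, Rc_refl _ _⟩)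
        · exact Or.inr (Or.inl ⟨h.1, Rc_refl _ _⟩)
        · exact Or.inl h.1
      · rcases ha with h | h | h
        · exact Or.inr (Or.inr ⟨h, Rc_refl _ _⟩)
        · exact Or.inl h.1
        · exact Or.inr (Or.inr ⟨h.1, Rc_refl _ _⟩)
    · have hab := Rc_of_mem hab
      rcases ha with h | h | h
      · exact Or.inl (h.trans hab)
      · exact Or.inr (Or.inl ⟨h.1, h.2.trans hab⟩)
      · exact Or.inr (Or.inr ⟨h.1, h.2.trans hab⟩)
  · rintro (h | h | h)
    · exact hm h
    · exact ((hm h.1).trans hxy).trans (hm h.2)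
    · exact ((hm h.1).trans hxy.symm).trans (hm h.2)

/-- The reachability setoid. -/
lemma kc_eq (ω : Finset (Sym2 V)) : kc ω = Nat.card (Quot (Rc ω)) := rfl

lemma kc_congr {ω ω' : Finset (Sym2 V)} (h : ∀ u v, Rc ω u v ↔ Rc ω' u v) : kc ω = kc ω' := by
  have : Rc ω = Rc ω' := by ext u v; exact h u v
  rw [kc_eq, kc_eq, this]

lemma Rc_quot {ω : Finset (Sym2 V)} {u v : V} : Quot.mk (Rc ω) u = Quot.mk (Rc ω) v ↔ Rc ω u v := by
  constructor
  · intro h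
    have := (SimpleGraph.ConnectedComponent.eq (G := SimpleGraph.fromEdgeSet (ω : Set (Sym2 V)))
      (v := u) (w := v)).1 h
    exact this
  · exact fun h => Quot.sound h

instance (ω : Finset (Sym2 V)) : Finite (Quot (Rc ω)) :=
  Finite.of_surjective (Quot.mk (Rc ω)) Quot.mk_surjective

lemma kc_insert {ω : Finset (Sym2 V)} {x y : V} (hxy : ¬ Rc ω x y) :
    kc (insert s(x, y) ω) + 1 = kc ω := by
  classical
  rw [kc_eq, kc_eq]
  -- the components of `insert` are in bijection with the old ones other than that of `y`
  let f : {c : Quot (Rc ω) // c ≠ Quot.mk _ y} → Quot (Rc (insert s(x, y) ω)) := fun c =>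
    Quot.map id (fun a b h => Rc.mono (Finset.subset_insert _ _) h) c.1
  have hf : Function.Bijective f := by
    constructor
    · rintro ⟨a, ha⟩ ⟨b, hb⟩ hab
      induction a using Quot.ind with | _ a => ?_
      induction b using Quot.ind with | _ b => ?_
      have h1 : Rc (insert s(x, y) ω) a b := Rc_quot.1 hab
      rw [Ne, Rc_quot] at ha hb
      rw [Rc_insert_iff] at h1
      rw [Subtype.mk.injEq, Rc_quot]
      rcases h1 with h | h | h
      · exact h
      · exact absurd h.2.symm hb
      · exact absurd h.1 ha
    · intro c
      induction c using Quot.ind with | _ c => ?_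
      by_cases hc : Rc ω c y
      · refine ⟨⟨Quot.mk _ x, by rw [Ne, Rc_quot]; exact hxy⟩, ?_⟩
        change Quot.mk _ x = Quot.mk _ c
        rw [Rc_quot, Rc_insert_iff]
        exact Or.inr (Or.inl ⟨Rc_refl _ _, hc.symm⟩)
      · exact ⟨⟨Quot.mk _ c, by rw [Ne, Rc_quot]; exact hc⟩, rfl⟩
  rw [← Nat.card_congr (Equiv.ofBijective f hf)]
  have := Fintype.ofFinite (Quot (Rc ω))
  rw [Nat.card_eq_fintype_card, Nat.card_eq_fintype_card, Fintype.card_subtype_compl]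
  have : 0 < Fintype.card (Quot (Rc ω)) := Fintype.card_pos_iff.2 ⟨Quot.mk _ y⟩
  simp; omega

lemma kc_insert_le (ω : Finset (Sym2 V)) (e : Sym2 V) : kc ω ≤ kc (insert e ω) + 1 := by
  induction e with | _ x y => ?_
  by_cases h : Rc ω x y
  · rw [kc_congr (Rc_insert_of h)]; omega
  · rw [kc_insert h]

lemma kc_union_le (ω₀ ω : Finset (Sym2 V)) : kc ω₀ ≤ kc (ω₀ ∪ ω) + ω.card := by
  induction ω using Finset.induction_on with
  | empty => simp
  | insert e ω he ih =>
    rw [Finset.union_insert, Finset.card_insert_of_notMem he]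
    have := kc_insert_le (ω₀ ∪ ω) e
    omega

/-- Relative spanning forest. -/
lemma exists_forest (ω₀ ω : Finset (Sym2 V)) : ∃ F, F ⊆ ω ∧
    (∀ u v, Rc (ω₀ ∪ F) u v ↔ Rc (ω₀ ∪ ω) u v) ∧ F.card + kc (ω₀ ∪ ω) = kc ω₀ := by
  induction ω using Finset.induction_on with
  | empty => exact ⟨∅, by simp⟩
  | insert e ω he ih =>
    obtain ⟨F, hF, hR, hc⟩ := ih
    induction e with | _ x y => ?_
    by_cases h : Rc (ω₀ ∪ ω) x y
    · refine ⟨F, hF.trans (Finset.subset_insert _ _), ?_, ?_⟩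
      · intro u v
        rw [Finset.union_insert, Rc_insert_of h, hR]
      · rw [Finset.union_insert, kc_congr (Rc_insert_of h), hc]
    · refine ⟨insert s(x, y) F, Finset.insert_subset_insert _ hF, ?_, ?_⟩
      · intro u v
        rw [Finset.union_insert, Finset.union_insert, Rc_insert_iff, Rc_insert_iff]
        simp only [hR]
      · have := kc_insert h
        rw [Finset.union_insert, Finset.card_insert_of_notMem (fun hh => he (hF hh))]
        omega

/-- if every vertex is reachable from a member of `B`, there are at most `#B` components -/
lemma kc_le_card {ω : Finset (Sym2 V)} (B : Finset V) (h : ∀ v, ∃ b ∈ B, Rc ω b v) :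
    kc ω ≤ B.card := by
  rw [kc_eq]
  have : Function.Surjective (fun b : B => Quot.mk (Rc ω) b.1) := by
    intro c
    induction c using Quot.ind with | _ c => ?_
    obtain ⟨b, hb, hbc⟩ := h c
    exact ⟨⟨b, hb⟩, Rc_quot.2 hbc⟩
  simpa using Nat.card_le_card_of_surjective _ this

lemma card_le_kc {ω : Finset (Sym2 V)} (B : Finset V)
    (h : ∀ u ∈ B, ∀ v ∈ B, Rc ω u v → u = v) : B.card ≤ kc ω := by
  rw [kc_eq]
  have : Function.Injective (fun b : B => Quot.mk (Rc ω) b.1) := by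
    rintro ⟨a, ha⟩ ⟨b, hb⟩ hab
    exact Subtype.ext (h a ha b hb (Rc_quot.1 hab))
  simpa using Nat.card_le_card_of_injective _ this

/-! ### Edge sets -/

/-- edges inside `S` -/
def Ein (S : Finset V) : Finset (Sym2 V) :=
  Finset.univ.filter fun e => ¬ e.IsDiag ∧ ∀ v ∈ e, v ∈ S

/-- edges between `A` and `U` -/
def Ecr (A U : Finset V) : Finset (Sym2 V) := (A ×ˢ U).image fun x => s(x.1, x.2)

lemma mem_Ein {S : Finset V} {u v : V} : s(u, v) ∈ Ein S ↔ u ≠ v ∧ u ∈ S ∧ v ∈ S := by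
  simp [Ein]

lemma mem_Ecr {A U : Finset V} {u v : V} :
    s(u, v) ∈ Ecr A U ↔ (u ∈ A ∧ v ∈ U) ∨ (v ∈ A ∧ u ∈ U) := by
  simp only [Ecr, Finset.mem_image, Finset.mem_product, Prod.exists, Sym2.eq_iff]
  constructor
  · rintro ⟨a, b, ⟨ha, hb⟩, ⟨rfl, rfl⟩ | ⟨rfl, rfl⟩⟩
    · exact Or.inl ⟨ha, hb⟩
    · exact Or.inr ⟨ha, hb⟩
  · rintro (⟨ha, hb⟩ | ⟨ha, hb⟩)
    · exact ⟨_, _, ⟨ha, hb⟩, Or.inl ⟨rfl, rfl⟩⟩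
    · exact ⟨_, _, ⟨ha, hb⟩, Or.inr ⟨rfl, rfl⟩⟩

lemma card_Ecr {A U : Finset V} (h : Disjoint A U) : (Ecr A U).card = A.card * U.card := by
  rw [Ecr, Finset.card_image_of_injOn, Finset.card_product]
  rintro ⟨a, b⟩ hab ⟨c, d⟩ hcd heq
  simp only [Finset.coe_product, Set.mem_prod, Finset.mem_coe] at hab hcd
  simp only [Sym2.eq_iff] at heq
  rcases heq with ⟨rfl, rfl⟩ | ⟨rfl, rfl⟩
  · rfl
  · exact absurd hcd.2 (Finset.disjoint_left.1 h hab.1)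

lemma card_Ein (S : Finset V) : (Ein S).card = S.card.choose 2 := by
  rw [← Sym2.card_image_offDiag]
  congr 1
  ext e
  induction e with | _ x y => ?_
  rw [mem_Ein]
  simp only [Finset.mem_image, Finset.mem_offDiag, Prod.exists, Function.uncurry_apply_pair, Sym2.eq_iff]
  constructor
  · rintro ⟨h, hx, hy⟩
    exact ⟨x, y, ⟨hx, hy, h⟩, Or.inl ⟨rfl, rfl⟩⟩
  · rintro ⟨a, b, ⟨ha, hb, hab⟩, ⟨rfl, rfl⟩ | ⟨rfl, rfl⟩⟩
    · exact ⟨hab, ha, hb⟩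
    · exact ⟨hab.symm, hb, ha⟩

lemma Ein_union {A U : Finset V} (h : Disjoint A U) : Ein (A ∪ U) = Ein A ∪ (Ecr A U ∪ Ein U) := by
  ext e
  induction e with | _ x y => ?_
  simp only [Finset.mem_union, mem_Ein, mem_Ecr]
  have := fun (z : V) (hz : z ∈ A) => Finset.disjoint_left.1 h hz
  constructor
  · tauto
  · rintro (h | h | h)
    · tauto
    · refine ⟨?_, by tauto⟩
      rintro rfl
      have := this x
      tauto
    · tauto

lemma disj_Ein_Ecr {A U : Finset V} (h : Disjoint A U) : Disjoint (Ein A) (Ecr A U ∪ Ein U) := by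
  rw [Finset.disjoint_left]
  intro e
  induction e with | _ x y => ?_
  simp only [Finset.mem_union, mem_Ein, mem_Ecr]
  have h1 := fun hx : x ∈ A => Finset.disjoint_left.1 h hx
  have h2 := fun hx : y ∈ A => Finset.disjoint_left.1 h hx
  tauto

lemma disj_Ecr_Ein {A U : Finset V} (h : Disjoint A U) : Disjoint (Ecr A U) (Ein U) := by
  rw [Finset.disjoint_left]
  intro e
  induction e with | _ x y => ?_
  simp only [mem_Ein, mem_Ecr]
  have h1 := fun hx : x ∈ A => Finset.disjoint_left.1 h hx
  have h2 := fun hx : y ∈ A => Finset.disjoint_left.1 h hx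
  tauto

/-- three-fold splitting of the expectation -/
lemma Ex_split {p : ℝ} {A U : Finset V} (h : Disjoint A U) (f : Finset (Sym2 V) → ℝ) :
    Ex p (Ein (A ∪ U)) f = Ex p (Ein A) fun ω₀ => Ex p (Ecr A U) fun ω₁ => Ex p (Ein U) fun ω₂ =>
      f (ω₀ ∪ (ω₁ ∪ ω₂)) := by
  rw [Ein_union h, Ex_union (disj_Ein_Ecr h)]
  refine Ex_congr fun ω _ => ?_
  rw [Ex_union (disj_Ecr_Ein h)]

end Gr

/-! ### Exploration: probability that all of `U` is connected to `A` -/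

section Bfs
variable {V : Type*} [Fintype V] [DecidableEq V]

/-- every vertex of `U` is reachable from `A` -/
def evh (A U : Finset V) (ω : Finset (Sym2 V)) : Prop := ∀ u ∈ U, ∃ a ∈ A, Rc ω a u

open Classical in
/-- probability of `evh` -/
def hs (p : ℝ) (A U : Finset V) : ℝ :=
  Ex p (Ein (A ∪ U)) fun ω => if evh A U ω then 1 else 0

open Classical in
/-- first layer -/
def Jset (A U : Finset V) (ω : Finset (Sym2 V)) : Finset V := U.filter fun u => ∃ a ∈ A, s(a, u) ∈ ω

lemma Jset_subset (A U : Finset V) (ω : Finset (Sym2 V)) : Jset A U ω ⊆ U := Finset.filter_subset _ _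

lemma evh_iff {A U : Finset V} (h : Disjoint A U) {ω₀ ω₁ ω₂ : Finset (Sym2 V)}
    (h0 : ω₀ ⊆ Ein A) (h1 : ω₁ ⊆ Ecr A U) (h2 : ω₂ ⊆ Ein U) :
    evh A U (ω₀ ∪ (ω₁ ∪ ω₂)) ↔ evh (Jset A U ω₁) (U \ Jset A U ω₁) ω₂ := by
  classical
  constructor
  · intro H u hu
    rw [Finset.mem_sdiff] at hu
    obtain ⟨a, ha, hau⟩ := H u hu.1
    have key : u ∈ A ∨ ∃ j ∈ Jset A U ω₁, Rc ω₂ j u := by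
      refine Rc.ind (P := fun w => w ∈ A ∨ ∃ j ∈ Jset A U ω₁, Rc ω₂ j w) (Or.inl ha) ?_ hau
      intro x y hxy hx
      simp only [Finset.mem_union] at hxy
      rcases hxy with hxy | hxy | hxy
      · exact Or.inl (mem_Ein.1 (h0 hxy)).2.2
      · rcases mem_Ecr.1 (h1 hxy) with ⟨hxA, hyU⟩ | ⟨hyA, hxU⟩
        · right
          exact ⟨y, by simp only [Jset, Finset.mem_filter]; exact ⟨hyU, x, hxA, hxy⟩, Rc_refl _ _⟩
        · exact Or.inl hyA
      · rcases hx with hx | ⟨j, hj, hjx⟩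
        · exact absurd (mem_Ein.1 (h2 hxy)).2.1 (Finset.disjoint_left.1 h hx)
        · exact Or.inr ⟨j, hj, hjx.trans (Rc_of_mem hxy)⟩
    rcases key with key | key
    · exact absurd hu.1 (Finset.disjoint_left.1 h key)
    · exact key
  · intro H u hu
    have hJ : ∀ j ∈ Jset A U ω₁, ∃ a ∈ A, Rc (ω₀ ∪ (ω₁ ∪ ω₂)) a j := by
      intro j hj
      simp only [Jset, Finset.mem_filter] at hj
      obtain ⟨_, a, ha, haj⟩ := hj
      exact ⟨a, ha, Rc_of_mem (by simp [haj])⟩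
    by_cases huJ : u ∈ Jset A U ω₁
    · exact hJ u huJ
    · obtain ⟨j, hj, hju⟩ := H u (Finset.mem_sdiff.2 ⟨hu, huJ⟩)
      obtain ⟨a, ha, haj⟩ := hJ j hj
      refine ⟨a, ha, haj.trans (hju.mono ?_)⟩
      exact Finset.subset_union_right.trans Finset.subset_union_right

lemma hs_rec {p : ℝ} {A U : Finset V} (h : Disjoint A U) :
    hs p A U = Ex p (Ecr A U) fun ω₁ => hs p (Jset A U ω₁) (U \ Jset A U ω₁) := by
  classical
  unfold hs
  rw [Ex_split h]
  rw [← Ex_const (p := p) (Ein A) (Ex p (Ecr A U) _)]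
  refine Ex_congr fun ω₀ h0 => Ex_congr fun ω₁ h1 => ?_
  rw [Finset.union_sdiff_of_subset (Jset_subset _ _ _)]
  refine Ex_congr fun ω₂ h2 => ?_
  simp only [evh_iff h h0 h1 h2]

lemma Ex_Jset {p : ℝ} (A U : Finset V) (h : Disjoint A U) (g : Finset V → ℝ) :
    Ex p (Ecr A U) (fun ω => g (Jset A U ω)) = Ex (1 - (1 - p) ^ A.card) U g := by
  classical
  induction U using Finset.induction_on generalizing g with
  | empty => simp [Ecr, Ex_empty, Jset]
  | insert u U hu ih =>
    rw [Finset.disjoint_insert_right] at h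
    have e1 : Ecr A (insert u U) = Ecr A {u} ∪ Ecr A U := by
      ext e
      induction e with | _ x y => ?_
      simp only [Finset.mem_union, mem_Ecr, Finset.mem_insert, Finset.mem_singleton]
      tauto
    have d1 : Disjoint (Ecr A {u}) (Ecr A U) := by
      rw [Finset.disjoint_left]
      intro e
      induction e with | _ x y => ?_
      simp only [mem_Ecr, Finset.mem_singleton]
      have hx := fun hx : x ∈ A => Finset.disjoint_left.1 h.2 hx
      have hy := fun hx : y ∈ A => Finset.disjoint_left.1 h.2 hx
      rintro (⟨h1, rfl⟩ | ⟨h1, rfl⟩) <;> tauto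
    have hcard : (Ecr A {u}).card = A.card := by
      rw [card_Ecr (by simpa using h.1)]; simp
    rw [e1, Ex_union d1, Ex_insert hu, ← ih h.2, ← ih h.2]
    have e2 : ∀ ω₁ ⊆ Ecr A {u}, ∀ ω₂ ⊆ Ecr A U, Jset A (insert u U) (ω₁ ∪ ω₂) =
        if ω₁ = ∅ then Jset A U ω₂ else insert u (Jset A U ω₂) := by
      intro ω₁ h1 ω₂ h2
      have key : (∃ a ∈ A, s(a, u) ∈ ω₁ ∪ ω₂) ↔ ω₁ ≠ ∅ := by
        constructor
        · rintro ⟨a, ha, hau⟩ rfl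
          rw [Finset.empty_union] at hau
          have := mem_Ecr.1 (h2 hau)
          have := h.1
          tauto
        · intro hne
          obtain ⟨e, he⟩ := Finset.nonempty_iff_ne_empty.2 hne
          induction e with | _ x y => ?_
          have := mem_Ecr.1 (h1 he)
          simp only [Finset.mem_singleton] at this
          rcases this with ⟨hx, rfl⟩ | ⟨hy, rfl⟩
          · exact ⟨x, hx, by simp [he]⟩
          · exact ⟨y, hy, by simp [Sym2.eq_swap, he]⟩
      have key2 : ∀ w ∈ U, (∃ a ∈ A, s(a, w) ∈ ω₁ ∪ ω₂) ↔ ∃ a ∈ A, s(a, w) ∈ ω₂ := by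
        intro w hw
        have hne : w ≠ u := by rintro rfl; exact hu hw
        have hwA : w ∉ A := fun hA => Finset.disjoint_left.1 h.2 hA hw
        constructor
        · rintro ⟨a, ha, haw⟩
          refine ⟨a, ha, ?_⟩
          rcases Finset.mem_union.1 haw with h' | h'
          · have := mem_Ecr.1 (h1 h')
            simp only [Finset.mem_singleton] at this
            tauto
          · exact h'
        · rintro ⟨a, ha, haw⟩
          exact ⟨a, ha, Finset.mem_union_right _ haw⟩
      unfold Jset
      rw [Finset.filter_insert]
      rw [Finset.filter_congr key2]
      by_cases h0 : ω₁ = ∅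
      · rw [if_neg (by rw [key]; simpa using h0), if_pos h0]
      · rw [if_pos (by rw [key]; exact h0), if_neg h0]
    have e3 : Ex p (Ecr A {u}) (fun ω₁ => Ex p (Ecr A U) fun ω₂ => g (Jset A (insert u U) (ω₁ ∪ ω₂)))
        = Ex p (Ecr A {u}) (fun ω₁ => if ω₁ = ∅ then Ex p (Ecr A U) (fun ω₂ => g (Jset A U ω₂)) else
          Ex p (Ecr A U) (fun ω₂ => g (insert u (Jset A U ω₂)))) := by
      refine Ex_congr fun ω₁ h1 => ?_
      split_ifs with h0
      · refine Ex_congr fun ω₂ h2 => ?_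
        rw [e2 ω₁ h1 ω₂ h2, if_pos h0]
      · refine Ex_congr fun ω₂ h2 => ?_
        rw [e2 ω₁ h1 ω₂ h2, if_neg h0]
    rw [e3, Ex_ite_empty, hcard, ih h.2 (fun J => g (insert u J))]
    ring

lemma hs_empty_right {p : ℝ} (A : Finset V) : hs p A ∅ = 1 := by
  classical
  unfold hs
  simp [evh, Ex_const]

lemma hs_empty_left {p : ℝ} {U : Finset V} (hU : U.Nonempty) : hs p ∅ U = 0 := by
  classical
  obtain ⟨u, hu⟩ := hU
  unfold hs
  have : ∀ ω, ¬ evh ∅ U ω := by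
    intro ω hh
    obtain ⟨a, ha, _⟩ := hh u hu
    simp at ha
  simp [this, Ex_const]

lemma hs_nonneg {p : ℝ} (hp : 0 ≤ p) (hp1 : p ≤ 1) (A U : Finset V) : 0 ≤ hs p A U := by
  classical
  rw [← Ex_const (p := p) (Ein (A ∪ U)) 0]
  exact Ex_mono hp hp1 fun ω _ => by split_ifs <;> norm_num

lemma hs_upper {p : ℝ} (hp : 0 ≤ p) (hp1 : p ≤ 1) (N : ℕ) : ∀ A U : Finset V, Disjoint A U → U.card = N →
    hs p A U ≤ (1 - (1 - p) ^ (A.card + U.card)) ^ U.card := by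
  induction N using Nat.strong_induction_on with
  | _ N ih =>
    intro A U h hN
    have s0 : 0 ≤ 1 - p := by linarith
    have s1 : 1 - p ≤ 1 := by linarith
    have hpi : ∀ k, (1 - p) ^ k ≤ 1 := fun k => pow_le_one₀ s0 s1
    have hpi0 : ∀ k, 0 ≤ (1 - p) ^ k := fun k => pow_nonneg s0 k
    rcases U.eq_empty_or_nonempty with rfl | hU
    · simp [hs_empty_right]
    rw [hs_rec h]
    calc Ex p (Ecr A U) (fun ω₁ => hs p (Jset A U ω₁) (U \ Jset A U ω₁))
        ≤ Ex p (Ecr A U) (fun ω₁ => (fun J : Finset V => (1 - (1 - p) ^ U.card) ^ (U.card - J.card)) (Jset A U ω₁)) := by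
          refine Ex_mono hp hp1 fun ω₁ h1 => ?_
          have hJ := Jset_subset A U ω₁
          rcases (Jset A U ω₁).eq_empty_or_nonempty with hJ0 | hJ0
          · simp only [hJ0, Finset.sdiff_empty]
            rw [hs_empty_left hU]
            exact pow_nonneg (by linarith [hpi U.card]) _
          · have hc := Finset.card_sdiff_of_subset hJ
            have hc2 := Finset.card_le_card hJ
            have hc3 := hJ0.card_pos
            have := ih (U.card - (Jset A U ω₁).card) (by omega) _ (U \ Jset A U ω₁)
              Finset.disjoint_sdiff hc
            rw [hc] at this
            rwa [Nat.add_sub_cancel' hc2] at this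
      _ = _ := by
          rw [Ex_Jset A U h (fun J : Finset V => (1 - (1 - p) ^ U.card) ^ (U.card - J.card)), Ex_pow']
          congr 1
          rw [pow_add]; ring

lemma pow_concave {s : ℝ} (s0 : 0 ≤ s) (s1 : s ≤ 1) (a u : ℕ) :
    (a : ℝ) * (1 - s ^ (a + u)) ≤ (a + u) * (1 - s ^ a) := by
  induction u with
  | zero => simp
  | succ u ih =>
    have h1 : (a : ℝ) * (1 - s) * s ^ a ≤ 1 - s ^ a := by
      clear ih
      induction a with
      | zero => simp
      | succ a iha =>
        have hpi : s ^ a ≤ 1 := pow_le_one₀ s0 s1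
        have hpi0 : 0 ≤ s ^ a := pow_nonneg s0 a
        push_cast
        rw [pow_succ]
        have : (a : ℝ) * (1 - s) * s ^ a * s ≤ (1 - s ^ a) * s := mul_le_mul_of_nonneg_right iha s0
        have h4 : s ^ a * s ≤ 1 := mul_le_one₀ hpi s0 s1
        nlinarith [mul_nonneg (sub_nonneg.2 s1) (sub_nonneg.2 h4)]
    have h2 : s ^ (a + u) ≤ s ^ a := pow_le_pow_of_le_one s0 s1 (by omega)
    have h3 : (a : ℝ) * (1 - s) * s ^ (a + u) ≤ (a : ℝ) * (1 - s) * s ^ a :=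
      mul_le_mul_of_nonneg_left h2 (mul_nonneg (Nat.cast_nonneg a) (by linarith))
    rw [← add_assoc, pow_succ]
    push_cast
    nlinarith

lemma hs_lower {p : ℝ} (hp : 0 ≤ p) (hp1 : p ≤ 1) (N : ℕ) : ∀ A U : Finset V, Disjoint A U → U.card = N →
    (A.card : ℝ) / (A.card + U.card) * (1 - (1 - p) ^ (A.card + U.card)) ^ U.card ≤ hs p A U := by
  induction N using Nat.strong_induction_on with
  | _ N ih =>
    intro A U h hN
    have s0 : 0 ≤ 1 - p := by linarith
    have s1 : 1 - p ≤ 1 := by linarith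
    have hpi : ∀ k, (1 - p) ^ k ≤ 1 := fun k => pow_le_one₀ s0 s1
    have hpi0 : ∀ k, 0 ≤ (1 - p) ^ k := fun k => pow_nonneg s0 k
    rcases U.eq_empty_or_nonempty with rfl | hU
    · simp [hs_empty_right]
      exact div_self_le_one _
    have hU0 : (0 : ℝ) < U.card := by exact_mod_cast hU.card_pos
    rw [hs_rec h]
    calc (A.card : ℝ) / (A.card + U.card) * (1 - (1 - p) ^ (A.card + U.card)) ^ U.card
        ≤ (1 - (1 - p) ^ A.card) * (1 - (1 - p) ^ (A.card + U.card)) ^ (U.card - 1) := by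
          obtain ⟨m, hm⟩ : ∃ m, U.card = m + 1 := ⟨U.card - 1, by have := hU.card_pos; omega⟩
          have h1 := pow_concave s0 s1 A.card U.card
          have h2 : (A.card : ℝ) / (A.card + U.card) * (1 - (1 - p) ^ (A.card + U.card)) ≤ 1 - (1 - p) ^ A.card := by
            rw [div_mul_eq_mul_div, div_le_iff₀ (by positivity)]
            linarith
          have h3 : 0 ≤ (1 - (1 - p) ^ (A.card + U.card)) ^ (U.card - 1) :=
            pow_nonneg (by linarith [hpi (A.card + U.card)]) _
          have := mul_le_mul_of_nonneg_right h2 h3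
          refine le_trans (le_of_eq ?_) this
          rw [mul_assoc, ← pow_succ', Nat.sub_add_cancel hU.card_pos]
      _ = Ex p (Ecr A U) (fun ω₁ => (fun J : Finset V => (J.card : ℝ) *
            (1 - (1 - p) ^ U.card) ^ (U.card - J.card) * (1 / U.card)) (Jset A U ω₁)) := by
          rw [Ex_Jset A U h (fun J : Finset V => (J.card : ℝ) *
            (1 - (1 - p) ^ U.card) ^ (U.card - J.card) * (1 / U.card)), Ex_mul_right, Ex_card_mul]
          rw [pow_add]
          field_simp
          ring
      _ ≤ Ex p (Ecr A U) (fun ω₁ => hs p (Jset A U ω₁) (U \ Jset A U ω₁)) := by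
          refine Ex_mono hp hp1 fun ω₁ h1 => ?_
          have hJ := Jset_subset A U ω₁
          rcases (Jset A U ω₁).eq_empty_or_nonempty with hJ0 | hJ0
          · simp only [hJ0, Finset.sdiff_empty]
            rw [hs_empty_left hU]
            simp
          · have hc := Finset.card_sdiff_of_subset hJ
            have hc2 := Finset.card_le_card hJ
            have hc3 := hJ0.card_pos
            have := ih (U.card - (Jset A U ω₁).card) (by omega) _ (U \ Jset A U ω₁)
              Finset.disjoint_sdiff hc
            rw [hc] at this
            rw [Nat.add_sub_cancel' hc2] at this
            refine le_trans (le_of_eq ?_) this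
            push_cast [Nat.cast_sub hc2]
            ring

end Bfs

/-! ### Two-sided bounds of the partition function -/

section Bounds
variable {V : Type*} [Fintype V] [DecidableEq V]

open Classical in
lemma low_S {p q : ℝ} (hp : 0 ≤ p) (hp1 : p ≤ 1) (hq : 1 ≤ q) (S : Finset V) (v0 : V) (hv : v0 ∈ S) :
    1 / (S.card : ℝ) * (1 - (1 - p) ^ S.card) ^ S.card * ((1 - p) ^ (S.card * Sᶜ.card) *
      (q ^ Sᶜ.card * (p / q + (1 - p)) ^ (Sᶜ.card.choose 2))) ≤
    Ex p (Ein Finset.univ) (fun ω => if (∀ u, Rc ω v0 u ↔ u ∈ S) then q ^ kc ω else 0) := by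
  have s0 : 0 ≤ 1 - p := by linarith
  have q0 : 0 < q := by linarith
  have hd : Disjoint S Sᶜ := disjoint_compl_right
  have hS : 0 < S.card := Finset.card_pos.2 ⟨v0, hv⟩
  rw [← Finset.union_compl S, Ex_split hd]
  have h1 : 1 / (S.card : ℝ) * (1 - (1 - p) ^ S.card) ^ S.card ≤ hs p {v0} (S \ {v0}) := by
    have := hs_lower hp hp1 _ {v0} (S \ {v0}) Finset.disjoint_sdiff rfl
    have hc : (S \ {v0}).card = S.card - 1 := by
      rw [Finset.card_sdiff_of_subset (by simpa using hv)]; simp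
    rw [hc, Finset.card_singleton, Nat.add_sub_cancel' hS] at this
    refine le_trans ?_ this
    have e : ((1 : ℕ) : ℝ) + ((S.card - 1 : ℕ) : ℝ) = S.card := by
      rw [Nat.cast_sub hS]; push_cast; ring
    rw [e, Nat.cast_one]
    refine mul_le_mul_of_nonneg_left ?_ (by positivity)
    have b1 : (1 - p) ^ S.card ≤ 1 := pow_le_one₀ s0 (by linarith)
    have b2 : 0 ≤ (1 - p) ^ S.card := pow_nonneg s0 _
    exact pow_le_pow_of_le_one (by linarith) (by linarith) (by omega)
  have hC : 0 ≤ (1 - p) ^ (S.card * Sᶜ.card) *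
      (q ^ Sᶜ.card * (p / q + (1 - p)) ^ (Sᶜ.card.choose 2)) := by positivity
  refine le_trans (mul_le_mul_of_nonneg_right h1 hC) ?_
  unfold hs
  rw [Finset.union_sdiff_of_subset (by simpa using hv), ← Ex_mul_right]
  refine Ex_mono hp hp1 fun ω₀ h0 => ?_
  have hnn : ∀ ω, 0 ≤ (if (∀ u, Rc ω v0 u ↔ u ∈ S) then q ^ kc ω else 0) := by
    intro ω; split_ifs <;> positivity
  have hnn2 : ∀ ω₁, 0 ≤ Ex p (Ein Sᶜ) fun ω₂ => (if (∀ u, Rc (ω₀ ∪ (ω₁ ∪ ω₂)) v0 u ↔ u ∈ S) then q ^ kc (ω₀ ∪ (ω₁ ∪ ω₂)) else 0) := by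
    intro ω₁
    refine le_trans (le_of_eq (Ex_const (p := p) (Ein Sᶜ) 0).symm) ?_
    exact Ex_mono hp hp1 fun ω₂ _ => hnn _
  refine le_trans ?_ (Ex_ge_empty hp hp1 fun ω₁ _ => hnn2 ω₁)
  rw [card_Ecr hd]
  split_ifs with hev
  swap
  · rw [zero_mul]
    exact mul_nonneg (pow_nonneg s0 _) (hnn2 ∅)
  rw [one_mul]
  refine mul_le_mul_of_nonneg_left ?_ (pow_nonneg s0 _)
  have hkc : Sᶜ.card ≤ kc ω₀ := by
    refine card_le_kc _ ?_
    intro u hu v _ huv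
    refine (Rc.ind (P := fun w => u = w) rfl ?_ huv)
    rintro x y hxy rfl
    exact absurd (mem_Ein.1 (h0 hxy)).2.1 (Finset.mem_compl.1 hu)
  have e1 := Ex_pow (p := p) (Ein (Sᶜ)) (1 / q)
  rw [card_Ein] at e1
  rw [show p / q + (1 - p) = p * (1 / q) + (1 - p) by ring, ← e1, mul_comm, ← Ex_mul_right]
  refine Ex_mono hp hp1 fun ω₂ h2 => ?_
  rw [Finset.empty_union, if_pos]
  · have h3 := kc_union_le ω₀ ω₂
    rw [one_div, inv_pow, inv_mul_eq_div, div_le_iff₀ (by positivity), ← pow_add]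
    exact pow_le_pow_right₀ hq (by omega)
  · intro u
    constructor
    · intro hu
      refine Rc.ind (P := fun w => w ∈ S) hv ?_ hu
      intro x y hxy hx
      rcases Finset.mem_union.1 hxy with h | h
      · exact (mem_Ein.1 (h0 h)).2.2
      · exact absurd hx (Finset.mem_compl.1 (mem_Ein.1 (h2 h)).2.1)
    · intro hu
      by_cases huv : u = v0
      · subst huv; exact Rc_refl _ _
      · obtain ⟨a, ha, hau⟩ := hev u (by simp [hu, huv])
        rw [Finset.mem_singleton] at ha
        subst ha
        exact hau.mono Finset.subset_union_left

/-- the explicit main term -/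
def Tm (n : ℕ) (p q : ℝ) (k : ℕ) : ℝ :=
  n.choose k * (1 - p) ^ (k * (n - k)) * (1 - (1 - p) ^ k) ^ k * q ^ (n - k) *
    (p / q + (1 - p)) ^ ((n - k).choose 2)

/-- abstract partition function -/
def Zq (V : Type*) [Fintype V] [DecidableEq V] (p q : ℝ) : ℝ :=
  Ex p (Ein (Finset.univ : Finset V)) (fun ω => q ^ kc ω)

lemma Zq_lower0 {p q : ℝ} (hp : 0 ≤ p) (hp1 : p ≤ 1) (hq : 1 ≤ q) :
    q ^ Fintype.card V * (p / q + (1 - p)) ^ ((Fintype.card V).choose 2) ≤ Zq V p q := by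
  have q0 : 0 < q := by linarith
  have e1 := Ex_pow (p := p) (Ein (Finset.univ : Finset V)) (1 / q)
  rw [card_Ein, Finset.card_univ] at e1
  rw [show p / q + (1 - p) = p * (1 / q) + (1 - p) by ring, ← e1, mul_comm, ← Ex_mul_right]
  refine Ex_mono hp hp1 fun ω₂ h2 => ?_
  have h3 := kc_union_le ∅ ω₂
  have h4 : Fintype.card V ≤ kc (∅ : Finset (Sym2 V)) := by
    rw [← Finset.card_univ]
    refine card_le_kc _ fun u _ v _ huv => Rc.ind (P := fun w => u = w) rfl ?_ huv
    intro x y hxy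
    simp at hxy
  rw [Finset.empty_union] at h3
  rw [one_div, inv_pow, inv_mul_eq_div, div_le_iff₀ (by positivity), ← pow_add]
  exact pow_le_pow_right₀ hq (by omega)

lemma Zq_lower {p q : ℝ} (hp : 0 ≤ p) (hp1 : p ≤ 1) (hq : 1 ≤ q) {n : ℕ} (hn : Fintype.card V = n)
    (hn0 : 1 ≤ n) (k : ℕ) : Tm n p q k ≤ n * Zq V p q := by
  classical
  have s0 : 0 ≤ 1 - p := by linarith
  have q0 : 0 < q := by linarith
  rcases Nat.eq_zero_or_pos k with rfl | hk
  · have h0 := Zq_lower0 (V := V) hp hp1 hq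
    have h1 : 0 ≤ Zq V p q := le_trans (by positivity) h0
    have h2 : Zq V p q ≤ n * Zq V p q := le_mul_of_one_le_left h1 (by exact_mod_cast hn0)
    rw [hn] at h0
    unfold Tm
    simp
    linarith
  · have e0 : Ex p (Ein (Finset.univ : Finset V)) (fun ω => ∑ S ∈ Finset.powersetCard k Finset.univ,
        ∑ v ∈ S, if (∀ u, Rc ω v u ↔ u ∈ S) then q ^ kc ω else 0) ≤ n * Zq V p q := by
      unfold Zq
      rw [mul_comm, ← Ex_mul_right]
      refine Ex_mono hp hp1 fun ω _ => ?_
      calc ∑ S ∈ Finset.powersetCard k Finset.univ,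
        ∑ v ∈ S, (if (∀ u, Rc ω v u ↔ u ∈ S) then q ^ kc ω else 0)
        ≤ ∑ S ∈ Finset.powersetCard k Finset.univ,
        ∑ v : V, (if (∀ u, Rc ω v u ↔ u ∈ S) then q ^ kc ω else 0) := by
            refine Finset.sum_le_sum fun S _ => ?_
            refine Finset.sum_le_sum_of_subset_of_nonneg (Finset.subset_univ _) fun v _ _ => ?_
            split_ifs <;> positivity
        _ ≤ ∑ v : V, q ^ kc ω := by
            rw [Finset.sum_comm]
            refine Finset.sum_le_sum fun v _ => ?_
            have : ∀ S ∈ Finset.powersetCard k (Finset.univ : Finset V),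
              (if (∀ u, Rc ω v u ↔ u ∈ S) then q ^ kc ω else 0) ≤
                if S = Finset.univ.filter (fun u => Rc ω v u) then q ^ kc ω else 0 := by
              intro S _
              split_ifs with h1 h2
              · exact le_rfl
              · exact absurd (by ext u; simp [h1]) h2
              · positivity
              · exact le_rfl
            refine (Finset.sum_le_sum this).trans ?_
            rw [Finset.sum_ite_eq']
            split_ifs
            · exact le_rfl
            · positivity
        _ = q ^ kc ω * n := by
            rw [Finset.sum_const, Finset.card_univ, hn, nsmul_eq_mul, mul_comm]
    refine le_trans ?_ e0
    rw [Ex_sum]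
    calc Tm n p q k = ∑ S ∈ Finset.powersetCard k (Finset.univ : Finset V), ∑ v ∈ S,
        1 / (S.card : ℝ) * (1 - (1 - p) ^ S.card) ^ S.card * ((1 - p) ^ (S.card * Sᶜ.card) *
      (q ^ Sᶜ.card * (p / q + (1 - p)) ^ (Sᶜ.card.choose 2))) := by
          have : ∀ S ∈ Finset.powersetCard k (Finset.univ : Finset V), (∑ v ∈ S,
              1 / (S.card : ℝ) * (1 - (1 - p) ^ S.card) ^ S.card * ((1 - p) ^ (S.card * Sᶜ.card) *
              (q ^ Sᶜ.card * (p / q + (1 - p)) ^ (Sᶜ.card.choose 2)))) =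
              (1 - p) ^ (k * (n - k)) * (1 - (1 - p) ^ k) ^ k * q ^ (n - k) *
                (p / q + (1 - p)) ^ ((n - k).choose 2) := by
            intro S hS
            rw [Finset.mem_powersetCard] at hS
            rw [Finset.sum_const, Finset.card_compl, hn, hS.2, nsmul_eq_mul]
            have : (k : ℝ) ≠ 0 := by positivity
            field_simp
          rw [Finset.sum_congr rfl this, Finset.sum_const, Finset.card_powersetCard,
            Finset.card_univ, hn, nsmul_eq_mul]
          unfold Tm; ring
      _ ≤ _ := by
          refine Finset.sum_le_sum fun S hS => ?_
          rw [Ex_sum]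
          exact Finset.sum_le_sum fun v hv => low_S hp hp1 hq S v hv

open Classical in
/-- components outside `S` are small -/
def sm (r : ℕ) (S : Finset V) (ω : Finset (Sym2 V)) : Prop :=
  ∀ v, v ∉ S → (Finset.univ.filter fun u => Rc ω v u).card ≤ r

open Classical in
lemma small_bound {p q : ℝ} (hp : 0 ≤ p) (hp1 : p ≤ 1) (hq : 1 ≤ q) {n : ℕ}
    (hn : Fintype.card V = n) (r : ℕ) (S : Finset V) (ω₀ : Finset (Sym2 V)) :
    (1 - p) ^ (r * n) * Ex p (Ein Sᶜ) (fun ω₂ => if sm r S (ω₀ ∪ ω₂) then q ^ kc (ω₀ ∪ ω₂) else 0) ≤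
      q ^ kc ω₀ * (p / q + (1 - p)) ^ (Ein Sᶜ).card := by
  have s0 : 0 ≤ 1 - p := by linarith
  have q0 : 0 < q := by linarith
  set E := Ein Sᶜ with hE
  choose F hF hR hc using fun ω => exists_forest ω₀ ω
  rw [show p / q + (1 - p) = p * (1 / q) + (1 - p) by ring, ← Ex_pow, mul_comm (q ^ kc ω₀), ← Ex_mul_right]
  unfold Ex
  have hmaps : ∀ ω ∈ E.powerset, F ω ∈ E.powerset := fun ω hω =>
    Finset.mem_powerset.2 ((hF ω).trans (Finset.mem_powerset.1 hω))
  rw [← Finset.sum_fiberwise_of_maps_to hmaps, Finset.mul_sum]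
  refine Finset.sum_le_sum fun X hX => ?_
  rw [Finset.mem_powerset] at hX
  set fib := E.powerset.filter (fun ω => F ω = X) with hfib
  by_cases hex : ∃ ω ∈ fib, sm r S (ω₀ ∪ ω)
  swap
  · have : ∑ ω ∈ fib, p ^ ω.card * (1 - p) ^ (E.card - ω.card) *
        (if sm r S (ω₀ ∪ ω) then q ^ kc (ω₀ ∪ ω) else 0) = 0 := by
      refine Finset.sum_eq_zero fun ω hω => ?_
      rw [if_neg (fun h => hex ⟨ω, hω, h⟩), mul_zero]
    rw [this, mul_zero]
    positivity
  obtain ⟨ω', hω', hsm⟩ := hex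
  rw [hfib, Finset.mem_filter] at hω'
  set cl := E.filter (fun e => ∀ u ∈ e, ∀ v ∈ e, Rc (ω₀ ∪ X) u v) with hcl
  have hR' : ∀ u v, Rc (ω₀ ∪ X) u v ↔ Rc (ω₀ ∪ ω') u v := by
    intro u v; rw [← hω'.2, hR]
  have hclcard : cl.card ≤ r * n := by
    have hsub : cl ⊆ (Sᶜ).biUnion (fun v => (Finset.univ.filter (fun u => Rc (ω₀ ∪ ω') v u)).image (fun u => s(v, u))) := by
      intro e he
      induction e with | _ x y => ?_
      rw [hcl, Finset.mem_filter] at he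
      rw [Finset.mem_biUnion]
      refine ⟨x, (mem_Ein.1 he.1).2.1, ?_⟩
      rw [Finset.mem_image]
      refine ⟨y, ?_, rfl⟩
      rw [Finset.mem_filter]
      exact ⟨Finset.mem_univ _, (hR' x y).1 (he.2 x (by simp) y (by simp))⟩
    refine (Finset.card_le_card hsub).trans ?_
    refine (Finset.card_biUnion_le_card_mul _ _ r ?_).trans ?_
    · intro v hv
      exact Finset.card_image_le.trans (hsm v (Finset.mem_compl.1 hv))
    · rw [mul_comm]
      exact Nat.mul_le_mul_left _ (by rw [← hn]; exact Finset.card_le_univ _)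
  set Y := cl \ X with hY
  have hYE : Y.card ≤ E.card - X.card := by
    rw [← Finset.card_sdiff_of_subset hX]
    exact Finset.card_le_card (Finset.sdiff_subset_sdiff (Finset.filter_subset _ _) le_rfl)
  have hYr : Y.card ≤ r * n := (Finset.card_le_card Finset.sdiff_subset).trans hclcard
  have hfibY : ∀ ω ∈ fib, X ⊆ ω ∧ ω \ X ⊆ Y := by
    intro ω hω
    rw [hfib, Finset.mem_filter, Finset.mem_powerset] at hω
    refine ⟨by rw [← hω.2]; exact hF ω, Finset.sdiff_subset_sdiff ?_ le_rfl⟩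
    intro e he
    rw [hcl, Finset.mem_filter]
    refine ⟨hω.1 he, ?_⟩
    induction e with | _ x y => ?_
    have hxy : Rc (ω₀ ∪ X) x y := by
      rw [← hω.2, hR]; exact Rc_of_mem (Finset.mem_union_right _ he)
    intro u hu v hv
    rw [Sym2.mem_iff] at hu hv
    rcases hu with rfl | rfl <;> rcases hv with rfl | rfl
    · exact Rc_refl _ _
    · exact hxy
    · exact hxy.symm
    · exact Rc_refl _ _
  set C := q ^ kc ω₀ * (1 / q) ^ X.card * p ^ X.card * (1 - p) ^ (E.card - X.card - Y.card) with hC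
  have hC0 : 0 ≤ C := by positivity
  have hterm : ∀ ω ∈ fib, p ^ ω.card * (1 - p) ^ (E.card - ω.card) *
      (if sm r S (ω₀ ∪ ω) then q ^ kc (ω₀ ∪ ω) else 0) ≤
      C * (fun Z : Finset (Sym2 V) => p ^ Z.card * (1 - p) ^ (Y.card - Z.card)) (ω \ X) := by
    intro ω hω
    obtain ⟨h1, h2⟩ := hfibY ω hω
    rw [hfib, Finset.mem_filter, Finset.mem_powerset] at hω
    have hcard : ω.card = X.card + (ω \ X).card := by
      have := Finset.card_sdiff_add_card_eq_card h1; omega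
    have hZ := Finset.card_le_card h2
    have hk : X.card + kc (ω₀ ∪ ω) = kc ω₀ := by rw [← hω.2]; exact hc ω
    have hle : (if sm r S (ω₀ ∪ ω) then q ^ kc (ω₀ ∪ ω) else 0) ≤ q ^ kc ω₀ * (1 / q) ^ X.card := by
      have : q ^ kc ω₀ * (1 / q) ^ X.card = q ^ kc (ω₀ ∪ ω) := by
        rw [← hk, pow_add, one_div, inv_pow]; field_simp
      rw [this]
      split_ifs
      · exact le_rfl
      · positivity
    calc _ ≤ p ^ ω.card * (1 - p) ^ (E.card - ω.card) * (q ^ kc ω₀ * (1 / q) ^ X.card) :=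
          mul_le_mul_of_nonneg_left hle (by positivity)
      _ = _ := by
          rw [hC, hcard, show E.card - (X.card + (ω \ X).card) = (E.card - X.card - Y.card) +
            (Y.card - (ω \ X).card) by omega, pow_add, pow_add]
          ring
  have hsum : ∑ ω ∈ fib, p ^ ω.card * (1 - p) ^ (E.card - ω.card) *
      (if sm r S (ω₀ ∪ ω) then q ^ kc (ω₀ ∪ ω) else 0) ≤ C := by
    refine (Finset.sum_le_sum hterm).trans ?_
    rw [← Finset.mul_sum]
    have : ∑ ω ∈ fib, (fun Z : Finset (Sym2 V) => p ^ Z.card * (1 - p) ^ (Y.card - Z.card)) (ω \ X) ≤ 1 := by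
      rw [← Finset.sum_image (s := fib) (g := fun ω => ω \ X)
        (f := fun Z : Finset (Sym2 V) => p ^ Z.card * (1 - p) ^ (Y.card - Z.card))]
      · have hone : ∑ Z ∈ Y.powerset, p ^ Z.card * (1 - p) ^ (Y.card - Z.card) = 1 := by
          rw [Finset.sum_pow_mul_eq_add_pow]; simp
        refine le_trans ?_ hone.le
        refine Finset.sum_le_sum_of_subset_of_nonneg ?_ fun Z _ _ => by positivity
        intro Z hZ
        rw [Finset.mem_image] at hZ
        obtain ⟨ω, hω, rfl⟩ := hZ
        exact Finset.mem_powerset.2 (hfibY ω hω).2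
      · intro ω hω ω'' hω'' heq
        have a1 := Finset.sdiff_union_of_subset (hfibY ω hω).1
        have a2 := Finset.sdiff_union_of_subset (hfibY ω'' hω'').1
        rw [← a1, ← a2]
        simp only at heq
        rw [heq]
    exact mul_le_of_le_one_right hC0 this
  refine (mul_le_mul_of_nonneg_left hsum (by positivity)).trans ?_
  have hpow : (1 - p) ^ (r * n) * (1 - p) ^ (E.card - X.card - Y.card) ≤ (1 - p) ^ (E.card - X.card) := by
    rw [← pow_add]
    exact pow_le_pow_of_le_one s0 (by linarith) (by omega)
  calc (1 - p) ^ (r * n) * C = q ^ kc ω₀ * (1 / q) ^ X.card * p ^ X.card *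
        ((1 - p) ^ (r * n) * (1 - p) ^ (E.card - X.card - Y.card)) := by rw [hC]; ring
    _ ≤ q ^ kc ω₀ * (1 / q) ^ X.card * p ^ X.card * (1 - p) ^ (E.card - X.card) :=
        mul_le_mul_of_nonneg_left hpow (by positivity)
    _ = _ := by ring

end Bounds

section Upper
variable {V : Type*} [Fintype V] [DecidableEq V]

/-- the event that `S` is the union of the large components, with representatives `A` -/
def Evt (r : ℕ) (S A : Finset V) (ω : Finset (Sym2 V)) : Prop :=
  evh A S ω ∧ (∀ u v, s(u, v) ∈ ω → (u ∈ S ↔ v ∈ S)) ∧ sm r S ω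

open Classical in
lemma up_SA {p q : ℝ} (hp : 0 ≤ p) (hp1 : p ≤ 1) (hq : 1 ≤ q) {n : ℕ}
    (hn : Fintype.card V = n) (r : ℕ) (S A : Finset V) (hA : A ⊆ S) :
    (1 - p) ^ (r * n) * Ex p (Ein Finset.univ) (fun ω => if Evt r S A ω then q ^ kc ω else 0) ≤
      (1 - (1 - p) ^ S.card) ^ (S.card - A.card) * ((1 - p) ^ (S.card * Sᶜ.card) *
        (q ^ (A.card + Sᶜ.card) * (p / q + (1 - p)) ^ (Sᶜ.card.choose 2))) := by
  have s0 : 0 ≤ 1 - p := by linarith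
  have q0 : 0 < q := by linarith
  have hd : Disjoint S Sᶜ := disjoint_compl_right
  set C := (1 - p) ^ (S.card * Sᶜ.card) *
        (q ^ (A.card + Sᶜ.card) * (p / q + (1 - p)) ^ (Sᶜ.card.choose 2)) with hC
  have hC0 : 0 ≤ C := by positivity
  have h1 := hs_upper hp hp1 _ A (S \ A) Finset.disjoint_sdiff rfl
  rw [Finset.card_sdiff_of_subset hA, show A.card + (S.card - A.card) = S.card from
    Nat.add_sub_cancel' (Finset.card_le_card hA)] at h1
  refine le_trans ?_ (mul_le_mul_of_nonneg_right h1 hC0)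
  unfold hs
  rw [Finset.union_sdiff_of_subset hA, ← Ex_mul_right, ← Finset.union_compl S, Ex_split hd,
    mul_comm, ← Ex_mul_right]
  refine Ex_mono hp hp1 fun ω₀ h0 => ?_
  rw [Ex_eq_empty]
  swap
  · intro ω₁ h1 hne
    obtain ⟨e, he⟩ := Finset.nonempty_iff_ne_empty.2 hne
    refine (Ex_congr (g := fun _ => 0) fun ω₂ h2 => ?_).trans (Ex_const _ _)
    rw [if_neg]
    rintro ⟨-, h, -⟩
    have he' := h1 he
    induction e with | _ x y => ?_
    have hxy := h x y (by simp [he])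
    rw [mem_Ecr] at he'
    simp only [Finset.mem_compl] at he'
    tauto
  rw [card_Ecr hd]
  simp only [Finset.empty_union]
  by_cases hev : evh A (S \ A) ω₀
  · rw [if_pos hev, one_mul]
    have hsb := small_bound hp hp1 hq hn r S ω₀
    have hle : Ex p (Ein Sᶜ) (fun ω₂ => if Evt r S A (ω₀ ∪ ω₂) then q ^ kc (ω₀ ∪ ω₂) else 0) ≤
        Ex p (Ein Sᶜ) (fun ω₂ => if sm r S (ω₀ ∪ ω₂) then q ^ kc (ω₀ ∪ ω₂) else 0) := by
      refine Ex_mono hp hp1 fun ω₂ h2 => ?_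
      by_cases h : Evt r S A (ω₀ ∪ ω₂)
      · rw [if_pos h, if_pos h.2.2]
      · rw [if_neg h]; split_ifs <;> positivity
    have hk : kc ω₀ ≤ A.card + Sᶜ.card := by
      refine (kc_le_card (A ∪ Sᶜ) ?_).trans (Finset.card_union_le _ _)
      intro v
      by_cases hv : v ∈ S
      · by_cases hvA : v ∈ A
        · exact ⟨v, by simp [hvA], Rc_refl _ _⟩
        · obtain ⟨a, ha, hav⟩ := hev v (by simp [hv, hvA])
          exact ⟨a, by simp [ha], hav⟩
      · exact ⟨v, by simp [hv], Rc_refl _ _⟩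
    rw [card_Ein] at hsb
    have hb : 0 ≤ p / q + (1 - p) := by positivity
    calc _ = (1 - p) ^ (S.card * Sᶜ.card) * ((1 - p) ^ (r * n) *
          Ex p (Ein Sᶜ) (fun ω₂ => if Evt r S A (ω₀ ∪ ω₂) then q ^ kc (ω₀ ∪ ω₂) else 0)) := by ring
      _ ≤ (1 - p) ^ (S.card * Sᶜ.card) * ((1 - p) ^ (r * n) *
          Ex p (Ein Sᶜ) (fun ω₂ => if sm r S (ω₀ ∪ ω₂) then q ^ kc (ω₀ ∪ ω₂) else 0)) := by
        gcongr
      _ ≤ (1 - p) ^ (S.card * Sᶜ.card) * (q ^ kc ω₀ * (p / q + (1 - p)) ^ (Sᶜ.card.choose 2)) := by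
        gcongr
      _ ≤ C := by
        rw [hC]
        gcongr
  · rw [if_neg hev, zero_mul]
    refine le_of_eq ?_
    have : Ex p (Ein Sᶜ) (fun ω₂ => if Evt r S A (ω₀ ∪ ω₂) then q ^ kc (ω₀ ∪ ω₂) else 0) = 0 := by
      refine (Ex_congr (g := fun _ => 0) fun ω₂ h2 => ?_).trans (Ex_const _ _)
      rw [if_neg]
      rintro ⟨h, -, -⟩
      apply hev
      intro u hu
      rw [Finset.mem_sdiff] at hu
      obtain ⟨a, ha, hau⟩ := h u hu.1
      refine ⟨a, ha, ?_⟩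
      have := Rc.ind (P := fun w => w ∈ S ∧ Rc ω₀ a w) ⟨hA ha, Rc_refl _ _⟩ ?_ hau
      · exact this.2
      · rintro x y hxy ⟨hx, hax⟩
        rw [Finset.mem_union] at hxy
        rcases hxy with hxy | hxy
        · exact ⟨(mem_Ein.1 (h0 hxy)).2.2, hax.trans (Rc_of_mem hxy)⟩
        · have := (mem_Ein.1 (h2 hxy)).2.1
          rw [Finset.mem_compl] at this
          exact absurd hx this
    rw [this]; ring

open Classical in
lemma cover {n : ℕ} (hn : Fintype.card V = n) (r : ℕ) (ω : Finset (Sym2 V)) :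
    ∃ S A : Finset V, A ⊆ S ∧ (S = ∅ ∨ r < S.card) ∧ A.card * r ≤ n ∧ Evt r S A ω := by
  set cl : V → Finset V := fun v => Finset.univ.filter fun u => Rc ω v u with hcl
  have hclc : ∀ u v, Rc ω u v → cl u = cl v := by
    intro u v h
    ext w
    simp only [hcl, Finset.mem_filter, Finset.mem_univ, true_and]
    exact ⟨fun h' => h.symm.trans h', fun h' => h.trans h'⟩
  set S : Finset V := Finset.univ.filter fun v => r < (cl v).card with hS
  set rep : V → V := fun v => Quot.out (Quot.mk (Rc ω) v) with hrep
  have hrepR : ∀ v, Rc ω (rep v) v := fun v => Rc_quot.1 (Quot.out_eq _)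
  have hrepeq : ∀ u v, Rc ω u v → rep u = rep v := by
    intro u v h
    simp only [hrep]
    rw [Rc_quot.2 h]
  have hSc : ∀ u v, Rc ω u v → (u ∈ S ↔ v ∈ S) := by
    intro u v h
    simp only [hS, Finset.mem_filter, Finset.mem_univ, true_and, hclc u v h]
  have hAS : S.image rep ⊆ S := by
    intro a ha
    obtain ⟨v, hv, rfl⟩ := Finset.mem_image.1 ha
    exact (hSc _ _ (hrepR v)).2 hv
  refine ⟨S, S.image rep, hAS, ?_, ?_, ?_, ?_, ?_⟩
  · rcases Finset.eq_empty_or_nonempty S with h | ⟨v, hv⟩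
    · exact Or.inl h
    · right
      have h1 : r < (cl v).card := by simpa [hS] using hv
      refine h1.trans_le (Finset.card_le_card ?_)
      intro u hu
      have : Rc ω v u := by simpa [hcl] using hu
      exact (hSc _ _ this).1 hv
  · have hdis : ∀ a ∈ S.image rep, ∀ b ∈ S.image rep, a ≠ b → Disjoint (cl a) (cl b) := by
      intro a ha b hb hab
      obtain ⟨v, hv, rfl⟩ := Finset.mem_image.1 ha
      obtain ⟨w, hw, rfl⟩ := Finset.mem_image.1 hb
      rw [Finset.disjoint_left]
      intro x hx hx'
      simp only [hcl, Finset.mem_filter, Finset.mem_univ, true_and] at hx hx'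
      exact hab (hrepeq _ _ ((hrepR v).symm.trans (hx.trans (hx'.symm.trans (hrepR w)))))
    have h1 := Finset.card_biUnion hdis
    have h2 : ((S.image rep).biUnion cl).card ≤ n := by rw [← hn]; exact Finset.card_le_univ _
    rw [h1] at h2
    refine le_trans ?_ h2
    rw [← smul_eq_mul]
    refine Finset.card_nsmul_le_sum _ _ _ fun a ha => ?_
    have := hAS ha
    rw [hS, Finset.mem_filter] at this
    exact this.2.le
  · intro u hu
    exact ⟨rep u, Finset.mem_image_of_mem _ hu, hrepR u⟩
  · intro u v h
    exact hSc _ _ (Rc_of_mem h)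
  · intro v hv
    simp only [hS, Finset.mem_filter, Finset.mem_univ, true_and, not_lt] at hv
    exact hv

open Classical in
lemma Zq_upper {p q : ℝ} (hp : 0 ≤ p) (hp1 : p ≤ 1) (hq : 1 ≤ q) {n : ℕ}
    (hn : Fintype.card V = n) (r L : ℕ) (hL : n < (L + 1) * r) (δ : ℝ) (hδ : 0 ≤ δ) (hδ1 : δ ≤ 1)
    (hδr : ∀ k, r < k → δ ≤ 1 - (1 - p) ^ k) :
    δ ^ L * ((1 - p) ^ (r * n) * Zq V p q) ≤
      (L + 1) * (n + 1) ^ L * q ^ L * ∑ k ∈ Finset.range (n + 1), Tm n p q k := by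
  have s0 : 0 ≤ 1 - p := by linarith
  have s1 : 1 - p ≤ 1 := by linarith
  have q0 : 0 < q := by linarith
  have hb : 0 ≤ p / q + (1 - p) := by positivity
  set PS : Finset (Finset V) := Finset.univ.filter fun S => S = ∅ ∨ r < S.card with hPS
  set PA : Finset V → Finset (Finset V) := fun S => S.powerset.filter fun A => A.card ≤ L with hPA
  set g : ℕ → ℝ := fun K => (1 - (1 - p) ^ K) ^ K * ((1 - p) ^ (K * (n - K)) *
      (q ^ (n - K) * (p / q + (1 - p)) ^ ((n - K).choose 2))) with hg
  have hu0 : ∀ K : ℕ, 0 ≤ 1 - (1 - p) ^ K := fun K => sub_nonneg.2 (pow_le_one₀ s0 s1)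
  have hg0 : ∀ K, 0 ≤ g K := by
    intro K
    have := hu0 K
    simp only [hg]
    positivity
  have h1 : Zq V p q ≤ ∑ S ∈ PS, ∑ A ∈ PA S,
      Ex p (Ein Finset.univ) (fun ω => if Evt r S A ω then q ^ kc ω else 0) := by
    have e : ∑ S ∈ PS, ∑ A ∈ PA S,
        Ex p (Ein Finset.univ) (fun ω => if Evt r S A ω then q ^ kc ω else 0) =
        Ex p (Ein Finset.univ) (fun ω => ∑ S ∈ PS, ∑ A ∈ PA S, if Evt r S A ω then q ^ kc ω else 0) := by
      rw [Ex_sum]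
      exact Finset.sum_congr rfl fun S _ => by rw [Ex_sum]
    rw [e]
    unfold Zq
    refine Ex_mono hp hp1 fun ω _ => ?_
    obtain ⟨S, A, hAS, hS, hA, hE⟩ := cover hn r ω
    have hnn : ∀ S A, 0 ≤ (if Evt r S A ω then q ^ kc ω else 0) := by
      intro S A; split_ifs <;> positivity
    have hSm : S ∈ PS := by simp [hPS, hS]
    have hAL : A.card ≤ L := by
      by_contra hcon
      have : (L + 1) * r ≤ A.card * r := Nat.mul_le_mul_right _ (by omega)
      omega
    have hAm : A ∈ PA S := by simp [hPA, hAS, hAL]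
    calc q ^ kc ω = if Evt r S A ω then q ^ kc ω else 0 := by rw [if_pos hE]
      _ ≤ ∑ A ∈ PA S, if Evt r S A ω then q ^ kc ω else 0 :=
        Finset.single_le_sum (f := fun A => if Evt r S A ω then q ^ kc ω else 0) (fun A _ => hnn S A) hAm
      _ ≤ _ := Finset.single_le_sum (f := fun S => ∑ A ∈ PA S, if Evt r S A ω then q ^ kc ω else 0)
          (fun S _ => Finset.sum_nonneg fun A _ => hnn S A) hSm
  have h2 : ∀ S ∈ PS, ∀ A ∈ PA S, δ ^ L * ((1 - p) ^ (r * n) *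
      Ex p (Ein Finset.univ) (fun ω => if Evt r S A ω then q ^ kc ω else 0)) ≤ q ^ L * g S.card := by
    intro S hS A hA
    simp only [hPS, hPA, Finset.mem_filter, Finset.mem_univ, true_and, Finset.mem_powerset] at hS hA
    have hup := up_SA hp hp1 hq hn r S A hA.1
    have hc : Sᶜ.card = n - S.card := by rw [Finset.card_compl, hn]
    rw [hc] at hup
    have hAc := Finset.card_le_card hA.1
    have hu := hu0 S.card
    have key : δ ^ L * (1 - (1 - p) ^ S.card) ^ (S.card - A.card) ≤ (1 - (1 - p) ^ S.card) ^ S.card := by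
      rcases hS with rfl | hS
      · simp; exact pow_le_one₀ hδ hδ1
      · have a1 : δ ^ L ≤ (1 - (1 - p) ^ S.card) ^ A.card :=
          (pow_le_pow_of_le_one hδ hδ1 hA.2).trans (pow_le_pow_left₀ hδ (hδr _ hS) _)
        calc _ ≤ (1 - (1 - p) ^ S.card) ^ A.card * (1 - (1 - p) ^ S.card) ^ (S.card - A.card) := by
              gcongr
          _ = _ := by rw [← pow_add, Nat.add_sub_cancel' hAc]
    have hqL : q ^ A.card ≤ q ^ L := pow_le_pow_right₀ hq hA.2
    calc _ ≤ δ ^ L * ((1 - (1 - p) ^ S.card) ^ (S.card - A.card) * ((1 - p) ^ (S.card * (n - S.card)) *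
        (q ^ (A.card + (n - S.card)) * (p / q + (1 - p)) ^ ((n - S.card).choose 2)))) := by gcongr
      _ = (δ ^ L * (1 - (1 - p) ^ S.card) ^ (S.card - A.card)) * (q ^ A.card * ((1 - p) ^ (S.card * (n - S.card)) *
        (q ^ (n - S.card) * (p / q + (1 - p)) ^ ((n - S.card).choose 2)))) := by rw [pow_add]; ring
      _ ≤ (1 - (1 - p) ^ S.card) ^ S.card * (q ^ L * ((1 - p) ^ (S.card * (n - S.card)) *
        (q ^ (n - S.card) * (p / q + (1 - p)) ^ ((n - S.card).choose 2)))) := by gcongr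
      _ = q ^ L * g S.card := by simp only [hg]; ring
  have hcardA : ∀ S : Finset V, ((PA S).card : ℝ) ≤ (L + 1) * (n + 1) ^ L := by
    intro S
    have : PA S ⊆ (Finset.range (L + 1)).biUnion fun j => Finset.powersetCard j S := by
      intro A hA
      simp only [hPA, Finset.mem_filter, Finset.mem_powerset] at hA
      simp only [Finset.mem_biUnion, Finset.mem_range, Finset.mem_powersetCard]
      exact ⟨A.card, by omega, hA.1, rfl⟩
    have h3 := (Finset.card_le_card this).trans Finset.card_biUnion_le
    have h4 : ∑ j ∈ Finset.range (L + 1), (Finset.powersetCard j S).card ≤ (L + 1) * (n + 1) ^ L := by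
      refine (Finset.sum_le_card_nsmul _ _ ((n + 1) ^ L) fun j hj => ?_).trans (by simp)
      rw [Finset.card_powersetCard]
      have hSn : S.card ≤ n := by rw [← hn]; exact Finset.card_le_univ _
      calc S.card.choose j ≤ S.card ^ j := Nat.choose_le_pow _ _
        _ ≤ (n + 1) ^ j := Nat.pow_le_pow_left (by omega) _
        _ ≤ (n + 1) ^ L := Nat.pow_le_pow_right (by omega) (by simpa [Nat.lt_succ_iff] using hj)
    exact_mod_cast h3.trans h4
  have hsum : ∑ S : Finset V, g S.card = ∑ k ∈ Finset.range (n + 1), Tm n p q k := by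
    have := Finset.sum_powerset_apply_card (x := (Finset.univ : Finset V)) g
    rw [Finset.powerset_univ, Finset.card_univ, hn] at this
    rw [this]
    refine Finset.sum_congr rfl fun k _ => ?_
    rw [nsmul_eq_mul]
    simp only [hg, Tm]; ring
  calc δ ^ L * ((1 - p) ^ (r * n) * Zq V p q)
      ≤ δ ^ L * ((1 - p) ^ (r * n) * ∑ S ∈ PS, ∑ A ∈ PA S,
      Ex p (Ein Finset.univ) (fun ω => if Evt r S A ω then q ^ kc ω else 0)) := by gcongr
    _ = ∑ S ∈ PS, ∑ A ∈ PA S, δ ^ L * ((1 - p) ^ (r * n) *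
      Ex p (Ein Finset.univ) (fun ω => if Evt r S A ω then q ^ kc ω else 0)) := by
        simp only [Finset.mul_sum]
    _ ≤ ∑ S ∈ PS, ∑ A ∈ PA S, q ^ L * g S.card :=
        Finset.sum_le_sum fun S hS => Finset.sum_le_sum fun A hA => h2 S hS A hA
    _ ≤ ∑ S ∈ PS, (L + 1) * (n + 1) ^ L * (q ^ L * g S.card) := by
        refine Finset.sum_le_sum fun S _ => ?_
        rw [Finset.sum_const, nsmul_eq_mul]
        exact mul_le_mul_of_nonneg_right (hcardA S) (mul_nonneg (by positivity) (hg0 _))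
    _ ≤ ∑ S : Finset V, (L + 1) * (n + 1) ^ L * (q ^ L * g S.card) :=
        Finset.sum_le_sum_of_subset_of_nonneg (Finset.subset_univ _) fun S _ _ =>
          mul_nonneg (by positivity) (mul_nonneg (by positivity) (hg0 _))
    _ = _ := by rw [← Finset.mul_sum, ← Finset.mul_sum, hsum]; ring

end Upper

lemma Ztot_eq (n : ℕ) (lam q : ℝ) : Ztot n lam q = Zq (Fin n) (lam / n) q := by
  classical
  unfold Ztot Zrc ZP Zq Ex
  rw [finsum_mem_univ, finsum_eq_sum_of_fintype]
  symm
  refine Finset.sum_bij' (fun ω _ => SimpleGraph.fromEdgeSet (ω : Set (Sym2 (Fin n))))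
    (fun G _ => (Finset.univ.filter fun e => e ∈ G.edgeSet)) ?_ ?_ ?_ ?_ ?_
  · intro ω _; exact Finset.mem_univ _
  · intro G _
    rw [Finset.mem_powerset]
    intro e he
    simp only [Finset.mem_filter, Finset.mem_univ, true_and] at he
    simp only [Ein, Finset.mem_filter, Finset.mem_univ, true_and, implies_true, and_true]
    exact G.not_isDiag_of_mem_edgeSet he
  · intro ω hω
    rw [Finset.mem_powerset] at hω
    ext e
    simp only [Finset.mem_filter, Finset.mem_univ, true_and, SimpleGraph.edgeSet_fromEdgeSet]
    constructor
    · intro h; exact_mod_cast h.1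
    · intro h
      refine ⟨by exact_mod_cast h, ?_⟩
      have := hω h
      simp only [Ein, Finset.mem_filter] at this
      exact this.2.1
  · intro G _
    simp
  · intro ω hω
    rw [Finset.mem_powerset] at hω
    have h1 : (SimpleGraph.fromEdgeSet (ω : Set (Sym2 (Fin n)))).edgeSet = (ω : Set (Sym2 (Fin n))) := by
      rw [SimpleGraph.edgeSet_fromEdgeSet]
      ext e
      constructor
      · intro h; exact h.1
      · intro h
        refine ⟨h, ?_⟩
        have := hω (by exact_mod_cast h)
        simp only [Ein, Finset.mem_filter] at this
        exact this.2.1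
    unfold rcW kc
    rw [h1, Set.ncard_coe_finset, card_Ein, Finset.card_univ, Fintype.card_fin, Nat.choose_two_right]

/-- the function `Φ` with `Ψ` replaced by `0` -/
def F0 (lam q θ : ℝ) : ℝ :=
  -Sent θ - lam * θ * (1 - θ) + θ * Real.log (1 - Real.exp (-(lam * θ))) +
    (1 - θ) * (Real.log q - (q - 1) / (2 * q) * (lam * (1 - θ)))

lemma Phi_eq (lam q θ : ℝ) : Phi θ lam q = F0 lam q θ + (1 - θ) * Psi (lam * (1 - θ) / q) := by
  unfold Phi F0 pi1
  rw [show 1 - (1 - Real.exp (-(lam * θ))) = Real.exp (-(lam * θ)) by ring, Real.log_exp]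
  ring

lemma two_log_le {t : ℝ} (ht : 1 ≤ t) : 2 * Real.log t ≤ t - 1 / t := by
  have h := Real.self_le_sinh_iff.2 (Real.log_nonneg ht)
  rw [Real.sinh_log (by linarith)] at h
  rw [one_div]; linarith

lemma Psi_zero {x : ℝ} (h0 : 0 ≤ x) (h1 : x ≤ 1) : Psi x = 0 := by
  unfold Psi
  apply min_eq_right
  rcases h0.eq_or_lt with rfl | h0
  · simp
  · have := two_log_le (one_le_one_div h0 h1)
    rw [Real.log_div one_ne_zero h0.ne', Real.log_one, one_div_one_div] at this
    linarith

lemma Phi_le (lam q θ : ℝ) (h1 : θ ≤ 1) : Phi θ lam q ≤ F0 lam q θ := by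
  rw [Phi_eq]
  have : Psi (lam * (1 - θ) / q) ≤ 0 := min_le_right _ _
  nlinarith

lemma one_sub_exp_pos {y : ℝ} (hy : 0 < y) : 0 < 1 - Real.exp (-y) := by
  have : Real.exp (-y) < 1 := Real.exp_lt_one_iff.2 (by linarith)
  linarith

lemma one_sub_exp_le (y : ℝ) : 1 - Real.exp (-y) ≤ y := by
  have := Real.add_one_le_exp (-y); linarith

lemma le_one_sub_exp (y : ℝ) : y * Real.exp (-y) ≤ 1 - Real.exp (-y) := by
  have h := Real.add_one_le_exp y
  have h2 : Real.exp y * Real.exp (-y) = 1 := by rw [← Real.exp_add]; simp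
  nlinarith [Real.exp_pos (-y)]

lemma neg_Sent (θ : ℝ) : -Sent θ = Real.binEntropy θ := by
  unfold Sent Real.binEntropy
  rw [Real.log_inv, Real.log_inv]; ring

lemma F0_bdd {lam q θ : ℝ} (hq : 1 ≤ q) (hlam : 0 < lam) (h0 : 0 ≤ θ) (h1 : θ ≤ 1) :
    F0 lam q θ ≤ Real.log 2 + Real.log q := by
  unfold F0
  rw [neg_Sent]
  have a1 := Real.binEntropy_le_log_two (p := θ)
  have a2 : θ * Real.log (1 - Real.exp (-(lam * θ))) ≤ 0 := by
    refine mul_nonpos_of_nonneg_of_nonpos h0 (Real.log_nonpos ?_ ?_)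
    · have : Real.exp (-(lam * θ)) ≤ 1 := Real.exp_le_one_iff.2 (by nlinarith)
      linarith
    · linarith [Real.exp_pos (-(lam * θ))]
  have a3 : 0 ≤ lam * θ * (1 - θ) := by
    have : 0 ≤ 1 - θ := by linarith
    positivity
  have a4 := Real.log_nonneg hq
  have a5 : 0 ≤ (1 - θ) * ((q - 1) / (2 * q) * (lam * (1 - θ))) := by
    have : 0 ≤ 1 - θ := by linarith
    have : 0 ≤ q - 1 := by linarith
    positivity
  nlinarith

lemma Phi_bdd {lam q : ℝ} (hq : 1 ≤ q) (hlam : 0 < lam) :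
    BddAbove ((fun θ => Phi θ lam q) '' Set.Icc (0:ℝ) 1) := by
  refine ⟨Real.log 2 + Real.log q, ?_⟩
  rintro _ ⟨θ, hθ, rfl⟩
  exact (Phi_le _ _ _ hθ.2).trans (F0_bdd hq hlam hθ.1 hθ.2)

lemma cont_aux {lam : ℝ} (hlam : 0 < lam) :
    ContinuousOn (fun θ : ℝ => θ * Real.log (1 - Real.exp (-(lam * θ)))) (Set.Ici 0) := by
  intro θ hθ
  rcases (show (0:ℝ) ≤ θ from hθ).eq_or_lt with rfl | h
  · unfold ContinuousWithinAt
    simp only [zero_mul]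
    refine tendsto_of_tendsto_of_tendsto_of_le_of_le'
      (g := fun θ => θ * Real.log lam + θ * Real.log θ - lam * θ * θ) (h := fun _ => 0) ?_ tendsto_const_nhds ?_ ?_
    · have hc : Continuous fun θ : ℝ => θ * Real.log lam + θ * Real.log θ - lam * θ * θ := by
        have := Real.continuous_mul_log
        fun_prop
      have := (hc.tendsto 0).mono_left (nhdsWithin_le_nhds (s := Set.Ici 0))
      simpa using this
    · filter_upwards [self_mem_nhdsWithin] with t ht
      rcases (show (0:ℝ) ≤ t from ht).eq_or_lt with rfl | ht
      · simp
      · have hy : 0 < lam * t := by positivity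
        have h1 := Real.log_le_log (by positivity) (le_one_sub_exp (lam * t))
        rw [Real.log_mul hy.ne' (Real.exp_pos _).ne', Real.log_exp, Real.log_mul hlam.ne' ht.ne'] at h1
        nlinarith
    · filter_upwards [self_mem_nhdsWithin] with t ht
      have ht : (0:ℝ) ≤ t := ht
      refine mul_nonpos_of_nonneg_of_nonpos ht (Real.log_nonpos ?_ ?_)
      · have : Real.exp (-(lam * t)) ≤ 1 := Real.exp_le_one_iff.2 (by nlinarith)
        linarith
      · linarith [Real.exp_pos (-(lam * t))]
  · have := one_sub_exp_pos (y := lam * θ) (by positivity)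
    refine ContinuousAt.continuousWithinAt ?_
    refine ContinuousAt.mul continuousAt_id (ContinuousAt.log ?_ this.ne')
    fun_prop

lemma F0_cont {lam q : ℝ} (hlam : 0 < lam) : ContinuousOn (F0 lam q) (Set.Ici 0) := by
  unfold F0
  simp only [neg_Sent]
  have h1 := cont_aux hlam
  have h2 := Real.binEntropy_continuous
  refine ContinuousOn.add (ContinuousOn.add ?_ h1) ?_
  · exact Continuous.continuousOn (by fun_prop)
  · exact Continuous.continuousOn (by fun_prop)

/-- derivative of `F0` -/
lemma F0_deriv {lam q θ : ℝ} (hq : 1 ≤ q) (hlam : 0 < lam) (h0 : 0 < θ) (h1 : θ < 1) :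
    HasDerivAt (F0 lam q) ((Real.log (lam * (1 - θ) / q) - lam * (1 - θ) / q) -
      (Real.log (lam * θ / (1 - Real.exp (-(lam * θ)))) - lam * θ / (1 - Real.exp (-(lam * θ))))) θ := by
  have hy := one_sub_exp_pos (y := lam * θ) (by positivity)
  have q0 : 0 < q := by linarith
  have h1' : 0 < 1 - θ := by linarith
  have hid := hasDerivAt_id θ
  have hE : HasDerivAt (fun θ : ℝ => 1 - Real.exp (-(lam * θ))) (lam * Real.exp (-(lam * θ))) θ := by
    have h3 : HasDerivAt (fun θ : ℝ => -(lam * θ)) (-(lam * 1)) θ := ((hasDerivAt_id θ).const_mul lam).neg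
    refine (h3.exp.const_sub 1).congr_deriv ?_
    ring
  have hL := hid.mul (hE.log hy.ne')
  have hS := Real.hasDerivAt_binEntropy h0.ne' h1.ne
  have hA : HasDerivAt (fun θ : ℝ => lam * θ * (1 - θ)) (lam * (1 - 2 * θ)) θ := by
    have := ((hasDerivAt_id θ).const_mul lam).mul ((hasDerivAt_id θ).const_sub 1)
    refine this.congr_deriv ?_
    simp only [id]; ring
  have hB : HasDerivAt (fun θ : ℝ => (1 - θ) * (Real.log q - (q - 1) / (2 * q) * (lam * (1 - θ))))
      (-Real.log q + (q - 1) / q * lam * (1 - θ)) θ := by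
    have i1 := (hasDerivAt_id θ).const_sub 1
    have := i1.mul (((i1.const_mul lam).const_mul ((q - 1) / (2 * q))).const_sub (Real.log q))
    refine this.congr_deriv ?_
    simp only [id]; field_simp; ring
  have := ((hS.sub hA).add hL).add hB
  have e : F0 lam q = fun θ => Real.binEntropy θ - lam * θ * (1 - θ) +
      θ * Real.log (1 - Real.exp (-(lam * θ))) + (1 - θ) * (Real.log q - (q - 1) / (2 * q) * (lam * (1 - θ))) := by
    funext t; unfold F0; rw [neg_Sent]
  rw [e]
  refine this.congr_deriv ?_
  simp only [id]
  rw [Real.log_div (by positivity) hy.ne', Real.log_div (by positivity) q0.ne',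
    Real.log_mul hlam.ne' h1'.ne', Real.log_mul hlam.ne' h0.ne']
  set E := Real.exp (-(lam * θ))
  have : lam * θ / (1 - E) = lam * θ + θ * (lam * E / (1 - E)) := by field_simp; ring
  rw [this]
  field_simp
  ring

lemma log_sub_anti {z x : ℝ} (hz : 1 ≤ z) (hx : z ≤ x) : Real.log x - x ≤ Real.log z - z := by
  have z0 : 0 < z := by linarith
  have x0 : 0 < x := by linarith
  have h := Real.log_le_sub_one_of_pos (x := x / z) (by positivity)
  rw [Real.log_div x0.ne' z0.ne'] at h
  have : x / z - 1 ≤ x - z := by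
    rw [div_sub_one z0.ne', div_le_iff₀ z0]
    nlinarith
  linarith

lemma z_mono {a b : ℝ} (ha : 0 < a) (hab : a ≤ b) :
    a / (1 - Real.exp (-a)) ≤ b / (1 - Real.exp (-b)) := by
  have hb : 0 < b := by linarith
  rw [div_le_div_iff₀ (one_sub_exp_pos ha) (one_sub_exp_pos hb)]
  have h := convexOn_exp.2 (Set.mem_univ 0) (Set.mem_univ (-b)) (show 0 ≤ 1 - a / b by rw [sub_nonneg, div_le_one hb]; exact hab)
    (show 0 ≤ a / b by positivity) (by ring)
  simp only [smul_eq_mul, mul_zero, zero_add, Real.exp_zero, mul_one] at h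
  rw [show a / b * -b = -a by field_simp] at h
  have : b * Real.exp (-a) ≤ b * (1 - a / b + a / b * Real.exp (-b)) := by gcongr
  rw [show b * (1 - a / b + a / b * Real.exp (-b)) = b - a + a * Real.exp (-b) by field_simp] at this
  nlinarith

lemma z_ge {a : ℝ} (ha : 0 < a) : 1 ≤ a / (1 - Real.exp (-a)) := by
  rw [le_div_iff₀ (one_sub_exp_pos ha)]
  linarith [one_sub_exp_le a]

lemma rho_mono {w v : ℝ} (hw : 1 ≤ w) (hv : w ≤ v) :
    (w + 1) * (v - 1) * Real.log w ≤ (w - 1) * (v + 1) * Real.log v := by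
  rcases hw.eq_or_lt with rfl | hw
  · simp
  have hm : MonotoneOn (fun t : ℝ => (t + 1) * Real.log t / (t - 1)) (Set.Icc w v) := by
    have hd : ∀ t ∈ Set.Icc w v, HasDerivAt (fun t : ℝ => (t + 1) * Real.log t / (t - 1))
        (((1 * Real.log t + (t + 1) * t⁻¹) * (t - 1) - (t + 1) * Real.log t * 1) / (t - 1) ^ 2) t := by
      intro t ht
      have : 1 < t := hw.trans_le ht.1
      exact ((((hasDerivAt_id t).add_const 1).mul (Real.hasDerivAt_log (by linarith))).div
        ((hasDerivAt_id t).sub_const 1) (sub_pos.2 this).ne')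
    refine monotoneOn_of_deriv_nonneg (convex_Icc _ _) (fun t ht => (hd t ht).continuousAt.continuousWithinAt)
      (fun t ht => (hd t (interior_subset ht)).differentiableAt.differentiableWithinAt) ?_
    intro t ht
    have ht := interior_subset ht
    rw [(hd t ht).deriv]
    have t1 : 1 < t := hw.trans_le ht.1
    have t0 : 0 < t := by linarith
    apply div_nonneg _ (sq_nonneg _)
    have := two_log_le t1.le
    have e : (1 * Real.log t + (t + 1) * t⁻¹) * (t - 1) - (t + 1) * Real.log t * 1 =
      (t - 1 / t) - 2 * Real.log t := by field_simp; ring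
    rw [e]; linarith
  have := hm ⟨le_rfl, hv⟩ ⟨hv, le_rfl⟩ hv
  simp only at this
  rw [div_le_div_iff₀ (by linarith) (by linarith)] at this
  nlinarith

lemma F0_zero (lam q : ℝ) : F0 lam q 0 = Real.log q - (q - 1) / (2 * q) * lam := by
  unfold F0 Sent; simp

lemma exists_crit {lam q : ℝ} (hq : 1 ≤ q) (hlam : q < lam) :
    ∃ θ ∈ Set.Icc (0:ℝ) 1, F0 lam q 0 ≤ Phi θ lam q := by
  have q0 : 0 < q := by linarith
  have l0 : 0 < lam := by linarith
  have hr : 1 < lam / q := by rw [lt_div_iff₀ q0]; linarith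
  set y0 := Real.log (lam / q) with hy0
  have y00 : 0 < y0 := Real.log_pos hr
  have hy0l : y0 ≤ lam := by
    have h1 := Real.log_le_sub_one_of_pos (x := lam / q) (by positivity)
    have : lam / q ≤ lam := div_le_self l0.le hq
    linarith
  obtain ⟨y, hy, hyz⟩ : ∃ y ∈ Set.Icc y0 lam, y * (1 + (q - 1) * Real.exp (-y)) - lam * (1 - Real.exp (-y)) = 0 := by
    have hc : ContinuousOn (fun y : ℝ => y * (1 + (q - 1) * Real.exp (-y)) - lam * (1 - Real.exp (-y)))
        (Set.Icc y0 lam) := Continuous.continuousOn (by fun_prop)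
    refine intermediate_value_Icc hy0l hc ⟨?_, ?_⟩
    · have e : Real.exp (-y0) = q / lam := by
        rw [Real.exp_neg, hy0, Real.exp_log (by positivity), inv_div]
      have h1 := le_one_sub_exp y0
      have h2 : lam * (y0 * Real.exp (-y0)) = y0 * q := by rw [e]; field_simp
      have h3 : Real.exp (-y0) ≤ 1 := Real.exp_le_one_iff.2 (by linarith)
      have h4 : lam * (y0 * Real.exp (-y0)) ≤ lam * (1 - Real.exp (-y0)) := by gcongr
      have h5 : (q - 1) * Real.exp (-y0) ≤ q - 1 := mul_le_of_le_one_right (by linarith) h3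
      nlinarith
    · have := Real.exp_pos (-lam)
      have h1 : lam * (1 + (q - 1) * Real.exp (-lam)) - lam * (1 - Real.exp (-lam)) = lam * q * Real.exp (-lam) := by ring
      show 0 ≤ lam * (1 + (q - 1) * Real.exp (-lam)) - lam * (1 - Real.exp (-lam))
      rw [h1]; positivity
  have yp : 0 < y := y00.trans_le hy.1
  set E := Real.exp (-y) with hE
  have E0 : 0 < E := Real.exp_pos _
  have E1 : E < 1 := Real.exp_lt_one_iff.2 (by linarith)
  set D := 1 + (q - 1) * E with hD
  have D0 : 1 ≤ D := by rw [hD]; nlinarith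
  set θ := y / lam with hθ
  have θe : θ = (1 - E) / D := by
    rw [hθ, div_eq_div_iff l0.ne' (by linarith)]; linarith
  have θ0 : 0 < θ := by positivity
  have lθ : lam * θ = y := by rw [hθ]; field_simp
  set u := 1 - θ with hu
  have ue : u = q * E / D := by
    rw [hu, θe]; field_simp; rw [hD]; ring
  have u0 : 0 < u := by rw [ue]; positivity
  have u1 : u < 1 := by rw [hu]; linarith
  set w := 1 + (q - 1) * θ with hw
  have we : w = q / D := by
    rw [hw, θe]; field_simp; rw [hD]; ring
  have w1 : 1 ≤ w := by rw [hw]; nlinarith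
  have hEuw : E = u / w := by rw [ue, we]; field_simp
  have hyl : y = Real.log w - Real.log u := by
    have : Real.log E = -y := Real.log_exp _
    rw [hEuw, Real.log_div u0.ne' (by linarith)] at this
    linarith
  have hx : lam * u / q ≤ 1 := by
    have : lam * u / q * (1 - E) = y * E := by
      rw [ue]
      have : lam * (1 - E) = y * D := by linarith
      field_simp
      linear_combination this
    have h2 := le_one_sub_exp y
    have h3 : lam * u / q * (1 - E) ≤ 1 * (1 - E) := by rw [this, one_mul]; exact h2
    exact le_of_mul_le_mul_right h3 (by linarith)
  refine ⟨θ, ⟨θ0.le, by linarith⟩, ?_⟩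
  rw [Phi_eq, Psi_zero (by positivity) hx, mul_zero, add_zero, F0_zero]
  have hFθ : F0 lam q θ = Real.log q - Real.log w - (q - 1) / (2 * q) * lam * u ^ 2 := by
    unfold F0 Sent
    rw [lθ, ← hE, ← hu]
    have : Real.log (1 - E) = Real.log θ + Real.log q - Real.log w := by
      have : 1 - E = θ * q / w := by rw [θe, we]; field_simp
      rw [this, Real.log_div (by positivity) (by linarith), Real.log_mul θ0.ne' q0.ne']
    rw [this, hyl]
    have : θ = 1 - u := by rw [hu]; ring
    rw [this]; ring
  rw [hFθ]
  -- the inequality `w ≤ 1 / u`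
  have hwv : w ≤ 1 / u := by
    by_contra hcon
    push Not at hcon
    have v1 : 1 ≤ 1 / u := one_le_one_div u0 u1.le
    have a1 := log_sub_anti v1 hcon.le
    have a2 := two_log_le v1
    rw [one_div_one_div] at a2
    rw [Real.log_div one_ne_zero u0.ne', Real.log_one] at a1 a2
    have a3 : w - u < y := by
      rw [← lθ, hw, hu]
      nlinarith
    linarith
  have hrho := rho_mono w1 hwv
  rw [Real.log_div one_ne_zero u0.ne', Real.log_one] at hrho
  have hrho2 : (w + 1) * (1 - u) * Real.log w ≤ (w - 1) * (1 + u) * (-Real.log u) := by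
    have := mul_le_mul_of_nonneg_left hrho u0.le
    have e1 : u * ((w + 1) * (1 / u - 1) * Real.log w) = (w + 1) * (1 - u) * Real.log w := by
      field_simp
    have e2 : u * ((w - 1) * (1 / u + 1) * (0 - Real.log u)) = (w - 1) * (1 + u) * (-Real.log u) := by
      field_simp; ring
    rw [e1, e2] at this; exact this
  have hw1 : w - 1 = (q - 1) * (1 - u) := by rw [hw, hu]; ring
  have hg : (w + 1) * Real.log w ≤ (q - 1) * (1 + u) * (-Real.log u) := by
    rw [hw1] at hrho2
    have : (1 - u) * ((w + 1) * Real.log w) ≤ (1 - u) * ((q - 1) * (1 + u) * (-Real.log u)) := by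
      calc _ = (w + 1) * (1 - u) * Real.log w := by ring
        _ ≤ _ := hrho2
        _ = _ := by ring
    exact le_of_mul_le_mul_left this (by linarith)
  have hfin : 2 * q * ((Real.log q - Real.log w - (q - 1) / (2 * q) * lam * u ^ 2) -
      (Real.log q - (q - 1) / (2 * q) * lam)) =
      (q - 1) * (1 + u) * (-Real.log u) - (w + 1) * Real.log w := by
    have e : lam * (1 - u) = Real.log w - Real.log u := by
      rw [← hyl, ← lθ, hu]; ring
    have hw2 : w = 1 + (q - 1) * (1 - u) := by linarith
    have : 2 * q * ((Real.log q - Real.log w - (q - 1) / (2 * q) * lam * u ^ 2) -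
      (Real.log q - (q - 1) / (2 * q) * lam)) = -2 * q * Real.log w + (q - 1) * (1 + u) * (lam * (1 - u)) := by
      field_simp; ring
    rw [this, e]
    linear_combination (Real.log w) * hw2
  have : 0 ≤ (Real.log q - Real.log w - (q - 1) / (2 * q) * lam * u ^ 2) -
      (Real.log q - (q - 1) / (2 * q) * lam) := by
    have h : 0 ≤ 2 * q * ((Real.log q - Real.log w - (q - 1) / (2 * q) * lam * u ^ 2) -
      (Real.log q - (q - 1) / (2 * q) * lam)) := by rw [hfin]; linarith
    exact nonneg_of_mul_nonneg_right h (by positivity)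
  linarith

lemma F0_le_sup {lam q θ : ℝ} (hq : 1 ≤ q) (hlam : 0 < lam) (h0 : 0 ≤ θ) (h1 : θ ≤ 1) :
    F0 lam q θ ≤ sSup ((fun θ => Phi θ lam q) '' Set.Icc (0:ℝ) 1) := by
  have q0 : 0 < q := by linarith
  suffices ∃ t ∈ Set.Icc (0:ℝ) 1, F0 lam q θ ≤ Phi t lam q by
    obtain ⟨t, ht, h⟩ := this
    exact h.trans (le_csSup (Phi_bdd hq hlam) ⟨t, ht, rfl⟩)
  rcases le_or_gt (lam * (1 - θ) / q) 1 with hx | hx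
  · refine ⟨θ, ⟨h0, h1⟩, ?_⟩
    have : 0 ≤ 1 - θ := by linarith
    rw [Phi_eq, Psi_zero (by positivity) hx]; simp
  rw [lt_div_iff₀ q0, one_mul] at hx
  have hlq : q < lam := by nlinarith
  rcases h0.eq_or_lt with rfl | h0
  · exact exists_crit hq hlq
  have h1s : θ < 1 := by
    rcases h1.eq_or_lt with rfl | h
    · simp at hx; linarith
    · exact h
  have hθpos : 0 < lam * θ := by positivity
  rcases le_or_gt (lam * θ / (1 - Real.exp (-(lam * θ)))) (lam * (1 - θ) / q) with hz | hz
  · -- antitone on `[0, θ]`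
    obtain ⟨t, ht, h⟩ := exists_crit hq hlq
    refine ⟨t, ht, le_trans ?_ h⟩
    have hm : AntitoneOn (F0 lam q) (Set.Icc 0 θ) := by
      refine antitoneOn_of_deriv_nonpos (convex_Icc _ _) ((F0_cont hlam).mono fun t ht => ht.1) ?_ ?_
      · intro t ht
        rw [interior_Icc] at ht
        exact (F0_deriv hq hlam ht.1 (ht.2.trans h1s)).differentiableAt.differentiableWithinAt
      · intro t ht
        rw [interior_Icc] at ht
        rw [(F0_deriv hq hlam ht.1 (ht.2.trans h1s)).deriv]
        have ht0 : 0 < lam * t := mul_pos hlam ht.1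
        have a1 := z_ge ht0
        have a2 : lam * t / (1 - Real.exp (-(lam * t))) ≤ lam * θ / (1 - Real.exp (-(lam * θ))) :=
          z_mono ht0 (by nlinarith [ht.2])
        have a3 : lam * (1 - θ) / q ≤ lam * (1 - t) / q := by
          gcongr; exact ht.2.le
        have := log_sub_anti a1 (a2.trans (hz.trans a3))
        linarith
    exact hm ⟨le_rfl, h0.le⟩ ⟨h0.le, le_rfl⟩ h0.le
  · -- monotone on `[θ, θ*]`
    set ts := 1 - q / lam with hts
    have hqd : q / lam < 1 - θ := by rw [div_lt_iff₀ hlam]; linarith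
    have hqd0 : 0 < q / lam := by positivity
    have hθts : θ ≤ ts := by rw [hts]; linarith
    have hts1 : ts < 1 := by rw [hts]; linarith
    have hxs : lam * (1 - ts) / q = 1 := by rw [hts]; field_simp; ring
    refine ⟨ts, ⟨h0.le.trans hθts, hts1.le⟩, ?_⟩
    rw [Phi_eq, Psi_zero (by rw [hxs]; norm_num) (by rw [hxs]), mul_zero, add_zero]
    have hm : MonotoneOn (F0 lam q) (Set.Icc θ ts) := by
      refine monotoneOn_of_deriv_nonneg (convex_Icc _ _) ((F0_cont hlam).mono fun t ht => h0.le.trans ht.1) ?_ ?_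
      · intro t ht
        rw [interior_Icc] at ht
        exact (F0_deriv hq hlam (h0.trans ht.1) (ht.2.trans hts1)).differentiableAt.differentiableWithinAt
      · intro t ht
        rw [interior_Icc] at ht
        rw [(F0_deriv hq hlam (h0.trans ht.1) (ht.2.trans hts1)).deriv]
        have a2 : lam * θ / (1 - Real.exp (-(lam * θ))) ≤ lam * t / (1 - Real.exp (-(lam * t))) :=
          z_mono hθpos (by nlinarith [ht.1])
        have a3 : lam * (1 - t) / q ≤ lam * (1 - θ) / q := by
          gcongr; exact ht.1.le
        have a4 : 1 ≤ lam * (1 - t) / q := by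
          refine hxs.ge.trans ?_
          gcongr; exact ht.2.le
        have := log_sub_anti a4 (a3.trans (hz.le.trans a2))
        linarith
    exact hm ⟨le_rfl, hθts⟩ ⟨hθts, le_rfl⟩ hθts

lemma log_fact_lower (n : ℕ) : (n:ℝ) * Real.log n - n ≤ Real.log (n.factorial : ℝ) := by
  rcases Nat.eq_zero_or_pos n with rfl | hn
  · simp
  have h := Real.pow_div_factorial_le_exp (n:ℝ) (by positivity) n
  have hf : (0:ℝ) < n.factorial := by exact_mod_cast n.factorial_pos
  have hn' : (0:ℝ) < n := by exact_mod_cast hn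
  have h2 := Real.log_le_log (by positivity) h
  rw [Real.log_exp, Real.log_div (by positivity) hf.ne', Real.log_pow] at h2
  linarith

lemma log_fact_upper (n : ℕ) : Real.log (n.factorial : ℝ) ≤ (n:ℝ) * Real.log n - n + 1 + Real.log n := by
  rcases Nat.eq_zero_or_pos n with rfl | hn
  · simp
  induction n, hn using Nat.le_induction with
  | base => simp
  | succ n hn ih =>
    have hn' : (0:ℝ) < n := by exact_mod_cast hn
    have hf : (0:ℝ) < n.factorial := by exact_mod_cast n.factorial_pos
    rw [Nat.factorial_succ]
    push_cast
    rw [Real.log_mul (by positivity) hf.ne']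
    have h := Real.one_sub_inv_le_log_of_pos (x := ((n:ℝ) + 1) / n) (by positivity)
    rw [Real.log_div (by positivity) hn'.ne', inv_div] at h
    have h3 : 1 - (n:ℝ) / (n + 1) = 1 / (n + 1) := by field_simp; ring
    rw [h3, div_le_iff₀ (by positivity)] at h
    nlinarith

lemma n_Sent {n K : ℕ} (hn : 1 ≤ n) (hK : K ≤ n) :
    (n:ℝ) * Sent ((K:ℝ) / n) = K * Real.log K + ((n - K : ℕ) : ℝ) * Real.log ((n - K : ℕ) : ℝ) - n * Real.log n := by
  have hn' : (0:ℝ) < n := by exact_mod_cast hn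
  have e1 : 1 - (K:ℝ) / n = ((n - K : ℕ) : ℝ) / n := by
    rw [Nat.cast_sub hK]; field_simp
  unfold Sent
  rw [e1]
  have key : ∀ m : ℕ, (m:ℝ) / n * Real.log ((m:ℝ) / n) = (m:ℝ) / n * (Real.log m - Real.log n) := by
    intro m
    rcases Nat.eq_zero_or_pos m with rfl | hm
    · simp
    · have hm' : (0:ℝ) < m := by exact_mod_cast hm
      rw [Real.log_div hm'.ne' hn'.ne']
  rw [key, key]
  have : ((n - K : ℕ) : ℝ) = n - K := Nat.cast_sub hK
  set A := Real.log ((n - K : ℕ) : ℝ)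
  rw [this]
  field_simp
  ring

lemma log_choose_lower {n K : ℕ} (hn : 1 ≤ n) (hK : K ≤ n) :
    -((n:ℝ) * Sent ((K:ℝ) / n)) - 2 - 2 * Real.log n ≤ Real.log (n.choose K : ℝ) := by
  have hlog : ∀ m : ℕ, m ≤ n → Real.log (m:ℝ) ≤ Real.log n := by
    intro m hm
    rcases Nat.eq_zero_or_pos m with rfl | hm0
    · simp only [Nat.cast_zero, Real.log_zero]
      exact Real.log_natCast_nonneg n
    · exact Real.log_le_log (by exact_mod_cast hm0) (by exact_mod_cast hm)
  rw [n_Sent hn hK]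
  have h1 := Nat.choose_mul_factorial_mul_factorial hK
  have h2 : (n.choose K : ℝ) * K.factorial * (n - K).factorial = n.factorial := by exact_mod_cast h1
  have f1 : (0:ℝ) < K.factorial := by exact_mod_cast K.factorial_pos
  have f2 : (0:ℝ) < (n - K).factorial := by exact_mod_cast (n - K).factorial_pos
  have f3 : (0:ℝ) < n.choose K := by exact_mod_cast Nat.choose_pos hK
  have h3 := congrArg Real.log h2
  rw [Real.log_mul (by positivity) f2.ne', Real.log_mul f3.ne' f1.ne'] at h3
  have a1 := log_fact_lower n
  have a2 := log_fact_upper K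
  have a3 := log_fact_upper (n - K)
  have b1 := hlog K hK
  have b2 := hlog (n - K) (Nat.sub_le _ _)
  have : ((n - K : ℕ) : ℝ) = n - K := Nat.cast_sub hK
  linarith

lemma log_choose_upper {n K : ℕ} (hn : 1 ≤ n) (hK : K ≤ n) :
    Real.log (n.choose K : ℝ) ≤ -((n:ℝ) * Sent ((K:ℝ) / n)) := by
  have hn' : (0:ℝ) < n := by exact_mod_cast hn
  rcases Nat.eq_zero_or_pos K with rfl | hK0
  · simp [Sent]
  rcases hK.eq_or_lt with rfl | hKn
  · simp [Sent, hn'.ne']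
  have hK' : (0:ℝ) < K := by exact_mod_cast hK0
  have hKn' : (K:ℝ) < n := by exact_mod_cast hKn
  set θ := (K:ℝ) / n with hθ
  have θ0 : 0 < θ := by positivity
  have θ1 : 0 < 1 - θ := by rw [hθ, sub_pos, div_lt_one hn']; exact hKn'
  have h := add_pow θ (1 - θ) n
  rw [show θ + (1 - θ) = 1 by ring, one_pow] at h
  have h1 : θ ^ K * (1 - θ) ^ (n - K) * (n.choose K : ℝ) ≤ 1 := by
    refine le_trans ?_ h.ge
    exact Finset.single_le_sum (f := fun m => θ ^ m * (1 - θ) ^ (n - m) * (n.choose m : ℝ))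
      (fun m _ => by positivity) (Finset.mem_range.2 (by omega))
  have f3 : (0:ℝ) < n.choose K := by exact_mod_cast Nat.choose_pos hK
  have h2 := Real.log_le_log (by positivity) h1
  rw [Real.log_one, Real.log_mul (by positivity) f3.ne', Real.log_mul (by positivity) (by positivity),
    Real.log_pow, Real.log_pow, Nat.cast_sub hK] at h2
  have e : (n:ℝ) * Sent θ = K * Real.log θ + (n - K) * Real.log (1 - θ) := by
    unfold Sent
    have : (K:ℝ) = n * θ := by rw [hθ]; field_simp
    rw [this]; ring
  linarith

/-- effective edge rate -/
def lnn (lam : ℝ) (n : ℕ) : ℝ := -((n:ℝ) * Real.log (1 - lam / n))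

lemma lnn_tendsto (lam : ℝ) : Tendsto (lnn lam) atTop (𝓝 lam) := by
  have h := (Real.tendsto_mul_log_one_add_div_atTop (-lam)).comp tendsto_natCast_atTop_atTop
  have h2 := h.neg
  rw [neg_neg] at h2
  refine h2.congr fun n => ?_
  simp only [Function.comp, lnn]
  rw [neg_div, ← sub_eq_add_neg]

lemma lnn_ge {lam : ℝ} {n : ℕ} (hn : 1 ≤ n) (h : lam < n) : lam ≤ lnn lam n := by
  have hn' : (0:ℝ) < n := by exact_mod_cast hn
  have h0 : 0 < 1 - lam / n := by rw [sub_pos, div_lt_one hn']; exact h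
  have := Real.log_le_sub_one_of_pos h0
  unfold lnn
  have : (n:ℝ) * Real.log (1 - lam / n) ≤ n * (1 - lam / n - 1) := by gcongr
  have e : (n:ℝ) * (1 - lam / n - 1) = -lam := by field_simp; ring
  linarith

section Main
variable {lam q : ℝ} {n K : ℕ}

lemma Tm_pos (hq : 1 ≤ q) (hlam : 0 < lam) (hn : lam < n) (hK : K ≤ n) : 0 < Tm n (lam / n) q K := by
  have hn' : (0:ℝ) < n := hlam.trans hn
  have h0 : 0 < 1 - lam / n := by rw [sub_pos, div_lt_one hn']; exact hn
  have q0 : 0 < q := by linarith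
  have f3 : (0:ℝ) < n.choose K := by exact_mod_cast Nat.choose_pos hK
  have hu : 0 < (1 - (1 - lam / n) ^ K) ^ K := by
    rcases Nat.eq_zero_or_pos K with rfl | hK0
    · simp
    · have : 0 < lam / n := by positivity
      refine pow_pos (sub_pos.2 (pow_lt_one₀ h0.le (by linarith) (by omega))) _
  unfold Tm
  positivity

lemma log_Tm (hq : 1 ≤ q) (hlam : 0 < lam) (hn : lam < n) (hK : K ≤ n) :
    Real.log (Tm n (lam / n) q K) = Real.log (n.choose K) - (K / n) * (n - K) * lnn lam n +
      K * Real.log (1 - (1 - lam / n) ^ K) + (n - K) * Real.log q -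
      ((n - K) * (n - K - 1) / 2) / n * lnn (lam * (q - 1) / q) n := by
  have hn' : (0:ℝ) < n := hlam.trans hn
  have h0 : 0 < 1 - lam / n := by rw [sub_pos, div_lt_one hn']; exact hn
  have q0 : 0 < q := by linarith
  have f3 : (0:ℝ) < n.choose K := by exact_mod_cast Nat.choose_pos hK
  have hu : 0 < (1 - (1 - lam / n) ^ K) ^ K := by
    rcases Nat.eq_zero_or_pos K with rfl | hK0
    · simp
    · have : 0 < lam / n := by positivity
      refine pow_pos (sub_pos.2 (pow_lt_one₀ h0.le (by linarith) (by omega))) _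
  have hb : 0 < lam / n / q + (1 - lam / n) := by positivity
  unfold Tm
  rw [Real.log_mul (by positivity) (by positivity), Real.log_mul (by positivity) (by positivity),
    Real.log_mul (by positivity) hu.ne', Real.log_mul f3.ne' (by positivity),
    Real.log_pow, Real.log_pow, Real.log_pow, Real.log_pow, Nat.cast_choose_two, Nat.cast_mul, Nat.cast_sub hK]
  unfold lnn
  have e : lam / n / q + (1 - lam / n) = 1 - lam * (q - 1) / q / n := by field_simp; ring
  rw [e]
  field_simp
  ring

lemma pow_le_exp' (hlam : 0 < lam) (hn : lam < n) : (1 - lam / n) ^ K ≤ Real.exp (-(lam * (K / n))) := by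
  have hn' : (0:ℝ) < n := hlam.trans hn
  have h0 : 0 < 1 - lam / n := by rw [sub_pos, div_lt_one hn']; exact hn
  have h1 := Real.one_sub_le_exp_neg (lam / n)
  have h2 := pow_le_pow_left₀ h0.le h1 K
  rw [← Real.exp_nat_mul] at h2
  refine h2.trans (le_of_eq ?_)
  congr 1
  ring

lemma log_Tm_lower (hq : 1 ≤ q) (hlam : 0 < lam) (hn : lam < n) (hK : K ≤ n) :
    n * (F0 lam q (K / n) - (lnn lam n - lam) - (lnn (lam * (q - 1) / q) n - lam * (q - 1) / q)) - 2
      - 2 * Real.log n ≤ Real.log (Tm n (lam / n) q K) := by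
  have hn' : (0:ℝ) < n := hlam.trans hn
  have hn1 : 1 ≤ n := by exact_mod_cast hn'
  have h0 : 0 < 1 - lam / n := by rw [sub_pos, div_lt_one hn']; exact hn
  have q0 : 0 < q := by linarith
  rw [log_Tm hq hlam hn hK]
  have a1 := log_choose_lower hn1 hK
  set θ := (K:ℝ) / n with hθ
  have hKθ : (K:ℝ) = n * θ := by rw [hθ]; field_simp
  have θ0 : 0 ≤ θ := by positivity
  have θ1 : θ ≤ 1 := by rw [hθ, div_le_one hn']; exact_mod_cast hK
  have a2 : K * Real.log (1 - Real.exp (-(lam * θ))) ≤ K * Real.log (1 - (1 - lam / n) ^ K) := by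
    rcases Nat.eq_zero_or_pos K with h | hK0
    · simp [h]
    · have hK' : (0:ℝ) < K := by exact_mod_cast hK0
      have hθ0 : 0 < θ := by positivity
      refine mul_le_mul_of_nonneg_left (Real.log_le_log (one_sub_exp_pos (by positivity)) ?_) hK'.le
      have := pow_le_exp' (K := K) hlam hn
      linarith
  set κ := lam * (q - 1) / q with hκ
  have hκ0 : 0 ≤ κ := by
    have : 0 ≤ q - 1 := by linarith
    positivity
  have hκl : κ < n := by
    refine lt_of_le_of_lt ?_ hn
    rw [hκ, div_le_iff₀ q0]; nlinarith
  have hl := lnn_ge hn1 hn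
  have hk := lnn_ge hn1 hκl
  have a3 : θ * (n - K) * lnn lam n ≤ n * (lam * θ * (1 - θ)) + n * (lnn lam n - lam) := by
    have : θ * (1 - θ) ≤ 1 := by nlinarith
    have h3 : θ * (1 - θ) * (lnn lam n - lam) ≤ 1 * (lnn lam n - lam) :=
      mul_le_mul_of_nonneg_right this (by linarith)
    have h4 := mul_le_mul_of_nonneg_left h3 hn'.le
    rw [hKθ]
    nlinarith
  have a4 : ((n - K) * (n - K - 1) / 2) / n * lnn κ n ≤ n * ((1 - θ) * ((1 - θ) * κ / 2)) + n * (lnn κ n - κ) := by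
    have h1 : (((n:ℝ) - K) * (n - K - 1) / 2) / n ≤ n * ((1 - θ) ^ 2 / 2) := by
      rw [hKθ, div_le_iff₀ hn']
      have : 0 ≤ (n:ℝ) * (1 - θ) := mul_nonneg hn'.le (by linarith)
      nlinarith
    have h2 := mul_le_mul_of_nonneg_right h1 (hκ0.trans hk)
    have h3 : (1 - θ) ^ 2 / 2 ≤ 1 := by nlinarith
    have h4 : (1 - θ) ^ 2 / 2 * (lnn κ n - κ) ≤ 1 * (lnn κ n - κ) :=
      mul_le_mul_of_nonneg_right h3 (by linarith)
    have h5 := mul_le_mul_of_nonneg_left h4 hn'.le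
    nlinarith
  have eF : n * F0 lam q θ = -(n * Sent θ) - n * (lam * θ * (1 - θ)) + K * Real.log (1 - Real.exp (-(lam * θ)))
      + (n - K) * Real.log q - n * ((1 - θ) * ((1 - θ) * κ / 2)) := by
    unfold F0
    rw [hKθ, hκ]
    field_simp
    ring
  linarith

lemma log_Tm_upper (hq : 1 ≤ q) (hlam : 0 < lam) (hn : lam < n) (hK : K ≤ n) :
    Real.log (Tm n (lam / n) q K) ≤ n * F0 lam q (K / n) + n * Real.log (lnn lam n / lam) + lam * (q - 1) / q := by
  have hn' : (0:ℝ) < n := hlam.trans hn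
  have hn1 : 1 ≤ n := by exact_mod_cast hn'
  have h0 : 0 < 1 - lam / n := by rw [sub_pos, div_lt_one hn']; exact hn
  have q0 : 0 < q := by linarith
  rw [log_Tm hq hlam hn hK]
  have a1 := log_choose_upper hn1 hK
  set θ := (K:ℝ) / n with hθ
  have hKθ : (K:ℝ) = n * θ := by rw [hθ]; field_simp
  have θ0 : 0 ≤ θ := by positivity
  have θ1 : θ ≤ 1 := by rw [hθ, div_le_one hn']; exact_mod_cast hK
  have hl := lnn_ge hn1 hn
  have hl0 : 0 < lnn lam n := by linarith
  have hlog : 0 ≤ Real.log (lnn lam n / lam) := Real.log_nonneg (by rw [le_div_iff₀ hlam]; linarith)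
  have a2 : K * Real.log (1 - (1 - lam / n) ^ K) ≤ K * Real.log (1 - Real.exp (-(lam * θ))) +
      n * Real.log (lnn lam n / lam) := by
    rcases Nat.eq_zero_or_pos K with h | hK0
    · simp only [h, Nat.cast_zero, zero_mul, zero_add]; positivity
    · have hK' : (0:ℝ) < K := by exact_mod_cast hK0
      have hθ0 : 0 < θ := by positivity
      have e : (1 - lam / n) ^ K = Real.exp (-(lnn lam n * θ)) := by
        rw [← Real.exp_log (pow_pos h0 K), Real.log_pow]
        congr 1
        unfold lnn
        rw [hKθ]; ring
      have z := z_mono (a := lam * θ) (b := lnn lam n * θ) (by positivity) (by gcongr)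
      have p1 := one_sub_exp_pos (y := lam * θ) (by positivity)
      have p2 := one_sub_exp_pos (y := lnn lam n * θ) (by positivity)
      rw [div_le_div_iff₀ p1 p2] at z
      have z2 : 1 - Real.exp (-(lnn lam n * θ)) ≤ lnn lam n / lam * (1 - Real.exp (-(lam * θ))) := by
        rw [div_mul_eq_mul_div, le_div_iff₀ hlam]
        have : θ * ((1 - Real.exp (-(lnn lam n * θ))) * lam) ≤ θ * (lnn lam n * (1 - Real.exp (-(lam * θ)))) := by
          linarith
        exact le_of_mul_le_mul_left this hθ0
      have z3 := Real.log_le_log p2 z2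
      rw [Real.log_mul (by positivity) p1.ne'] at z3
      rw [e]
      have hKn : (K:ℝ) ≤ n := by exact_mod_cast hK
      nlinarith
  set κ := lam * (q - 1) / q with hκ
  have hκ0 : 0 ≤ κ := by
    have : 0 ≤ q - 1 := by linarith
    positivity
  have hκl : κ < n := by
    refine lt_of_le_of_lt ?_ hn
    rw [hκ, div_le_iff₀ q0]; nlinarith
  have hk := lnn_ge hn1 hκl
  have a3 : n * (lam * θ * (1 - θ)) ≤ θ * (n - K) * lnn lam n := by
    have : 0 ≤ θ * (1 - θ) := mul_nonneg θ0 (by linarith)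
    have h3 : θ * (1 - θ) * lam ≤ θ * (1 - θ) * lnn lam n := by gcongr
    have h4 := mul_le_mul_of_nonneg_left h3 hn'.le
    rw [hKθ]
    nlinarith
  have a4 : n * ((1 - θ) * ((1 - θ) * κ / 2)) - κ ≤ ((n - K) * (n - K - 1) / 2) / n * lnn κ n := by
    have hc : 0 ≤ (((n:ℝ) - K) * (n - K - 1) / 2) / n := by
      have := Nat.cast_choose_two ℝ (n - K)
      rw [Nat.cast_sub hK] at this
      rw [← this]; positivity
    have h1 : (((n:ℝ) - K) * (n - K - 1) / 2) / n * κ ≤ _ := mul_le_mul_of_nonneg_left hk hc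
    refine le_trans ?_ h1
    have e : (((n:ℝ) - K) * (n - K - 1) / 2) / n = n * ((1 - θ) * (1 - θ) / 2) - (1 - θ) / 2 := by
      rw [hKθ]; field_simp
    rw [e]
    nlinarith
  have eF : n * F0 lam q θ = -(n * Sent θ) - n * (lam * θ * (1 - θ)) + K * Real.log (1 - Real.exp (-(lam * θ)))
      + (n - K) * Real.log q - n * ((1 - θ) * ((1 - θ) * κ / 2)) := by
    unfold F0
    rw [hKθ, hκ]
    field_simp
    ring
  linarith

end Main

lemma Ztot_pos {lam q : ℝ} {n : ℕ} (hq : 1 ≤ q) (hlam : 0 < lam) (hn : lam < n) :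
    0 < Zq (Fin n) (lam / n) q := by
  have hn' : (0:ℝ) < n := hlam.trans hn
  have hp : 0 < lam / n := by positivity
  have hp1 : lam / n < 1 := by rw [div_lt_one hn']; exact hn
  have q0 : 0 < q := by linarith
  refine lt_of_lt_of_le ?_ (Zq_lower0 hp.le hp1.le hq)
  have : 0 < 1 - lam / n := by linarith
  positivity

lemma upper_n {lam q : ℝ} {n : ℕ} (hq : 1 ≤ q) (hlam : 0 < lam) (hn : lam < n) (m : ℕ) (hm : 1 ≤ m) (M : ℝ)
    (hM : ∀ θ, 0 ≤ θ → θ ≤ 1 → F0 lam q θ ≤ M) :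
    (1 / (n:ℝ)) * Real.log (Zq (Fin n) (lam / n) q) ≤
      M + Real.log (lnn lam n / lam) + (m + 1) * (Real.log (n + 1) / n) +
      (lam * (q - 1) / q + Real.log (m + 1) + m * Real.log q -
        m * Real.log (1 - Real.exp (-(lam / m)))) / n +
      (1 / m + 1 / n) * lnn lam n := by
  have hn' : (0:ℝ) < n := hlam.trans hn
  have hn1 : 1 ≤ n := by exact_mod_cast hn'
  have hm' : (0:ℝ) < m := by exact_mod_cast hm
  have q0 : 0 < q := by linarith
  have hp : 0 < lam / n := by positivity
  have hp1 : lam / n < 1 := by rw [div_lt_one hn']; exact hn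
  have s0 : 0 < 1 - lam / n := by linarith
  have hZ := Ztot_pos hq hlam hn
  set r := n / m + 1 with hr
  have hrn : n < m * r := by
    rw [hr]
    exact Nat.lt_mul_div_succ n (by omega)
  set δ := 1 - Real.exp (-(lam / m)) with hδ
  have δ0 : 0 < δ := one_sub_exp_pos (by positivity)
  have δ1 : δ ≤ 1 := by rw [hδ]; linarith [Real.exp_pos (-(lam / m))]
  have hup := Zq_upper (V := Fin n) hp.le hp1.le hq (Fintype.card_fin n) r m (by nlinarith) δ δ0.le δ1 (by
    intro k hk
    have h1 := pow_le_exp' (K := k) hlam hn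
    have h2 : Real.exp (-(lam * (k / n))) ≤ Real.exp (-(lam / m)) := by
      rw [Real.exp_le_exp, neg_le_neg_iff, div_eq_mul_inv]
      refine mul_le_mul_of_nonneg_left ?_ hlam.le
      rw [le_div_iff₀ hn', inv_mul_le_iff₀ hm']
      have : n ≤ m * k := by nlinarith
      exact_mod_cast this
    rw [hδ]; linarith)
  set B := n * M + n * Real.log (lnn lam n / lam) + lam * (q - 1) / q with hB
  have hTm : ∀ k ∈ Finset.range (n + 1), Tm n (lam / n) q k ≤ Real.exp B := by
    intro k hk
    have hk : k ≤ n := by simpa [Nat.lt_succ_iff] using hk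
    rw [← Real.log_le_iff_le_exp (Tm_pos hq hlam hn hk)]
    refine (log_Tm_upper hq hlam hn hk).trans ?_
    have := hM ((k:ℝ) / n) (by positivity) (by rw [div_le_one hn']; exact_mod_cast hk)
    have := mul_le_mul_of_nonneg_left this hn'.le
    rw [hB]; linarith
  have hsum := Finset.sum_le_card_nsmul _ _ _ hTm
  rw [Finset.card_range, nsmul_eq_mul] at hsum
  have h3 := hup.trans (mul_le_mul_of_nonneg_left hsum (by positivity))
  have h4 := Real.log_le_log (by positivity) h3
  push_cast at h4
  rw [Real.log_mul (by positivity) (by positivity), Real.log_mul (by positivity) hZ.ne',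
    Real.log_mul (by positivity) (by positivity), Real.log_mul (by positivity) (by positivity),
    Real.log_mul (by positivity) (by positivity), Real.log_mul (by positivity) (by positivity),
    Real.log_pow, Real.log_pow, Real.log_pow, Real.log_pow, Real.log_exp] at h4
  push_cast at h4
  have hl := lnn_ge hn1 hn
  have h5 : -((n / m : ℕ) + 1 : ℝ) * n * Real.log (1 - lam / n) ≤ n * ((1 / m + 1 / n) * lnn lam n) := by
    have e : -((n / m : ℕ) + 1 : ℝ) * n * Real.log (1 - lam / n) = ((n / m : ℕ) + 1 : ℝ) * lnn lam n := by
      unfold lnn; ring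
    rw [e, ← mul_assoc]
    refine mul_le_mul_of_nonneg_right ?_ (by linarith)
    have h6 : ((n / m : ℕ) : ℝ) ≤ (n:ℝ) / m := Nat.cast_div_le
    have e2 : (n:ℝ) * (1 / m + 1 / n) = n / m + 1 := by field_simp
    rw [e2]; linarith
  rw [one_div, inv_mul_le_iff₀ hn']
  have e3 : (n:ℝ) * (M + Real.log (lnn lam n / lam) + (m + 1) * (Real.log (n + 1) / n) +
      (lam * (q - 1) / q + Real.log (m + 1) + m * Real.log q - m * Real.log δ) / n +
      (1 / m + 1 / n) * lnn lam n) = n * M + n * Real.log (lnn lam n / lam) + (m + 1) * Real.log (n + 1) +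
      (lam * (q - 1) / q + Real.log (m + 1) + m * Real.log q - m * Real.log δ) +
      n * ((1 / m + 1 / n) * lnn lam n) := by
    have : (n:ℝ) * ((m + 1) * (Real.log (n + 1) / n)) = (m + 1) * Real.log (n + 1) := by field_simp
    have h2 : (n:ℝ) * ((lam * (q - 1) / q + Real.log (m + 1) + m * Real.log q - m * Real.log δ) / n) =
      (lam * (q - 1) / q + Real.log (m + 1) + m * Real.log q - m * Real.log δ) := by
      rw [mul_div_cancel₀ _ hn'.ne']
    linear_combination this + h2
  rw [← one_div, e3]
  rw [hr] at h4
  push_cast at h4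
  rw [hB] at h4
  linarith

lemma lower_n {lam q : ℝ} {n : ℕ} (hq : 1 ≤ q) (hlam : 0 < lam) (hn : lam < n) (K : ℕ) (hK : K ≤ n) :
    F0 lam q (K / n) - (lnn lam n - lam) - (lnn (lam * (q - 1) / q) n - lam * (q - 1) / q) - 2 / n
      - 3 * (Real.log n / n) ≤ (1 / (n:ℝ)) * Real.log (Zq (Fin n) (lam / n) q) := by
  have hn' : (0:ℝ) < n := hlam.trans hn
  have hn1 : 1 ≤ n := by exact_mod_cast hn'
  have hp : 0 < lam / n := by positivity
  have hp1 : lam / n < 1 := by rw [div_lt_one hn']; exact hn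
  have hZ := Ztot_pos hq hlam hn
  have h1 := Zq_lower (V := Fin n) hp.le hp1.le hq (Fintype.card_fin n) hn1 K
  have h2 := Real.log_le_log (Tm_pos hq hlam hn hK) h1
  rw [Real.log_mul hn'.ne' hZ.ne'] at h2
  have h3 := log_Tm_lower hq hlam hn hK
  rw [one_div, le_inv_mul_iff₀ hn']
  have e : (n:ℝ) * (F0 lam q (K / n) - (lnn lam n - lam) - (lnn (lam * (q - 1) / q) n - lam * (q - 1) / q) - 2 / n
      - 3 * (Real.log n / n)) = n * (F0 lam q (K / n) - (lnn lam n - lam) - (lnn (lam * (q - 1) / q) n - lam * (q - 1) / q)) - 2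
      - 3 * Real.log n := by
    have a : (n:ℝ) * (2 / n) = 2 := by field_simp
    have b : (n:ℝ) * (3 * (Real.log n / n)) = 3 * Real.log n := by field_simp
    linear_combination -a - b
  rw [e]; linarith

lemma log_div_tendsto : Tendsto (fun n : ℕ => Real.log n / (n:ℝ)) atTop (𝓝 0) := by
  have h : Tendsto (fun x : ℝ => Real.log x / x) atTop (𝓝 0) := Real.isLittleO_log_id_atTop.tendsto_div_nhds_zero
  exact h.comp tendsto_natCast_atTop_atTop

lemma log_div_tendsto' : Tendsto (fun n : ℕ => Real.log ((n:ℝ) + 1) / (n:ℝ)) atTop (𝓝 0) := by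
  have h := log_div_tendsto.comp (tendsto_add_atTop_nat 1)
  have h1 : Tendsto (fun n : ℕ => ((n:ℝ) + 1) / n) atTop (𝓝 1) := by
    have h2 : Tendsto (fun n : ℕ => 1 + 1 / (n:ℝ)) atTop (𝓝 (1 + 0)) :=
      tendsto_const_nhds.add tendsto_one_div_atTop_nhds_zero_nat
    rw [add_zero] at h2
    refine h2.congr' ?_
    filter_upwards [eventually_ge_atTop 1] with n hn
    have : (0:ℝ) < n := by exact_mod_cast hn
    field_simp
  have h3 := h.mul h1
  rw [zero_mul] at h3
  refine h3.congr fun n => ?_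
  simp only [Function.comp]
  push_cast
  have : (n:ℝ) + 1 ≠ 0 := by positivity
  field_simp

lemma main_limit (q lam : ℝ) (hq : 1 ≤ q) (hlam : 0 < lam) :
    Tendsto (fun n : ℕ => (1 / (n:ℝ)) * Real.log (Ztot n lam q)) atTop
      (𝓝 (sSup ((fun θ => Phi θ lam q) '' Set.Icc (0:ℝ) 1))) := by
  set M := sSup ((fun θ => Phi θ lam q) '' Set.Icc (0:ℝ) 1) with hM
  have hFM : ∀ θ, 0 ≤ θ → θ ≤ 1 → F0 lam q θ ≤ M := fun θ h0 h1 => F0_le_sup hq hlam h0 h1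
  simp only [Ztot_eq]
  have hev : ∀ᶠ n : ℕ in atTop, lam < n := tendsto_natCast_atTop_atTop.eventually_gt_atTop lam
  have hone : Tendsto (fun n : ℕ => 1 / (n:ℝ)) atTop (𝓝 0) := tendsto_one_div_atTop_nhds_zero_nat
  have hln := lnn_tendsto lam
  rw [tendsto_order]
  constructor
  · intro a ha
    obtain ⟨_, ⟨θ, hθ, rfl⟩, hθa⟩ := exists_lt_of_lt_csSup (Set.Nonempty.image _ ⟨0, by simp⟩) ha
    have hθa : a < F0 lam q θ := lt_of_lt_of_le hθa (Phi_le _ _ _ hθ.2)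
    have hfl : Tendsto (fun n : ℕ => ((⌊θ * n⌋₊ : ℕ) : ℝ) / (n:ℝ)) atTop (𝓝 θ) :=
      (tendsto_nat_floor_mul_div_atTop hθ.1).comp tendsto_natCast_atTop_atTop
    have hF : Tendsto (fun n : ℕ => F0 lam q (((⌊θ * n⌋₊ : ℕ) : ℝ) / (n:ℝ))) atTop (𝓝 (F0 lam q θ)) := by
      refine ((F0_cont hlam) θ hθ.1).tendsto.comp ?_
      refine tendsto_nhdsWithin_iff.2 ⟨hfl, Eventually.of_forall fun n => ?_⟩
      show (0:ℝ) ≤ _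
      positivity
    have hk := lnn_tendsto (lam * (q - 1) / q)
    have hlim := (((hF.sub (hln.sub_const lam)).sub (hk.sub_const (lam * (q - 1) / q))).sub
      (hone.const_mul 2)).sub (log_div_tendsto.const_mul 3)
    simp only [sub_self, mul_zero, sub_zero] at hlim
    filter_upwards [hlim.eventually (lt_mem_nhds hθa), hev] with n h1 hn
    refine lt_of_lt_of_le h1 ?_
    have hK : ⌊θ * n⌋₊ ≤ n := by
      refine Nat.floor_le_of_le ?_
      exact mul_le_of_le_one_left (by positivity) hθ.2
    have := lower_n hq hlam hn _ hK
    rw [show (2:ℝ) / n = 2 * (1 / n) by ring] at this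
    exact this
  · intro b hb
    obtain ⟨m, hm⟩ := exists_nat_gt (lam / (b - M))
    have hbM : 0 < b - M := by linarith
    have hm0 : (0:ℝ) < m := lt_trans (by positivity) hm
    have hm1 : 1 ≤ m := by exact_mod_cast hm0
    have hmb : M + lam / m < b := by
      rw [div_lt_iff₀ hbM] at hm
      have : lam / m < b - M := by rw [div_lt_iff₀ hm0]; linarith
      linarith
    have hl2 : Tendsto (fun n : ℕ => Real.log (lnn lam n / lam)) atTop (𝓝 0) := by
      have := (hln.div_const lam).log (by rw [div_self hlam.ne']; norm_num)
      rwa [div_self hlam.ne', Real.log_one] at this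
    set c := lam * (q - 1) / q + Real.log (m + 1) + m * Real.log q -
        m * Real.log (1 - Real.exp (-(lam / m))) with hc
    have hlim := (((hl2.const_add M).add (log_div_tendsto'.const_mul ((m:ℝ) + 1))).add
      (hone.const_mul c)).add (((hone.const_add (1 / (m:ℝ)))).mul hln)
    have e : M + 0 + ((m:ℝ) + 1) * 0 + c * 0 + (1 / (m:ℝ) + 0) * lam = M + lam / m := by ring
    rw [e] at hlim
    filter_upwards [hlim.eventually (gt_mem_nhds hmb), hev] with n h1 hn
    refine lt_of_le_of_lt ?_ h1
    have := upper_n hq hlam hn m hm1 M hFM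
    rw [← hc, div_eq_mul_one_div c] at this
    exact this

/-- Fix `q ≥ 1` and `λ > 0`. Then the free energy limit holds:
`lim_{n→∞} (1/n) log Z_{n,λ,q} = sup_{θ∈[0,1]} Φ(θ,λ,q)`. -/
theorem stmt7 (q lam : ℝ) (hq : 1 ≤ q) (hlam : 0 < lam) :
    Tendsto (fun n : ℕ => (1 / (n:ℝ)) * Real.log (Ztot n lam q)) atTop
      (𝓝 (sSup ((fun θ => Phi θ lam q) '' Set.Icc (0:ℝ) 1))) :=
  main_limit q lam hq hlam
end
end

section
/- For each η > 0 there exist an integer n₀ < ∞ and a sequence (c_r)_{r≥1} of positive real numbers such that for all n ≥ n₀, k ≥ 1 and r ≥ 2 with k < (1−η)n and rk > (1+η)n, one has Q_{n,k,r} ≥ (c_r/√n) · (1/k!) · inf_{s>0} F_r(s)^k / s^n. -/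
open Filter Topology Set

noncomputable section

/-- `a_l = l^(l−2)`, the number of labelled trees on `l ≥ 1` vertices (`a_1 = 1`). -/
def aTree (l : ℕ) : ℕ := l ^ (l - 2)

/-- `F_r(s) = Σ_{l=1}^r a_l s^l / l!`. -/
def Fpoly (r : ℕ) (s : ℝ) : ℝ :=
  ∑ l ∈ Finset.Icc 1 r, (aTree l : ℝ) * s ^ l / (l.factorial : ℝ)

/-- `Q_{n,k,r} = Σ Π_{l≥1} (a_l/l!)^{m_l} / m_l!`, the sum being over sequences
`(m_l)` of nonnegative integers supported on `{1,…,r}` with `Σ l·m_l = n` and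
`Σ m_l = k`. -/
def Qsum (n k r : ℕ) : ℝ :=
  ∑ᶠ m ∈ {m : ℕ → ℕ | (∀ l, m l ≠ 0 → l ∈ Finset.Icc 1 r) ∧
      (∑ l ∈ Finset.Icc 1 r, l * m l = n) ∧ (∑ l ∈ Finset.Icc 1 r, m l = k)},
    ∏ l ∈ Finset.Icc 1 r, (((aTree l : ℝ) / (l.factorial : ℝ)) ^ m l / ((m l).factorial : ℝ))

/-- `inf_{s>0} F_r(s)^k / s^n`. -/
def infF (n k r : ℕ) : ℝ := ⨅ s : Set.Ioi (0:ℝ), Fpoly r (s:ℝ) ^ k / (s:ℝ) ^ n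

/-- weight of a configuration -/
def Vw (r : ℕ) (p : ℕ → ℝ) (m : ℕ → ℕ) : ℝ :=
  ∏ l ∈ Finset.Icc 1 r, (p l ^ m l / ((m l).factorial : ℝ))

lemma Vw_nonneg (r : ℕ) (p : ℕ → ℝ) (hp : ∀ l, 0 ≤ p l) (m : ℕ → ℕ) : 0 ≤ Vw r p m :=
  Finset.prod_nonneg fun l _ => div_nonneg (pow_nonneg (hp l) _) (by positivity)

lemma pow_eq_Vw (r k : ℕ) (p : ℕ → ℝ) :
    (∑ l ∈ Finset.Icc 1 r, p l) ^ k
      = ∑ m ∈ Finset.piAntidiag (Finset.Icc 1 r) k, (k.factorial : ℝ) * Vw r p m := by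
  rw [Finset.sum_pow_eq_sum_piAntidiag]
  refine Finset.sum_congr rfl fun m hm => ?_
  rw [Finset.mem_piAntidiag] at hm
  have h := Nat.multinomial_spec (Finset.Icc 1 r) m
  rw [hm.1] at h
  have h2 : (∏ i ∈ Finset.Icc 1 r, ((m i).factorial : ℝ)) * (Nat.multinomial (Finset.Icc 1 r) m : ℝ)
      = k.factorial := by exact_mod_cast h
  have h3 : (∏ i ∈ Finset.Icc 1 r, ((m i).factorial : ℝ)) ≠ 0 :=
    Finset.prod_ne_zero_iff.2 fun i _ => by positivity
  rw [Vw, Finset.prod_div_distrib, ← h2]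
  field_simp

lemma Vw_exp (r : ℕ) (p f : ℕ → ℝ) (m : ℕ → ℕ) :
    Vw r (fun l => p l * Real.exp (f l)) m
      = Vw r p m * Real.exp (∑ l ∈ Finset.Icc 1 r, f l * m l) := by
  rw [Vw, Vw, Real.exp_sum, ← Finset.prod_mul_distrib]
  refine Finset.prod_congr rfl fun l _ => ?_
  rw [mul_pow, ← Real.exp_nat_mul, mul_comm (m l : ℝ) (f l)]
  ring

lemma exp_quad (x : ℝ) (hx : |x| ≤ 1) : Real.exp x ≤ 1 + x + x ^ 2 := by
  have := Real.abs_exp_sub_one_sub_id_le hx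
  have := (abs_le.1 this).2
  linarith

/-- one-sided concentration -/
lemma conc (r k : ℕ) (p f : ℕ → ℝ) (R T : ℝ) (hR : 0 ≤ R) (hk : R ≤ √(k:ℝ)) (hk1 : 1 ≤ k)
    (hp : ∀ l, 0 ≤ p l) (hsum : ∑ l ∈ Finset.Icc 1 r, p l = 1)
    (hf : ∀ l ∈ Finset.Icc 1 r, |f l| ≤ R)
    (hf0 : ∑ l ∈ Finset.Icc 1 r, p l * f l = 0) :
    ∑ m ∈ (Finset.piAntidiag (Finset.Icc 1 r) k).filter
        (fun m => T * √(k:ℝ) < ∑ l ∈ Finset.Icc 1 r, f l * m l),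
      (k.factorial : ℝ) * Vw r p m ≤ Real.exp (R ^ 2 - T) := by
  have hkpos : (0:ℝ) < k := by exact_mod_cast hk1
  set y := √(k:ℝ) with hy
  have hy0 : 0 < y := Real.sqrt_pos.2 hkpos
  have hyy : y ^ 2 = k := Real.sq_sqrt hkpos.le
  have h1 : (∑ l ∈ Finset.Icc 1 r, p l * Real.exp (f l / y)) ^ k ≤ Real.exp (R ^ 2) := by
    have h2 : ∑ l ∈ Finset.Icc 1 r, p l * Real.exp (f l / y) ≤ Real.exp (R ^ 2 / k) := by
      have h3 : ∀ l ∈ Finset.Icc 1 r, p l * Real.exp (f l / y)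
          ≤ p l * (1 + R ^ 2 / k) + (p l * f l) / y := by
        intro l hl
        have hfl := hf l hl
        have h4 : |f l / y| ≤ 1 := by
          rw [abs_div, abs_of_pos hy0, div_le_one hy0]; exact hfl.trans hk
        have h5 := exp_quad _ h4
        have h6 : (f l / y) ^ 2 ≤ R ^ 2 / k := by
          rw [div_pow, hyy]
          gcongr 1
          exact sq_le_sq' (by linarith [(abs_le.1 hfl).1]) (abs_le.1 hfl).2
        calc p l * Real.exp (f l / y) ≤ p l * (1 + f l / y + R ^ 2 / k) := by
              apply mul_le_mul_of_nonneg_left _ (hp l); linarith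
          _ = _ := by ring
      refine (Finset.sum_le_sum h3).trans ?_
      rw [Finset.sum_add_distrib, ← Finset.sum_mul, ← Finset.sum_div, hsum, hf0]
      have := Real.add_one_le_exp (R ^ 2 / k)
      simp only [one_mul, zero_div, add_zero]
      linarith
    calc _ ≤ (Real.exp (R ^ 2 / k)) ^ k := by
            apply pow_le_pow_left₀ _ h2
            exact Finset.sum_nonneg fun l _ => mul_nonneg (hp l) (Real.exp_pos _).le
      _ = _ := by
        rw [← Real.exp_nat_mul]; congr 1; field_simp
  rw [pow_eq_Vw] at h1
  have hex : Real.exp (R ^ 2 - T) = Real.exp (-T) * Real.exp (R ^ 2) := by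
    rw [← Real.exp_add]; congr 1; ring
  rw [hex]
  refine le_trans ?_ (mul_le_mul_of_nonneg_left h1 (Real.exp_pos _).le)
  rw [Finset.mul_sum]
  refine le_trans (Finset.sum_le_sum (g := fun m => Real.exp (-T) * ((k.factorial : ℝ) *
    Vw r (fun l => p l * Real.exp (f l / y)) m)) fun m hm => ?_)
    (Finset.sum_le_sum_of_subset_of_nonneg (Finset.filter_subset _ _) fun m _ _ => ?_)
  · rw [Finset.mem_filter] at hm
    rw [Vw_exp]
    have h7 : ∑ l ∈ Finset.Icc 1 r, f l / y * m l = (∑ l ∈ Finset.Icc 1 r, f l * m l) / y := by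
      rw [Finset.sum_div]; exact Finset.sum_congr rfl fun l _ => by ring
    rw [h7]
    have h8 : T ≤ (∑ l ∈ Finset.Icc 1 r, f l * m l) / y := by
      rw [le_div_iff₀ hy0]; exact hm.2.le
    have h9 : 1 ≤ Real.exp (-T) * Real.exp ((∑ l ∈ Finset.Icc 1 r, f l * m l) / y) := by
      rw [← Real.exp_add]; apply Real.one_le_exp; linarith
    have h10 : 0 ≤ (k.factorial : ℝ) * Vw r p m :=
      mul_nonneg (by positivity) (Vw_nonneg r p hp m)
    nlinarith [mul_le_mul_of_nonneg_left h9 h10]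
  · exact mul_nonneg (Real.exp_pos _).le (mul_nonneg (by positivity)
      (Vw_nonneg r _ (fun l => mul_nonneg (hp l) (Real.exp_pos _).le) m))

lemma shift_aux (x y ρ : ℝ) (hx : 0 ≤ x) (hy : 0 ≤ y) (hρ : 0 ≤ ρ) (b d : ℕ) : ∀ a : ℕ,
    ρ * x * (b + d) ≤ y * (a + 1) →
    ρ ^ d * (x ^ (a + d) / (a + d).factorial * (y ^ b / b.factorial))
      ≤ x ^ a / a.factorial * (y ^ (b + d) / (b + d).factorial) := by
  induction d with
  | zero => intro a _; simp
  | succ d ih =>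
    intro a h
    have hρx : 0 ≤ ρ * x := mul_nonneg hρ hx
    push_cast at h
    have h1 := ih (a + 1) (by push_cast; nlinarith)
    have e : a + (d + 1) = a + 1 + d := by ring
    rw [e, pow_succ', mul_assoc]
    refine (mul_le_mul_of_nonneg_left h1 hρ).trans ?_
    have hb : (b + (d + 1)) = (b + d) + 1 := by ring
    rw [hb, Nat.factorial_succ, Nat.factorial_succ, pow_succ, pow_succ]
    push_cast
    have : ρ * x / (a + 1) ≤ y / (b + d + 1) := by
      rw [div_le_div_iff₀ (by positivity) (by positivity)]; linarith
    calc _ = (x ^ a / a.factorial * (y ^ (b + d) / (b + d).factorial)) * (ρ * x / (a + 1)) := by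
          field_simp
      _ ≤ (x ^ a / a.factorial * (y ^ (b + d) / (b + d).factorial)) * (y / (b + d + 1)) :=
          mul_le_mul_of_nonneg_left this (by positivity)
      _ = _ := by field_simp

lemma pair_ratio (p q δ y T : ℝ) (hδ : 0 < δ) (hp : δ ≤ p) (hq : δ ≤ q) (hy : 0 < y) (hT : 0 < T)
    (hyT : 4 * T ≤ δ * y) (a b d : ℕ) (ha : y ^ 2 * p - T * y ≤ a) (hb : (b:ℝ) ≤ y ^ 2 * q + T * y)
    (hd : (d : ℝ) ≤ T * y) (hda : d ≤ a) :
    Real.exp (-(8 * T ^ 2 / δ)) * (p ^ a / a.factorial * (q ^ b / b.factorial))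
      ≤ p ^ (a - d) / (a - d).factorial * (q ^ (b + d) / (b + d).factorial) := by
  obtain ⟨a', rfl⟩ : ∃ a', a = a' + d := ⟨a - d, by omega⟩
  rw [Nat.add_sub_cancel]
  push_cast at ha
  have hp0 : 0 < p := hδ.trans_le hp
  have hq0 : 0 < q := hδ.trans_le hq
  set x := 2 * T / (δ * y) with hx
  have hx0 : 0 < x := by positivity
  have hx1 : x ≤ 1 / 2 := by
    rw [hx, div_le_iff₀ (by positivity)]; linarith
  have hxy : 2 * T * y = x * δ * y ^ 2 := by rw [hx]; field_simp
  set ρ := Real.exp (-(4 * x)) with hρ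
  have hρ0 : 0 < ρ := Real.exp_pos _
  have hρ1 : ρ * (1 + x) ≤ 1 - x := by
    have h1 : ρ * (1 + 4 * x) ≤ 1 := by
      have h2 := Real.add_one_le_exp (4 * x)
      calc ρ * (1 + 4 * x) ≤ ρ * Real.exp (4 * x) := by
            apply mul_le_mul_of_nonneg_left _ hρ0.le; linarith
        _ = 1 := by rw [hρ, ← Real.exp_add]; simp
    have h3 : 1 + x ≤ (1 - x) * (1 + 4 * x) := by nlinarith
    calc ρ * (1 + x) ≤ ρ * ((1 - x) * (1 + 4 * x)) := mul_le_mul_of_nonneg_left h3 hρ0.le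
      _ = (1 - x) * (ρ * (1 + 4 * x)) := by ring
      _ ≤ (1 - x) * 1 := by apply mul_le_mul_of_nonneg_left h1; linarith
      _ = _ := by ring
  have hxy2 : 0 < x * y ^ 2 := by positivity
  have hbd : (b:ℝ) + d ≤ (1 + x) * (y ^ 2 * q) := by nlinarith
  have had : (1 - x) * (y ^ 2 * p) ≤ (a':ℝ) + 1 := by nlinarith
  have hcond : ρ * p * (b + d) ≤ q * (a' + 1) := by
    calc ρ * p * (b + d) ≤ ρ * p * ((1 + x) * (y ^ 2 * q)) :=
          mul_le_mul_of_nonneg_left hbd (by positivity)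
      _ = (ρ * (1 + x)) * (p * y ^ 2 * q) := by ring
      _ ≤ (1 - x) * (p * y ^ 2 * q) := mul_le_mul_of_nonneg_right hρ1 (by positivity)
      _ = q * ((1 - x) * (y ^ 2 * p)) := by ring
      _ ≤ _ := mul_le_mul_of_nonneg_left had hq0.le
  refine le_trans ?_ (shift_aux p q ρ hp0.le hq0.le hρ0.le b d a' hcond)
  apply mul_le_mul_of_nonneg_right _ (by positivity)
  rw [hρ, ← Real.exp_nat_mul, Real.exp_le_exp]
  have : (d:ℝ) * (4 * x) ≤ T * y * (4 * x) := mul_le_mul_of_nonneg_right hd (by positivity)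
  have h2 : T * y * (4 * x) = 8 * T ^ 2 / δ := by rw [hx]; field_simp; ring
  linarith

/-- move `d` parts from size 1 to size 2 -/
def shiftf (d : ℤ) (m : ℕ → ℕ) : ℕ → ℕ :=
  Function.update (Function.update m 1 ((m 1 : ℤ) - d).toNat) 2 ((m 2 : ℤ) + d).toNat

lemma shiftf_one (d : ℤ) (m : ℕ → ℕ) : shiftf d m 1 = ((m 1 : ℤ) - d).toNat := by
  simp [shiftf]
lemma shiftf_two (d : ℤ) (m : ℕ → ℕ) : shiftf d m 2 = ((m 2 : ℤ) + d).toNat := by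
  simp [shiftf]
lemma shiftf_other (d : ℤ) (m : ℕ → ℕ) (l : ℕ) (h1 : l ≠ 1) (h2 : l ≠ 2) :
    shiftf d m l = m l := by
  simp [shiftf, h1, h2]

lemma Icc_split (r : ℕ) (hr : 2 ≤ r) :
    Finset.Icc 1 r = insert 1 (insert 2 (Finset.Icc 3 r)) := by
  ext l; simp only [Finset.mem_Icc, Finset.mem_insert]; omega

lemma sum_split {M : Type*} [AddCommMonoid M] (r : ℕ) (hr : 2 ≤ r) (g : ℕ → M) :
    ∑ l ∈ Finset.Icc 1 r, g l = g 1 + (g 2 + ∑ l ∈ Finset.Icc 3 r, g l) := by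
  rw [Icc_split r hr, Finset.sum_insert (by simp), Finset.sum_insert (by simp)]

lemma prod_split {M : Type*} [CommMonoid M] (r : ℕ) (hr : 2 ≤ r) (g : ℕ → M) :
    ∏ l ∈ Finset.Icc 1 r, g l = g 1 * (g 2 * ∏ l ∈ Finset.Icc 3 r, g l) := by
  rw [Icc_split r hr, Finset.prod_insert (by simp), Finset.prod_insert (by simp)]

lemma shiftf_sum (r : ℕ) (hr : 2 ≤ r) (c : ℕ → ℕ) (d : ℤ) (m : ℕ → ℕ) (h1 : 0 ≤ (m 1 : ℤ) - d)
    (h2 : 0 ≤ (m 2 : ℤ) + d) :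
    ((∑ l ∈ Finset.Icc 1 r, c l * shiftf d m l : ℕ) : ℤ)
      = ((∑ l ∈ Finset.Icc 1 r, c l * m l : ℕ) : ℤ) + ((c 2 : ℤ) - c 1) * d := by
  rw [sum_split r hr, sum_split r hr, shiftf_one, shiftf_two]
  have : ∑ l ∈ Finset.Icc 3 r, c l * shiftf d m l = ∑ l ∈ Finset.Icc 3 r, c l * m l := by
    refine Finset.sum_congr rfl fun l hl => ?_
    rw [Finset.mem_Icc] at hl
    rw [shiftf_other d m l (by omega) (by omega)]
  rw [this]
  push_cast
  rw [Int.toNat_of_nonneg h1, Int.toNat_of_nonneg h2]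
  ring

lemma shiftf_Vw (r : ℕ) (hr : 2 ≤ r) (p : ℕ → ℝ) (hp : ∀ l, 0 ≤ p l) (δ y T : ℝ) (hδ : 0 < δ)
    (hp1 : δ ≤ p 1) (hp2 : δ ≤ p 2) (hy : 0 < y) (hT : 0 < T)
    (hyT : 4 * T ≤ δ * y) (m : ℕ → ℕ) (d : ℤ)
    (h1 : |(m 1 : ℝ) - y ^ 2 * p 1| ≤ T * y) (h2 : |(m 2 : ℝ) - y ^ 2 * p 2| ≤ T * y)
    (hd : |(d : ℝ)| ≤ T * y) (hd1 : 0 ≤ (m 1 : ℤ) - d) (hd2 : 0 ≤ (m 2 : ℤ) + d) :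
    Real.exp (-(8 * T ^ 2 / δ)) * Vw r p m ≤ Vw r p (shiftf d m) := by
  rw [abs_le] at h1 h2
  have key : Real.exp (-(8 * T ^ 2 / δ)) *
      (p 1 ^ m 1 / (m 1).factorial * (p 2 ^ m 2 / (m 2).factorial)) ≤
      p 1 ^ (shiftf d m 1) / (shiftf d m 1).factorial *
        (p 2 ^ (shiftf d m 2) / (shiftf d m 2).factorial) := by
    rw [shiftf_one, shiftf_two]
    rcases le_total 0 d with h | h
    · obtain ⟨e, rfl⟩ := Int.eq_ofNat_of_zero_le h
      have e1 : ((m 1 : ℤ) - (e:ℤ)).toNat = m 1 - e := by omega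
      have e2 : ((m 2 : ℤ) + (e:ℤ)).toNat = m 2 + e := by omega
      rw [e1, e2]
      refine pair_ratio _ _ δ y T hδ hp1 hp2 hy hT hyT _ _ e (by linarith) (by linarith) ?_
        (by omega)
      simpa using hd
    · obtain ⟨e, he⟩ := Int.eq_ofNat_of_zero_le (neg_nonneg.2 h)
      have he' : d = -(e:ℤ) := by omega
      subst he'
      have e1 : ((m 1 : ℤ) - -(e:ℤ)).toNat = m 1 + e := by omega
      have e2 : ((m 2 : ℤ) + -(e:ℤ)).toNat = m 2 - e := by omega
      rw [e1, e2]
      have := pair_ratio _ _ δ y T hδ hp2 hp1 hy hT hyT (m 2) (m 1) e (by linarith) (by linarith)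
        (by simpa using hd) (by omega)
      rw [mul_comm (p 1 ^ m 1 / _), mul_comm (p 1 ^ (m 1 + e) / _)]
      exact this
  rw [Vw, Vw, prod_split r hr, prod_split r hr, ← mul_assoc, ← mul_assoc, ← mul_assoc]
  have : ∏ l ∈ Finset.Icc 3 r, p l ^ shiftf d m l / ((shiftf d m l).factorial : ℝ)
      = ∏ l ∈ Finset.Icc 3 r, p l ^ m l / ((m l).factorial : ℝ) := by
    refine Finset.prod_congr rfl fun l hl => ?_
    rw [Finset.mem_Icc] at hl
    rw [shiftf_other d m l (by omega) (by omega)]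
  rw [this, mul_assoc (Real.exp _)]
  apply mul_le_mul_of_nonneg_right key
  exact Finset.prod_nonneg fun l _ => div_nonneg (pow_nonneg (hp l) _) (by positivity)

lemma shiftf_inj (d : ℤ) (m m' : ℕ → ℕ) (h1 : 0 ≤ (m 1 : ℤ) - d)
    (h2 : 0 ≤ (m 2 : ℤ) + d) (h1' : 0 ≤ (m' 1 : ℤ) - d) (h2' : 0 ≤ (m' 2 : ℤ) + d)
    (h : shiftf d m = shiftf d m') : m = m' := by
  funext l
  have hl := congrFun h l
  by_cases e1 : l = 1
  · subst e1; rw [shiftf_one, shiftf_one] at hl; omega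
  by_cases e2 : l = 2
  · subst e2; rw [shiftf_two, shiftf_two] at hl; omega
  rwa [shiftf_other _ _ _ e1 e2, shiftf_other _ _ _ e1 e2] at hl

/-- two-sided concentration -/
lemma conc2 (r k : ℕ) (p f : ℕ → ℝ) (R T : ℝ) (hR : 0 ≤ R) (hk : R ≤ √(k:ℝ)) (hk1 : 1 ≤ k)
    (hp : ∀ l, 0 ≤ p l) (hsum : ∑ l ∈ Finset.Icc 1 r, p l = 1)
    (hf : ∀ l ∈ Finset.Icc 1 r, |f l| ≤ R)
    (hf0 : ∑ l ∈ Finset.Icc 1 r, p l * f l = 0) :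
    ∑ m ∈ (Finset.piAntidiag (Finset.Icc 1 r) k).filter
        (fun m => T * √(k:ℝ) < |∑ l ∈ Finset.Icc 1 r, f l * m l|),
      (k.factorial : ℝ) * Vw r p m ≤ 2 * Real.exp (R ^ 2 - T) := by
  have a1 := conc r k p f R T hR hk hk1 hp hsum hf hf0
  have a2 := conc r k p (fun l => - f l) R T hR hk hk1 hp hsum (by simpa using hf)
    (by simpa using hf0)
  rw [two_mul]
  refine le_trans ?_ (add_le_add a1 a2)
  simp only [Finset.sum_filter]
  rw [← Finset.sum_add_distrib]
  refine Finset.sum_le_sum fun m _ => ?_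
  have h0 : 0 ≤ (k.factorial : ℝ) * Vw r p m :=
    mul_nonneg (by positivity) (Vw_nonneg r p hp m)
  simp only [neg_mul, Finset.sum_neg_distrib, lt_abs]
  split_ifs <;> first | linarith | (exfalso; tauto)

set_option maxHeartbeats 2000000 in
lemma llt (r : ℕ) (hr : 2 ≤ r) (δ : ℝ) (hδ : 0 < δ) :
    ∃ c : ℝ, 0 < c ∧ ∃ K : ℕ, ∀ k n : ℕ, K ≤ k → 1 ≤ k → ∀ p : ℕ → ℝ, (∀ l, 0 ≤ p l) →
      ∑ l ∈ Finset.Icc 1 r, p l = 1 → δ ≤ p 1 → δ ≤ p 2 →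
      (k:ℝ) * ∑ l ∈ Finset.Icc 1 r, p l * l = n →
      c / √(k:ℝ) ≤ ∑ m ∈ (Finset.piAntidiag (Finset.Icc 1 r) k).filter
        (fun m => ∑ l ∈ Finset.Icc 1 r, l * m l = n), (k.factorial : ℝ) * Vw r p m := by
  set T : ℝ := (r:ℝ) ^ 2 + 3 with hT
  have hT0 : 0 < T := by positivity
  set E := Real.exp (-(8 * T ^ 2 / δ)) with hE
  have hE0 : 0 < E := Real.exp_pos _
  refine ⟨E / (6 * T), by positivity, ⌈(4 * T / δ + T) ^ 2⌉₊, ?_⟩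
  intro k n hK hk1 p hp hsum hp1 hp2 hmean
  have hkpos : (0:ℝ) < k := by exact_mod_cast hk1
  set y := √(k:ℝ) with hy
  have hy0 : 0 < y := Real.sqrt_pos.2 hkpos
  have hyy : y ^ 2 = k := Real.sq_sqrt hkpos.le
  have hyK : 4 * T / δ + T ≤ y := Real.le_sqrt_of_sq_le (Nat.ceil_le.1 hK)
  have hTd : 0 < 4 * T / δ := by positivity
  have hyT : 4 * T ≤ δ * y := by
    have : 4 * T / δ ≤ y := by linarith
    rw [div_le_iff₀ hδ] at this; linarith
  have hr2 : (2:ℝ) ≤ r := by exact_mod_cast hr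
  have hry : (r:ℝ) ≤ y := by nlinarith
  have hy1 : 1 ≤ y := by nlinarith
  have hple : ∀ l ∈ Finset.Icc 1 r, p l ≤ 1 := fun l hl => by
    rw [← hsum]; exact Finset.single_le_sum (fun i _ => hp i) hl
  have m1 : 1 ∈ Finset.Icc 1 r := by simp; omega
  have m2 : 2 ∈ Finset.Icc 1 r := by simp; omega
  have hexp : Real.exp ((r:ℝ) ^ 2 - T) ≤ 1 / 12 := by
    have : (r:ℝ) ^ 2 - T = -3 := by rw [hT]; ring
    rw [this, Real.exp_neg, ← one_div]
    have h3 : (12:ℝ) ≤ Real.exp 3 := by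
      have h := Real.exp_one_gt_d9
      have e : Real.exp 3 = Real.exp 1 ^ 3 := by rw [← Real.exp_nat_mul]; norm_num
      have h' : (2.7:ℝ) ^ 3 ≤ Real.exp 1 ^ 3 := pow_le_pow_left₀ (by norm_num) (by linarith) 3
      rw [e]; norm_num at h' ⊢; linarith
    exact one_div_le_one_div_of_le (by norm_num) h3
  -- concentration of single counts
  have hsing : ∀ j ∈ Finset.Icc 1 r,
      ∑ m ∈ (Finset.piAntidiag (Finset.Icc 1 r) k).filter
        (fun m => T * y < |(m j : ℝ) - y ^ 2 * p j|), (k.factorial : ℝ) * Vw r p m ≤ 1 / 6 := by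
    intro j hj
    have h := conc2 r k p (fun l => (if l = j then 1 else 0) - p j) r T (by positivity) hry hk1 hp
      hsum ?_ ?_
    · refine le_trans (le_of_eq ?_) (h.trans (by linarith))
      refine Finset.sum_congr ?_ fun _ _ => rfl
      refine Finset.filter_congr fun m hm => ?_
      rw [Finset.mem_piAntidiag] at hm
      have : ∑ l ∈ Finset.Icc 1 r, ((if l = j then (1:ℝ) else 0) - p j) * m l
          = (m j : ℝ) - y ^ 2 * p j := by
        simp only [sub_mul, ite_mul, one_mul, zero_mul]
        rw [Finset.sum_sub_distrib, Finset.sum_ite_eq', if_pos hj, ← Finset.mul_sum, hyy, ← hm.1]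
        push_cast; ring
      rw [this]
    · intro l _
      have := hple j hj
      have := hp j
      rw [abs_le]; split_ifs <;> constructor <;> linarith
    · simp only [mul_sub, mul_ite, mul_one, mul_zero]
      rw [Finset.sum_sub_distrib, Finset.sum_ite_eq', if_pos hj, ← Finset.sum_mul, hsum]; ring
  have hmu : y ^ 2 * ∑ l ∈ Finset.Icc 1 r, p l * l = n := by rw [hyy]; exact hmean
  have hmu1 : 1 ≤ ∑ l ∈ Finset.Icc 1 r, p l * l := by
    rw [← hsum]; refine Finset.sum_le_sum fun l hl => ?_
    have : (1:ℝ) ≤ l := by exact_mod_cast (Finset.mem_Icc.1 hl).1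
    nlinarith [hp l]
  have hmur : ∑ l ∈ Finset.Icc 1 r, p l * l ≤ r := by
    calc _ ≤ ∑ l ∈ Finset.Icc 1 r, p l * r := by
          refine Finset.sum_le_sum fun l hl => ?_
          have : (l:ℝ) ≤ r := by exact_mod_cast (Finset.mem_Icc.1 hl).2
          exact mul_le_mul_of_nonneg_left this (hp l)
      _ = r := by rw [← Finset.sum_mul, hsum, one_mul]
  set μ := ∑ l ∈ Finset.Icc 1 r, p l * l with hμ
  have htot : ∑ m ∈ (Finset.piAntidiag (Finset.Icc 1 r) k).filter
        (fun m => T * y < |((∑ l ∈ Finset.Icc 1 r, l * m l : ℕ) : ℝ) - n|),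
        (k.factorial : ℝ) * Vw r p m ≤ 1 / 6 := by
    have h := conc2 r k p (fun l => (l:ℝ) - μ) r T (by positivity) hry hk1 hp
      hsum ?_ ?_
    · refine le_trans (le_of_eq ?_) (h.trans (by linarith))
      refine Finset.sum_congr ?_ fun _ _ => rfl
      refine Finset.filter_congr fun m hm => ?_
      rw [Finset.mem_piAntidiag] at hm
      have : ∑ l ∈ Finset.Icc 1 r, ((l:ℝ) - μ) * m l
          = ((∑ l ∈ Finset.Icc 1 r, l * m l : ℕ) : ℝ) - n := by
        simp only [sub_mul]
        rw [Finset.sum_sub_distrib, ← Finset.mul_sum, ← hmu, hyy, ← hm.1]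
        push_cast; ring
      rw [this]
    · intro l hl
      rw [Finset.mem_Icc] at hl
      have h1 : (1:ℝ) ≤ l := by exact_mod_cast hl.1
      have h2 : (l:ℝ) ≤ r := by exact_mod_cast hl.2
      rw [abs_le]; constructor <;> linarith
    · simp only [mul_sub]
      rw [Finset.sum_sub_distrib, ← Finset.sum_mul, hsum]; linarith
  have hall := pow_eq_Vw r k p
  rw [hsum, one_pow] at hall
  set P := Finset.piAntidiag (Finset.Icc 1 r) k with hP
  set good : Finset (ℕ → ℕ) := P.filter (fun m => |(m 1 : ℝ) - y ^ 2 * p 1| ≤ T * y ∧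
    |(m 2 : ℝ) - y ^ 2 * p 2| ≤ T * y ∧
    |((∑ l ∈ Finset.Icc 1 r, l * m l : ℕ) : ℝ) - n| ≤ T * y) with hgood
  have hW0 : ∀ m, 0 ≤ (k.factorial : ℝ) * Vw r p m := fun m =>
    mul_nonneg (by positivity) (Vw_nonneg r p hp m)
  have hhalf : 1 / 2 ≤ ∑ m ∈ good, (k.factorial : ℝ) * Vw r p m := by
    have h1 := hsing 1 m1
    have h2 := hsing 2 m2
    have : ∑ m ∈ P, (k.factorial : ℝ) * Vw r p m ≤ 
        (∑ m ∈ good, (k.factorial : ℝ) * Vw r p m) + 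
        (∑ m ∈ P.filter (fun m => T * y < |(m 1 : ℝ) - y ^ 2 * p 1|), (k.factorial : ℝ) * Vw r p m)
        + (∑ m ∈ P.filter (fun m => T * y < |(m 2 : ℝ) - y ^ 2 * p 2|),
            (k.factorial : ℝ) * Vw r p m)
        + (∑ m ∈ P.filter (fun m => T * y < |((∑ l ∈ Finset.Icc 1 r, l * m l : ℕ) : ℝ) - n|),
            (k.factorial : ℝ) * Vw r p m) := by
      simp only [hgood, Finset.sum_filter]
      rw [← Finset.sum_add_distrib, ← Finset.sum_add_distrib, ← Finset.sum_add_distrib]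
      refine Finset.sum_le_sum fun m _ => ?_
      have h0 := hW0 m
      simp only [← not_le]
      split_ifs <;> first | linarith | (exfalso; tauto)
    linarith
  -- fibre decomposition
  set S := ∑ m ∈ P.filter (fun m => ∑ l ∈ Finset.Icc 1 r, l * m l = n),
    (k.factorial : ℝ) * Vw r p m with hS
  set D : ℕ := ⌊T * y⌋₊ with hD
  have hDle : (D:ℝ) ≤ T * y := Nat.floor_le (by positivity)
  set dd : (ℕ → ℕ) → ℤ := fun m => (n:ℤ) - ((∑ l ∈ Finset.Icc 1 r, l * m l : ℕ) : ℤ) with hdd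
  have hddabs : ∀ m ∈ good, |((dd m : ℤ) : ℝ)| ≤ T * y := by
    intro m hm
    have := (Finset.mem_filter.1 hm).2.2.2
    rw [abs_sub_comm] at this
    simpa [hdd] using this
  have hmaps : ∀ m ∈ good, dd m ∈ Finset.Icc (-(D:ℤ)) D := by
    intro m hm
    have h := hddabs m hm
    have h1 : ((dd m).natAbs : ℝ) ≤ T * y := by
      rw [Nat.cast_natAbs]; push_cast; exact h
    have h2 : (dd m).natAbs ≤ D := Nat.le_floor h1
    rw [Finset.mem_Icc]; omega
  have hnn : ∀ m ∈ good, 0 ≤ (m 1 : ℤ) - dd m ∧ 0 ≤ (m 2 : ℤ) + dd m := by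
    intro m hm
    have hg := (Finset.mem_filter.1 hm).2
    have g1 := abs_le.1 hg.1
    have g2 := abs_le.1 hg.2.1
    have g3 := abs_le.1 (hddabs m hm)
    have k1 : 2 * (T * y) ≤ y ^ 2 * p 1 := by nlinarith
    have k2 : 2 * (T * y) ≤ y ^ 2 * p 2 := by nlinarith
    constructor
    · have : (0:ℝ) ≤ ((m 1 : ℤ) - dd m : ℤ) := by push_cast; linarith
      exact_mod_cast this
    · have : (0:ℝ) ≤ ((m 2 : ℤ) + dd m : ℤ) := by push_cast; linarith
      exact_mod_cast this
  have hfib : ∀ d ∈ Finset.Icc (-(D:ℤ)) D,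
      ∑ m ∈ good.filter (fun m => dd m = d), (k.factorial : ℝ) * Vw r p m ≤ S / E := by
    classical
    intro d _
    rw [le_div_iff₀ hE0, mul_comm, Finset.mul_sum]
    have hinj : Set.InjOn (shiftf d) (good.filter (fun m => dd m = d) : Finset (ℕ → ℕ)) := by
      intro m hm m' hm' he
      have hm := Finset.mem_filter.1 (Finset.mem_coe.1 hm)
      have hm' := Finset.mem_filter.1 (Finset.mem_coe.1 hm')
      have a := hnn m hm.1
      have b := hnn m' hm'.1
      rw [hm.2] at a
      rw [hm'.2] at b
      exact shiftf_inj d m m' a.1 a.2 b.1 b.2 he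
    calc _ ≤ ∑ m ∈ good.filter (fun m => dd m = d), (k.factorial : ℝ) * Vw r p (shiftf d m) := by
          refine Finset.sum_le_sum fun m hm => ?_
          have hm := Finset.mem_filter.1 hm
          have a := hnn m hm.1
          have hg := (Finset.mem_filter.1 hm.1).2
          have hab := hddabs m hm.1
          rw [hm.2] at a hab
          have := shiftf_Vw r hr p hp δ y T hδ hp1 hp2 hy0 hT0 hyT m d hg.1 hg.2.1 hab a.1 a.2
          rw [mul_left_comm]
          exact mul_le_mul_of_nonneg_left this (by positivity)
      _ = ∑ m ∈ (good.filter (fun m => dd m = d)).image (shiftf d),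
            (k.factorial : ℝ) * Vw r p m := by
          rw [Finset.sum_image hinj]
      _ ≤ S := by
          refine Finset.sum_le_sum_of_subset_of_nonneg ?_ fun m _ _ => hW0 m
          intro m' hm'
          obtain ⟨m, hm, rfl⟩ := Finset.mem_image.1 hm'
          have hm := Finset.mem_filter.1 hm
          have a := hnn m hm.1
          have hmP := (Finset.mem_filter.1 hm.1).1
          rw [hP, Finset.mem_piAntidiag] at hmP
          have hde := hm.2
          rw [hm.2] at a
          rw [Finset.mem_filter, hP, Finset.mem_piAntidiag]
          have s1 := shiftf_sum r hr (fun _ => 1) d m a.1 a.2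
          have s2 := shiftf_sum r hr (fun l => l) d m a.1 a.2
          simp only [one_mul] at s1
          refine ⟨⟨?_, ?_⟩, ?_⟩
          · have := hmP.1
            push_cast at s1
            zify
            zify at this
            simpa [this] using s1
          · intro l hl
            by_cases e1 : l = 1
            · rw [e1]; exact m1
            by_cases e2 : l = 2
            · rw [e2]; exact m2
            rw [shiftf_other _ _ _ e1 e2] at hl
            exact hmP.2 l hl
          · simp only [hdd] at hde
            push_cast at s2 hde
            zify
            linarith
  rw [← Finset.sum_fiberwise_of_maps_to hmaps] at hhalf
  have hfin := hhalf.trans (Finset.sum_le_sum hfib)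
  rw [Finset.sum_const, nsmul_eq_mul] at hfin
  have hcard : ((Finset.Icc (-(D:ℤ)) D).card : ℝ) ≤ 3 * T * y := by
    rw [Int.card_Icc]
    have : ((D:ℤ) + 1 - -(D:ℤ)).toNat = 2 * D + 1 := by omega
    rw [this]; push_cast
    nlinarith
  have hS0 : 0 ≤ S / E := div_nonneg (Finset.sum_nonneg fun m _ => hW0 m) hE0.le
  have h5 : 1 / 2 ≤ 3 * T * y * (S / E) := hfin.trans (mul_le_mul_of_nonneg_right hcard hS0)
  rw [div_div, div_le_iff₀ (by positivity)]
  have h6 : 3 * T * y * (S / E) = 3 * T * y * S / E := by ring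
  rw [h6, le_div_iff₀ hE0] at h5
  linarith

/-- tree weights -/
def wT (l : ℕ) : ℝ := (aTree l : ℝ) / (l.factorial : ℝ)

lemma wT_pos (l : ℕ) : 0 < wT l := by
  have : 0 < aTree l := by
    rcases Nat.eq_zero_or_pos l with rfl | h
    · simp [aTree]
    · exact pow_pos h _
  rw [wT]; positivity

lemma wT_one : wT 1 = 1 := by simp [wT, aTree]
lemma wT_two : wT 2 = 1 / 2 := by simp [wT, aTree]

lemma Fpoly_eq (r : ℕ) (s : ℝ) : Fpoly r s = ∑ l ∈ Finset.Icc 1 r, wT l * s ^ l := by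
  rw [Fpoly]; refine Finset.sum_congr rfl fun l _ => ?_
  rw [wT]; ring

lemma Qsum_eq (n k r : ℕ) :
    Qsum n k r = ∑ m ∈ (Finset.piAntidiag (Finset.Icc 1 r) k).filter
        (fun m => ∑ l ∈ Finset.Icc 1 r, l * m l = n), Vw r wT m := by
  rw [Qsum, ← finsum_mem_coe_finset]
  have : {m : ℕ → ℕ | (∀ l, m l ≠ 0 → l ∈ Finset.Icc 1 r) ∧
      (∑ l ∈ Finset.Icc 1 r, l * m l = n) ∧ (∑ l ∈ Finset.Icc 1 r, m l = k)}
      = ((Finset.piAntidiag (Finset.Icc 1 r) k).filter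
        (fun m => ∑ l ∈ Finset.Icc 1 r, l * m l = n) : Finset (ℕ → ℕ)) := by
    ext m
    simp only [Set.mem_ofPred_eq, Finset.mem_coe, Finset.mem_filter, Finset.mem_piAntidiag]
    tauto
  rw [this]
  rfl

lemma Fpoly_pos (r : ℕ) (hr : 2 ≤ r) (s : ℝ) (hs : 0 < s) : 0 < Fpoly r s := by
  rw [Fpoly_eq]
  refine Finset.sum_pos (fun l _ => mul_pos (wT_pos l) (pow_pos hs l)) ⟨1, by simp; omega⟩

lemma Qsum_pos (n k r : ℕ) (hk : 1 ≤ k) (h1 : k ≤ n) (h2 : n < r * k) : 0 < Qsum n k r := by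
  rw [Qsum_eq]
  refine Finset.sum_pos (fun m _ => Finset.prod_pos fun l _ =>
    div_pos (pow_pos (wT_pos l) _) (by positivity)) ?_
  have hq1 : 1 ≤ n / k := (Nat.one_le_div_iff (by omega)).2 h1
  have hq2 : n / k < r := Nat.div_lt_of_lt_mul (by rw [mul_comm]; exact h2)
  have ht : n % k < k := Nat.mod_lt _ (by omega)
  have hn := Nat.div_add_mod n k
  set q := n / k with hq
  set t := n % k with htt
  have a1 : q ∈ Finset.Icc 1 r := by simp; omega
  have a2 : q + 1 ∈ Finset.Icc 1 r := by simp; omega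
  refine ⟨fun l => (if l = q then k - t else 0) + (if l = q + 1 then t else 0), ?_⟩
  rw [Finset.mem_filter, Finset.mem_piAntidiag]
  refine ⟨⟨?_, ?_⟩, ?_⟩
  · rw [Finset.sum_add_distrib, Finset.sum_ite_eq', Finset.sum_ite_eq', if_pos a1, if_pos a2]
    omega
  · intro l hl
    by_cases e1 : l = q
    · rw [e1]; exact a1
    by_cases e2 : l = q + 1
    · rw [e2]; exact a2
    simp [e1, e2] at hl
  · simp only [mul_add, mul_ite, mul_zero]
    rw [Finset.sum_add_distrib, Finset.sum_ite_eq', Finset.sum_ite_eq', if_pos a1, if_pos a2]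
    obtain ⟨u, hu⟩ : ∃ u, k = u + t := ⟨k - t, by omega⟩
    rw [← hn]
    rw [hu, Nat.add_sub_cancel]; ring

lemma infF_nonneg (n k r : ℕ) (hr : 2 ≤ r) : 0 ≤ infF n k r := by
  rw [infF]
  exact Real.iInf_nonneg fun s => div_nonneg (pow_nonneg (Fpoly_pos r hr s s.2).le _)
    (pow_nonneg (le_of_lt s.2) _)

lemma infF_le (n k r : ℕ) (hr : 2 ≤ r) (s : ℝ) (hs : 0 < s) :
    infF n k r ≤ Fpoly r s ^ k / s ^ n := by
  rw [infF]
  refine ciInf_le (f := fun s : Set.Ioi (0:ℝ) => Fpoly r (s:ℝ) ^ k / (s:ℝ) ^ n) ⟨0, ?_⟩ ⟨s, hs⟩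
  rintro _ ⟨s, rfl⟩
  exact div_nonneg (pow_nonneg (Fpoly_pos r hr s s.2).le _)
    (pow_nonneg (le_of_lt s.2) _)

set_option maxHeartbeats 1000000 in
lemma tilt (r : ℕ) (hr : 2 ≤ r) (η : ℝ) (hη : 0 < η) :
    ∃ δ : ℝ, 0 < δ ∧ ∀ n k : ℕ, 1 ≤ k → (k : ℝ) < (1 - η) * n → (1 + η) * n < ((r : ℝ) * k) →
      ∃ s : ℝ, 0 < s ∧ δ ≤ wT 1 * s ^ 1 / Fpoly r s ∧ δ ≤ wT 2 * s ^ 2 / Fpoly r s ∧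
        (k:ℝ) * ∑ l ∈ Finset.Icc 1 r, wT l * s ^ l / Fpoly r s * l = n := by
  have hr2 : (2:ℝ) ≤ r := by exact_mod_cast hr
  set W := ∑ l ∈ Finset.Icc 1 r, wT l with hW
  have m1 : 1 ∈ Finset.Icc 1 r := by simp; omega
  have mr : r ∈ Finset.Icc 1 r := by simp; omega
  have hW0 : 0 < W := Finset.sum_pos (fun l _ => wT_pos l) ⟨1, m1⟩
  set A := η / (r * W + η) with hA
  have hden : 0 < r * W + η := by positivity
  have hA0 : 0 < A := by positivity
  have hA1 : A ≤ 1 := by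
    rw [hA, div_le_one hden]; nlinarith
  have hAW : A * (r * W) < η := by
    have : A * (r * W + η) = η := by rw [hA]; field_simp
    nlinarith
  set γ := (r:ℝ) - r / (1 + η) with hγ
  have hγ0 : 0 < γ := by
    rw [hγ, sub_pos, div_lt_iff₀ (by positivity)]; nlinarith
  have hwr := wT_pos r
  set B := r * W / (γ * wT r) + 1 with hB
  have hB1 : 1 ≤ B := by
    have : 0 ≤ r * W / (γ * wT r) := by positivity
    linarith
  have hB0 : 0 < B := by linarith
  have hBW : r * W < γ * wT r * B := by
    have : γ * wT r * B = r * W + γ * wT r := by rw [hB]; field_simp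
    have : 0 < γ * wT r := by positivity
    linarith
  have hFB := Fpoly_pos r hr B hB0
  refine ⟨min (A / Fpoly r B) (1 / 2 * A ^ 2 / Fpoly r B), by positivity, ?_⟩
  intro n k hk h1 h2
  have hk0 : (0:ℝ) < k := by exact_mod_cast hk
  have hn0 : (0:ℝ) ≤ n := by positivity
  have hη1 : 0 < 1 - η := by by_contra h; nlinarith
  set μ := (n:ℝ) / k with hμ
  have hkμ : (k:ℝ) * μ = n := by rw [hμ]; field_simp
  have hμ1 : 1 + η < μ := by
    rw [hμ, lt_div_iff₀ hk0]
    have e1 := mul_lt_mul_of_pos_left h1 (show 0 < 1 + η by linarith)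
    have e2 : 0 ≤ η ^ 2 * n := by positivity
    linarith
  have hμ2 : μ < r / (1 + η) := by
    rw [hμ, div_lt_div_iff₀ hk0 (by positivity)]; linarith
  have hμr : μ < r := by linarith
  have hcont : ContinuousOn (fun s : ℝ => ∑ l ∈ Finset.Icc 1 r, ((l:ℝ) - μ) * (wT l * s ^ l))
      (Set.Icc A B) := by fun_prop
  have hHA : ∑ l ∈ Finset.Icc 1 r, ((l:ℝ) - μ) * (wT l * A ^ l) ≤ 0 := by
    have : ∀ l ∈ Finset.Icc 1 r, ((l:ℝ) - μ) * (wT l * A ^ l)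
        ≤ wT l * (r * A ^ 2) + if l = 1 then -(η * A) else 0 := by
      intro l hl
      have hl := Finset.mem_Icc.1 hl
      have hw := wT_pos l
      split_ifs with e
      · subst e
        rw [wT_one]
        have : 0 ≤ r * A ^ 2 := by positivity
        have e1 : (1 - μ) * A ≤ (-η) * A := by
          apply mul_le_mul_of_nonneg_right _ hA0.le; linarith
        push_cast
        linarith
      · have hpow : A ^ l ≤ A ^ 2 := pow_le_pow_of_le_one hA0.le hA1 (by omega)
        have hlr : (l:ℝ) ≤ r := by exact_mod_cast hl.2
        have hAl : 0 < A ^ l := by positivity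
        calc _ ≤ (r:ℝ) * (wT l * A ^ l) := by
              apply mul_le_mul_of_nonneg_right _ (by positivity); linarith
          _ ≤ (r:ℝ) * (wT l * A ^ 2) := by gcongr
          _ = _ := by ring
    refine (Finset.sum_le_sum this).trans ?_
    rw [Finset.sum_add_distrib, Finset.sum_ite_eq', if_pos m1, ← Finset.sum_mul]
    have e1 := mul_le_mul_of_nonneg_right hAW.le hA0.le
    linarith
  have hHB : 0 ≤ ∑ l ∈ Finset.Icc 1 r, ((l:ℝ) - μ) * (wT l * B ^ l) := by
    have : ∀ l ∈ Finset.Icc 1 r, wT l * (-(r * B ^ (r - 1))) +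
        (if l = r then γ * (wT r * B ^ r) else 0) ≤ ((l:ℝ) - μ) * (wT l * B ^ l) := by
      intro l hl
      have hl := Finset.mem_Icc.1 hl
      have hw := wT_pos l
      split_ifs with e
      · subst e
        have a : γ * (wT l * B ^ l) ≤ ((l:ℝ) - μ) * (wT l * B ^ l) := by
          apply mul_le_mul_of_nonneg_right _ (by positivity); linarith
        have : 0 ≤ wT l * (l * B ^ (l - 1)) := by positivity
        linarith
      · have hpow : B ^ l ≤ B ^ (r - 1) := pow_le_pow_right₀ hB1 (by omega)
        have hl0 : (0:ℝ) ≤ l := by positivity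
        have a : (μ - l) * (wT l * B ^ l) ≤ r * (wT l * B ^ l) := by
          apply mul_le_mul_of_nonneg_right _ (by positivity); linarith
        have b : (r:ℝ) * (wT l * B ^ l) ≤ r * (wT l * B ^ (r - 1)) := by gcongr
        linarith
    refine le_trans ?_ (Finset.sum_le_sum this)
    rw [Finset.sum_add_distrib, Finset.sum_ite_eq', if_pos mr, ← Finset.sum_mul]
    obtain ⟨j, rfl⟩ : ∃ j, r = j + 1 := ⟨r - 1, by omega⟩
    rw [Nat.add_sub_cancel, pow_succ]
    have := mul_le_mul_of_nonneg_right hBW.le (pow_nonneg hB0.le j)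
    linarith
  obtain ⟨s, hs, hHs⟩ := intermediate_value_Icc (hA1.trans hB1) hcont ⟨hHA, hHB⟩
  have hs0 : 0 < s := hA0.trans_le hs.1
  have hFs := Fpoly_pos r hr s hs0
  have hFsB : Fpoly r s ≤ Fpoly r B := by
    rw [Fpoly_eq, Fpoly_eq]
    refine Finset.sum_le_sum fun l _ => ?_
    exact mul_le_mul_of_nonneg_left (pow_le_pow_left₀ hs0.le hs.2 l) (wT_pos l).le
  refine ⟨s, hs0, ?_, ?_, ?_⟩
  · refine (min_le_left _ _).trans ?_
    rw [wT_one, one_mul, pow_one]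
    exact div_le_div₀ hs0.le hs.1 hFs hFsB
  · refine (min_le_right _ _).trans ?_
    rw [wT_two]
    refine div_le_div₀ (by positivity) ?_ hFs hFsB
    have := pow_le_pow_left₀ hA0.le hs.1 2
    linarith
  · have e : ∑ l ∈ Finset.Icc 1 r, wT l * s ^ l * l = μ * Fpoly r s := by
      rw [Fpoly_eq, Finset.mul_sum, ← sub_eq_zero, ← Finset.sum_sub_distrib, ← hHs]
      exact Finset.sum_congr rfl fun l _ => by ring
    have e2 : ∑ l ∈ Finset.Icc 1 r, wT l * s ^ l / Fpoly r s * l = μ := by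
      have : ∀ l ∈ Finset.Icc 1 r, wT l * s ^ l / Fpoly r s * l = wT l * s ^ l * l / Fpoly r s :=
        fun l _ => by ring
      rw [Finset.sum_congr rfl this, ← Finset.sum_div, e]
      field_simp
    rw [e2, hkμ]

lemma Vw_tilt (n k r : ℕ) (s F : ℝ) (m : ℕ → ℕ)
    (hm : ∑ l ∈ Finset.Icc 1 r, m l = k) (hn : ∑ l ∈ Finset.Icc 1 r, l * m l = n) :
    Vw r (fun l => wT l * s ^ l / F) m = Vw r wT m * (s ^ n / F ^ k) := by
  rw [← hm, ← hn, ← Finset.prod_pow_eq_pow_sum, ← Finset.prod_pow_eq_pow_sum,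
    ← Finset.prod_div_distrib, Vw, Vw, ← Finset.prod_mul_distrib]
  refine Finset.prod_congr rfl fun l _ => ?_
  rw [div_pow, mul_pow, ← pow_mul]
  ring

lemma per_r (r : ℕ) (hr : 2 ≤ r) (η : ℝ) (hη : 0 < η) :
    ∃ c : ℝ, 0 < c ∧ ∀ n k : ℕ, 1 ≤ k → (k : ℝ) < (1 - η) * n → (1 + η) * n < ((r : ℝ) * k) →
        (c / Real.sqrt n) * ((1 / (k.factorial : ℝ)) * infF n k r) ≤ Qsum n k r := by
  obtain ⟨δ, hδ, htilt⟩ := tilt r hr η hη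
  obtain ⟨c₁, hc₁, K, hK⟩ := llt r hr δ hδ
  set G : ℕ → ℕ → ℝ := fun n k =>
    (1 / Real.sqrt n) * ((1 / (k.factorial : ℝ)) * infF n k r) with hG
  have hG0 : ∀ n k, 0 ≤ G n k := fun n k => by
    have := infF_nonneg n k r hr
    simp only [hG]; positivity
  have hQ0 : ∀ n k, 0 ≤ Qsum n k r := fun n k => by
    rw [Qsum_eq]; exact Finset.sum_nonneg fun m _ => Vw_nonneg r _ (fun l => (wT_pos l).le) m
  set M := ∑ x ∈ Finset.range (r * K) ×ˢ Finset.range K, G x.1 x.2 / Qsum x.1 x.2 r with hM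
  have hM0 : 0 ≤ M := Finset.sum_nonneg fun x _ => div_nonneg (hG0 _ _) (hQ0 _ _)
  have hc2 : 0 < 1 / (1 + M) := by positivity
  refine ⟨min c₁ (1 / (1 + M)), lt_min hc₁ hc2, ?_⟩
  intro n k hk h1 h2
  have hk0 : (0:ℝ) < k := by exact_mod_cast hk
  have hn0 : (0:ℝ) ≤ n := by positivity
  have hkn : k ≤ n := by
    have : (k:ℝ) ≤ n := by nlinarith
    exact_mod_cast this
  have hnr : n < r * k := by
    have : (n:ℝ) < r * k := by nlinarith
    exact_mod_cast this
  have hGe : ∀ c : ℝ, (c / Real.sqrt n) * ((1 / (k.factorial : ℝ)) * infF n k r) = c * G n k := by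
    intro c; simp only [hG]; ring
  rw [hGe]
  rcases lt_or_ge k K with hkK | hkK
  · have hQ := Qsum_pos n k r hk hkn hnr
    have hmem : (n, k) ∈ Finset.range (r * K) ×ˢ Finset.range K := by
      rw [Finset.mem_product, Finset.mem_range, Finset.mem_range]
      exact ⟨hnr.trans_le (Nat.mul_le_mul_left r hkK.le), hkK⟩
    have hle : G n k / Qsum n k r ≤ M :=
      Finset.single_le_sum (f := fun x : ℕ × ℕ => G x.1 x.2 / Qsum x.1 x.2 r)
        (fun x _ => div_nonneg (hG0 _ _) (hQ0 _ _)) hmem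
    rw [div_le_iff₀ hQ] at hle
    calc _ ≤ 1 / (1 + M) * G n k := mul_le_mul_of_nonneg_right (min_le_right _ _) (hG0 _ _)
      _ ≤ 1 / (1 + M) * ((1 + M) * Qsum n k r) := by
          apply mul_le_mul_of_nonneg_left _ hc2.le; linarith
      _ = _ := by field_simp
  · obtain ⟨s, hs, hp1, hp2, hmean⟩ := htilt n k hk h1 h2
    have hF := Fpoly_pos r hr s hs
    have hllt := hK k n hkK hk (fun l => wT l * s ^ l / Fpoly r s)
      (fun l => by have := wT_pos l; positivity)
      (by rw [← Finset.sum_div, ← Fpoly_eq]; field_simp) hp1 hp2 hmean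
    have hS : ∑ m ∈ (Finset.piAntidiag (Finset.Icc 1 r) k).filter
        (fun m => ∑ l ∈ Finset.Icc 1 r, l * m l = n),
        (k.factorial : ℝ) * Vw r (fun l => wT l * s ^ l / Fpoly r s) m
        = (k.factorial : ℝ) * (Qsum n k r * (s ^ n / Fpoly r s ^ k)) := by
      rw [Qsum_eq, Finset.sum_mul, Finset.mul_sum]
      refine Finset.sum_congr rfl fun m hm => ?_
      rw [Finset.mem_filter, Finset.mem_piAntidiag] at hm
      rw [Vw_tilt n k r s _ m hm.1.1 hm.2]
    rw [hS] at hllt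
    have hsq : c₁ / √(n:ℝ) ≤ c₁ / √(k:ℝ) := by
      apply div_le_div_of_nonneg_left hc₁.le (Real.sqrt_pos.2 hk0)
      exact Real.sqrt_le_sqrt (by exact_mod_cast hkn)
    have hinf := infF_le n k r hr s hs
    have hinf0 := infF_nonneg n k r hr
    have hX : 0 < Fpoly r s ^ k / s ^ n := by positivity
    calc _ ≤ c₁ * G n k := mul_le_mul_of_nonneg_right (min_le_left _ _) (hG0 _ _)
      _ = (c₁ / √(n:ℝ)) * ((1 / (k.factorial : ℝ)) * infF n k r) := (hGe _).symm
      _ ≤ ((k.factorial : ℝ) * (Qsum n k r * (s ^ n / Fpoly r s ^ k))) *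
          ((1 / (k.factorial : ℝ)) * (Fpoly r s ^ k / s ^ n)) := by
          apply mul_le_mul (hsq.trans hllt)
          · exact mul_le_mul_of_nonneg_left hinf (by positivity)
          · positivity
          · have := hQ0 n k
            positivity
      _ = _ := by
          have : (k.factorial : ℝ) ≠ 0 := by positivity
          field_simp

/-- For each `η > 0` there exist `n₀ < ∞` and a sequence
`(c_r)_{r≥1}` of positive reals such that for all `n ≥ n₀`, `k ≥ 1` and `r ≥ 2`
with `k < (1−η)n` and `rk > (1+η)n`, one has
`Q_{n,k,r} ≥ (c_r/√n) · (1/k!) · inf_{s>0} F_r(s)^k / s^n`. -/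
theorem stmt9 (η : ℝ) (hη : 0 < η) :
    ∃ n₀ : ℕ, ∃ c : ℕ → ℝ, (∀ r : ℕ, 1 ≤ r → 0 < c r) ∧
      ∀ n k r : ℕ, n₀ ≤ n → 1 ≤ k → 2 ≤ r →
        (k : ℝ) < (1 - η) * n → (1 + η) * n < ((r : ℝ) * k) →
        (c r / Real.sqrt n) * ((1 / (k.factorial : ℝ)) * infF n k r) ≤ Qsum n k r := by
  choose! c hc0 hc using fun (r : ℕ) (hr : 2 ≤ r) => per_r r hr η hη
  refine ⟨0, fun r => if 2 ≤ r then c r else 1, ?_, ?_⟩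
  · intro r _
    dsimp only
    split_ifs with h
    · exact hc0 r h
    · exact one_pos
  · intro n k r _ hk hr h1 h2
    simp only [if_pos hr]
    exact hc r hr n k hk h1 h2
end
end
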